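/- Assume N ≥ 3 and 1 + 4/(N−2) < p < 1 + 4/(N−3) (for N = 3 this means p > 5). For every integer n ≥ 0 there exist real numbers B̃_n with b_∞ < B̃_n < +∞ and C̃_n > 0, and a function u ∈ C²([0,1]) solving (PDE) on (0,1), such that u(0) = C̃_n, u′(0) = 0, u(1) = B̃_n, u > 0 on [0,1], and the function ρ ↦ u(ρ)/u_∞(ρ) − 1 has exactly 2n+1 zeros on (0,1). -/

import Mathlib

open Set Filter

noncomputable def alphaP (p : ℝ) : ℝ := 2 / (p - 1)

noncomputable def b0 (p : ℝ) : ℝ := (2 * (p + 1) / (p - 1) ^ 2) ^ ((1 : ℝ) / (p - 1))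

noncomputable def bInf (N : ℕ) (p : ℝ) : ℝ :=
  (alphaP p * ((N : ℝ) - 2 - alphaP p)) ^ (alphaP p / 2)

noncomputable def uInf (N : ℕ) (p : ℝ) (ρ : ℝ) : ℝ := bInf N p * ρ ^ (-(alphaP p))

/-- `u` solves `(1-ρ²)u'' + ((N-1)/ρ - 2(α+1)ρ)u' - α(α+1)u + |u|^{p-1}u = 0` on `s`. -/
def IsSolOn (N : ℕ) (p : ℝ) (u : ℝ → ℝ) (s : Set ℝ) : Prop :=
  ∀ ρ ∈ s,
    (1 - ρ ^ 2) * deriv (deriv u) ρ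
      + (((N : ℝ) - 1) / ρ - 2 * (alphaP p + 1) * ρ) * deriv u ρ
      - alphaP p * (alphaP p + 1) * u ρ + |u ρ| ^ (p - 1) * u ρ = 0

namespace SelfSimilar

open Real MeasureTheory Topology

/-- The weight `sinh ^ (-δ)` on the positive half-line, extended by zero. -/
noncomputable def wt (δ τ : ℝ) : ℝ := (max (sinh τ) 0) ^ (-δ)

/-- The solution operator of `(sinh ^ (-δ) z)' = sinh ^ (-δ) φ` that is regular at the origin. -/
noncomputable def avg (δ : ℝ) (φ : ℝ → ℝ) (s : ℝ) : ℝ :=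
  (max (sinh s) 0) ^ δ * ∫ τ in (0 : ℝ)..s, wt δ τ * φ τ

lemma wt_of_pos {δ τ : ℝ} (hτ : 0 < τ) : wt δ τ = sinh τ ^ (-δ) := by
  rw [wt, max_eq_left (sinh_nonneg_iff.2 hτ.le)]

lemma wt_nonneg (δ τ : ℝ) : 0 ≤ wt δ τ := rpow_nonneg (le_max_right _ _) _

lemma measurable_wt (δ : ℝ) : Measurable (wt δ) := by
  unfold wt; fun_prop

lemma wt_le_rpow {δ τ : ℝ} (hδ : 0 ≤ δ) (hτ : 0 < τ) : wt δ τ ≤ τ ^ (-δ) := by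
  rw [wt_of_pos hτ]
  exact rpow_le_rpow_of_nonpos hτ (self_le_sinh_iff.2 hτ.le) (by linarith)

lemma intervalIntegrable_wt {δ : ℝ} (h0 : 0 < δ) (h1 : δ < 1) (a b : ℝ) :
    IntervalIntegrable (wt δ) volume a b := by
  suffices h : ∀ c, IntervalIntegrable (wt δ) volume 0 c from (h a).symm.trans (h b)
  intro c
  have hr : IntervalIntegrable (fun τ : ℝ => τ ^ (-δ)) volume 0 c :=
    intervalIntegral.intervalIntegrable_rpow' (by linarith)
  refine hr.mono_fun (measurable_wt δ).aestronglyMeasurable ?_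
  refine Eventually.of_forall fun τ => ?_
  rcases le_or_gt τ 0 with hτ | hτ
  · have : wt δ τ = 0 := by
      rw [wt, max_eq_right (sinh_nonpos_iff.2 hτ), zero_rpow (by linarith)]
    show ‖wt δ τ‖ ≤ ‖τ ^ (-δ)‖
    rw [this, norm_zero]
    exact norm_nonneg _
  · show ‖wt δ τ‖ ≤ ‖τ ^ (-δ)‖
    rw [norm_of_nonneg (wt_nonneg δ τ), norm_of_nonneg (rpow_nonneg hτ.le _)]
    exact wt_le_rpow h0.le hτ

lemma intervalIntegrable_wt_mul {δ : ℝ} (h0 : 0 < δ) (h1 : δ < 1) {φ : ℝ → ℝ} (hφ : Continuous φ)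
    (a b : ℝ) : IntervalIntegrable (fun τ => wt δ τ * φ τ) volume a b :=
  (intervalIntegrable_wt h0 h1 a b).mul_continuousOn hφ.continuousOn

lemma continuous_avg {δ : ℝ} (h0 : 0 < δ) (h1 : δ < 1) {φ : ℝ → ℝ} (hφ : Continuous φ) :
    Continuous (avg δ φ) := by
  have := intervalIntegral.continuous_primitive (intervalIntegrable_wt_mul h0 h1 hφ) 0
  have h2 : Continuous fun s : ℝ => (max (sinh s) 0) ^ δ :=
    (continuous_sinh.max continuous_const).rpow_const fun _ => Or.inr h0.le
  exact h2.mul this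

lemma avg_sub {δ : ℝ} (h0 : 0 < δ) (h1 : δ < 1) {φ ψ : ℝ → ℝ} (hφ : Continuous φ)
    (hψ : Continuous ψ) (s : ℝ) : avg δ (fun τ => φ τ - ψ τ) s = avg δ φ s - avg δ ψ s := by
  simp only [avg, mul_sub]
  rw [intervalIntegral.integral_sub (intervalIntegrable_wt_mul h0 h1 hφ 0 s)
    (intervalIntegrable_wt_mul h0 h1 hψ 0 s), mul_sub]

lemma hasDerivAt_avg {δ : ℝ} (h0 : 0 < δ) (h1 : δ < 1) {φ : ℝ → ℝ} (hφ : Continuous φ) {s : ℝ}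
    (hs : 0 < s) : HasDerivAt (avg δ φ) (δ * (cosh s / sinh s) * avg δ φ s + φ s) s := by
  have hsinh : 0 < sinh s := sinh_pos_iff.2 hs
  have hc : ContinuousAt (fun τ => wt δ τ * φ τ) s := by
    refine ContinuousAt.mul ?_ hφ.continuousAt
    refine ContinuousAt.rpow_const (by fun_prop) (Or.inl ?_)
    rw [max_eq_left hsinh.le]; exact hsinh.ne'
  have hI := intervalIntegral.integral_hasDerivAt_right (intervalIntegrable_wt_mul h0 h1 hφ 0 s)
    (((measurable_wt δ).mul hφ.measurable).stronglyMeasurable.stronglyMeasurableAtFilter) hc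
  have hp : HasDerivAt (fun t : ℝ => (max (sinh t) 0) ^ δ) (cosh s * δ * sinh s ^ (δ - 1)) s := by
    refine ((hasDerivAt_sinh s).rpow_const (Or.inl hsinh.ne')).congr_of_eventuallyEq ?_
    filter_upwards [lt_mem_nhds hs] with t ht
    rw [max_eq_left (sinh_nonneg_iff.2 (le_of_lt ht))]
  refine (hp.mul hI).congr_deriv ?_
  rw [avg, wt_of_pos hs, max_eq_left hsinh.le, rpow_sub_one hsinh.ne', rpow_neg hsinh.le]
  have := (rpow_pos_of_pos hsinh δ).ne'
  field_simp

lemma abs_avg_le {δ : ℝ} (h0 : 0 < δ) (h1 : δ < 1) {φ : ℝ → ℝ} {s C : ℝ} (hs : 0 ≤ s)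
    (hφ : ∀ τ, 0 < τ → τ ≤ s → |φ τ| ≤ C) :
    |avg δ φ s| ≤ C / (1 - δ) * (s * cosh s) := by
  rcases hs.eq_or_lt with rfl | hs
  · simp [avg]
  have hC : 0 ≤ C := (abs_nonneg _).trans (hφ s hs le_rfl)
  have hb : ‖∫ τ in (0 : ℝ)..s, wt δ τ * φ τ‖ ≤ ∫ τ in (0 : ℝ)..s, C * τ ^ (-δ) := by
    refine intervalIntegral.norm_integral_le_of_norm_le hs.le (ae_of_all _ fun τ hτ => ?_)
      ((intervalIntegral.intervalIntegrable_rpow' (by linarith)).const_mul C)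
    rw [norm_mul, norm_of_nonneg (wt_nonneg δ τ), mul_comm, Real.norm_eq_abs]
    exact mul_le_mul (hφ τ hτ.1 hτ.2) (wt_le_rpow h0.le hτ.1) (wt_nonneg _ _) hC
  rw [intervalIntegral.integral_const_mul, integral_rpow (Or.inl (by linarith)),
    zero_rpow (by linarith), sub_zero, Real.norm_eq_abs] at hb
  have hsinh : 0 < sinh s := sinh_pos_iff.2 hs
  have hle : sinh s ^ δ ≤ s ^ δ * cosh s := by
    have h2 : sinh s ≤ s * cosh s := by
      have hm : MonotoneOn (fun x : ℝ => x * cosh x - sinh x) (Ici 0) := by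
        refine monotoneOn_of_deriv_nonneg (convex_Ici 0) (by fun_prop) (by fun_prop) ?_
        intro x hx
        rw [interior_Ici] at hx
        have hd : HasDerivAt (fun x : ℝ => x * cosh x - sinh x)
            (1 * cosh x + x * sinh x - cosh x) x :=
          ((hasDerivAt_id x).mul (hasDerivAt_cosh x)).sub (hasDerivAt_sinh x)
        rw [hd.deriv]
        have := mul_pos (mem_Ioi.1 hx) (sinh_pos_iff.2 (mem_Ioi.1 hx))
        linarith
      have := hm (mem_Ici.2 le_rfl) (mem_Ici.2 hs.le) hs.le
      simp at this; linarith
    calc sinh s ^ δ ≤ (s * cosh s) ^ δ := rpow_le_rpow hsinh.le h2 h0.le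
      _ = s ^ δ * cosh s ^ δ := mul_rpow hs.le (cosh_pos s).le
      _ ≤ s ^ δ * cosh s := by
        gcongr
        calc cosh s ^ δ ≤ cosh s ^ (1 : ℝ) := rpow_le_rpow_of_exponent_le (one_le_cosh s) h1.le
          _ = cosh s := rpow_one _
  rw [avg, max_eq_left hsinh.le, abs_mul, abs_of_nonneg (rpow_nonneg hsinh.le _)]
  calc sinh s ^ δ * |∫ τ in (0 : ℝ)..s, wt δ τ * φ τ|
      ≤ (s ^ δ * cosh s) * (C * (s ^ (-δ + 1) / (-δ + 1))) := by gcongr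
    _ = C / (1 - δ) * ((s ^ δ * s ^ (-δ + 1)) * cosh s) := by
      have : (1 - δ) ≠ 0 := by linarith
      have h2 : (-δ + 1) ≠ 0 := by linarith
      field_simp
      ring
    _ = _ := by rw [← rpow_add hs]; simp

/-- Weight `exp (c ∫₀ˢ σ cosh σ dσ)` absorbing the growth of solutions. -/
noncomputable def growth (c s : ℝ) : ℝ := exp (c * (s * sinh s - cosh s + 1))

lemma growth_pos (c s : ℝ) : 0 < growth c s := exp_pos _

lemma continuous_growth (c : ℝ) : Continuous (growth c) := by unfold growth; fun_prop

lemma growth_zero (c : ℝ) : growth c 0 = 1 := by simp [growth]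

lemma hasDerivAt_growth (c s : ℝ) :
    HasDerivAt (growth c) (c * (s * cosh s) * growth c s) s := by
  have h : HasDerivAt (fun s => c * (s * sinh s - cosh s + 1))
      (c * (1 * sinh s + s * cosh s - sinh s)) s :=
    ((((hasDerivAt_id s).mul (hasDerivAt_sinh s)).sub (hasDerivAt_cosh s)).add_const 1).const_mul c
  exact h.exp.congr_deriv (by rw [growth]; ring)

lemma growth_mono {c : ℝ} (hc : 0 ≤ c) : MonotoneOn (growth c) (Ici 0) := by
  refine monotoneOn_of_deriv_nonneg (convex_Ici 0) (continuous_growth c).continuousOn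
    (fun x _ => (hasDerivAt_growth c x).differentiableAt.differentiableWithinAt) fun x hx => ?_
  rw [interior_Ici] at hx
  rw [(hasDerivAt_growth c x).deriv]
  have := growth_pos c x
  have := cosh_pos x
  have : 0 < x := hx
  positivity

lemma abs_avg_le_growth {δ : ℝ} (h0 : 0 < δ) (h1 : δ < 1) {φ : ℝ → ℝ} {c C : ℝ} (hc : 0 ≤ c)
    (hC : 0 ≤ C) (hφ : ∀ τ, 0 ≤ τ → |φ τ| ≤ C * growth c τ) {s : ℝ} (hs : 0 ≤ s) :
    |avg δ φ s| ≤ C / (1 - δ) * (s * cosh s * growth c s) := by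
  have h := abs_avg_le h0 h1 hs (φ := φ) (C := C * growth c s) fun τ hτ hτs =>
    (hφ τ hτ.le).trans (mul_le_mul_of_nonneg_left (growth_mono hc (mem_Ici.2 hτ.le) (mem_Ici.2 hs) hτs) hC)
  exact h.trans_eq (by ring)

lemma abs_integral_avg_le {δ : ℝ} (h0 : 0 < δ) (h1 : δ < 1) {φ : ℝ → ℝ} {c C : ℝ} (hc : 0 < c)
    (hC : 0 ≤ C) (hφ : ∀ τ, 0 ≤ τ → |φ τ| ≤ C * growth c τ) {s : ℝ} (hs : 0 ≤ s) :
    |∫ σ in (0 : ℝ)..s, avg δ φ σ| ≤ C / (1 - δ) / c * growth c s := by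
  have h1' : 0 < 1 - δ := by linarith
  have hintg : Continuous fun σ => C / (1 - δ) / c * (c * (σ * cosh σ) * growth c σ) := by
    have := continuous_growth c; fun_prop
  have hb : ‖∫ σ in (0 : ℝ)..s, avg δ φ σ‖ ≤
      ∫ σ in (0 : ℝ)..s, C / (1 - δ) / c * (c * (σ * cosh σ) * growth c σ) := by
    refine intervalIntegral.norm_integral_le_of_norm_le hs (ae_of_all _ fun σ hσ => ?_)
      (hintg.intervalIntegrable _ _)
    refine (abs_avg_le_growth h0 h1 hc.le hC hφ hσ.1.le).trans_eq ?_
    field_simp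
  rw [intervalIntegral.integral_const_mul, intervalIntegral.integral_eq_sub_of_hasDerivAt
    (fun x _ => hasDerivAt_growth c x), growth_zero, Real.norm_eq_abs] at hb
  · refine hb.trans ?_
    have : 0 ≤ C / (1 - δ) / c := by positivity
    nlinarith
  · have := continuous_growth c
    exact Continuous.intervalIntegrable (by fun_prop) _ _

/-- `(y, z)` solves `y'' = δ coth(s) y' - g(y)` on `s > 0`, with `z = y'`, `y(0) = b` and
`y' = O(s)` at the origin. -/
structure RegSol (δ : ℝ) (g : ℝ → ℝ) (b : ℝ) (y z : ℝ → ℝ) : Prop where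
  cont_y : ContinuousOn y (Ici 0)
  cont_z : ContinuousOn z (Ici 0)
  y_zero : y 0 = b
  z_zero : z 0 = 0
  deriv_y : ∀ s, 0 < s → HasDerivAt y (z s) s
  deriv_z : ∀ s, 0 < s → HasDerivAt z (δ * (cosh s / sinh s) * z s - g (y s)) s
  bound_z : ∀ S, ∃ C, ∀ s, 0 ≤ s → s ≤ S → |z s| ≤ C * s

/-- Undo the normalisation of an element of the weighted space. -/
noncomputable def unweight (c : ℝ) (η : ℝ → ℝ) (s : ℝ) : ℝ := η s * growth c (max s 0)

lemma continuous_unweight {c : ℝ} {η : ℝ → ℝ} (hη : Continuous η) : Continuous (unweight c η) :=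
  hη.mul ((continuous_growth c).comp (by fun_prop))

lemma abs_unweight_le {c : ℝ} (η : BoundedContinuousFunction ℝ ℝ) (s : ℝ) (hs : 0 ≤ s) :
    |unweight c η s| ≤ ‖η‖ * growth c s := by
  rw [unweight, max_eq_left hs, abs_mul, abs_of_pos (growth_pos c s)]
  exact mul_le_mul_of_nonneg_right (η.norm_coe_le_norm s) (growth_pos _ _).le

section Contraction

variable {δ : ℝ} {g : ℝ → ℝ} {L : NNReal}

lemma abs_g_unweight_le (hg : LipschitzWith L g) (hg0 : g 0 = 0) {c : ℝ}
    (η : BoundedContinuousFunction ℝ ℝ) (s : ℝ) (hs : 0 ≤ s) :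
    |g (unweight c η s)| ≤ L * ‖η‖ * growth c s := by
  have h := hg.dist_le_mul (unweight c η s) 0
  rw [hg0, dist_zero_right, dist_zero_right, Real.norm_eq_abs, Real.norm_eq_abs] at h
  refine h.trans ?_
  rw [mul_assoc]
  exact mul_le_mul_of_nonneg_left (abs_unweight_le η s hs) L.coe_nonneg

lemma abs_g_unweight_sub_le (hg : LipschitzWith L g) {c : ℝ}
    (η ξ : BoundedContinuousFunction ℝ ℝ) (s : ℝ) (hs : 0 ≤ s) :
    |g (unweight c η s) - g (unweight c ξ s)| ≤ L * ‖η - ξ‖ * growth c s := by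
  have h := hg.dist_le_mul (unweight c η s) (unweight c ξ s)
  rw [Real.dist_eq, Real.dist_eq] at h
  refine h.trans ?_
  rw [mul_assoc]
  refine mul_le_mul_of_nonneg_left ?_ L.coe_nonneg
  have := abs_unweight_le (c := c) (η - ξ) s hs
  simpa [unweight, sub_mul] using this

/-- The growth rate making the Volterra operator a contraction. -/
noncomputable def rate (δ : ℝ) (L : NNReal) : ℝ := 2 * (L + 1) / (1 - δ)

lemma rate_pos (h1 : δ < 1) (L : NNReal) : 0 < rate δ L := by
  have : 0 < 1 - δ := by linarith
  have := L.coe_nonneg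
  unfold rate; positivity

lemma div_rate_le (h1 : δ < 1) (L : NNReal) {x : ℝ} (hx : 0 ≤ x) :
    L * x / (1 - δ) / rate δ L ≤ x / 2 := by
  have : 0 < 1 - δ := by linarith
  have hL : (0 : ℝ) ≤ L := L.coe_nonneg
  have hL1 : (0 : ℝ) < L + 1 := by linarith
  rw [rate]
  have e : (L : ℝ) * x / (1 - δ) / (2 * (L + 1) / (1 - δ)) = x / 2 * (L / (L + 1)) := by
    field_simp
  rw [e]
  have : (L : ℝ) / (L + 1) ≤ 1 := by rw [div_le_one hL1]; linarith
  nlinarith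

/-- The underlying function of the weighted Volterra operator. -/
noncomputable def volterraFun (δ : ℝ) (g : ℝ → ℝ) (c b : ℝ) (η : ℝ → ℝ) (s : ℝ) : ℝ :=
  (b - ∫ σ in (0 : ℝ)..(max s 0), avg δ (fun τ => g (unweight c η τ)) σ) / growth c (max s 0)

lemma continuous_volterraFun (h0 : 0 < δ) (h1 : δ < 1) (hg : Continuous g) (c b : ℝ) {η : ℝ → ℝ}
    (hη : Continuous η) : Continuous (volterraFun δ g c b η) := by
  have ha := continuous_avg h0 h1 (hg.comp (continuous_unweight (c := c) hη))
  have hp := intervalIntegral.continuous_primitive (μ := volume)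
    (fun a b => ha.intervalIntegrable a b) 0
  have hm : Continuous fun s : ℝ => max s 0 := by fun_prop
  exact (continuous_const.sub (hp.comp hm)).div ((continuous_growth c).comp hm)
    fun s => (growth_pos _ _).ne'

lemma abs_volterraFun_le (h0 : 0 < δ) (h1 : δ < 1) (hg : LipschitzWith L g) (hg0 : g 0 = 0)
    (b : ℝ) (η : BoundedContinuousFunction ℝ ℝ) (s : ℝ) :
    ‖volterraFun δ g (rate δ L) b η s‖ ≤ |b| + ‖η‖ / 2 := by
  have hm : (0 : ℝ) ≤ max s 0 := le_max_right _ _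
  have hc := rate_pos h1 L
  have h := abs_integral_avg_le h0 h1 hc (mul_nonneg L.coe_nonneg (norm_nonneg η))
    (abs_g_unweight_le hg hg0 (c := rate δ L) η) hm
  have hw := growth_pos (rate δ L) (max s 0)
  have hw1 : 1 ≤ growth (rate δ L) (max s 0) := by
    rw [← growth_zero (rate δ L)]
    exact growth_mono hc.le (mem_Ici.2 le_rfl) (mem_Ici.2 hm) hm
  rw [volterraFun, norm_div, norm_of_nonneg hw.le, div_le_iff₀ hw, Real.norm_eq_abs]
  refine (abs_sub _ _).trans ?_
  have h2 := div_rate_le h1 L (norm_nonneg η)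
  have h3 := mul_le_mul_of_nonneg_right h2 hw.le
  have h4 : |b| ≤ |b| * growth (rate δ L) (max s 0) := le_mul_of_one_le_right (abs_nonneg _) hw1
  rw [add_mul]
  exact add_le_add h4 (h.trans h3)

/-- The weighted Volterra operator whose fixed point is the regular solution. -/
noncomputable def volterra (h0 : 0 < δ) (h1 : δ < 1) (hg : LipschitzWith L g) (hg0 : g 0 = 0)
    (b : ℝ) (η : BoundedContinuousFunction ℝ ℝ) : BoundedContinuousFunction ℝ ℝ :=
  BoundedContinuousFunction.ofNormedAddCommGroup (volterraFun δ g (rate δ L) b η)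
    (continuous_volterraFun h0 h1 hg.continuous _ _ η.continuous) _
    (abs_volterraFun_le h0 h1 hg hg0 b η)

lemma contracting_volterra (h0 : 0 < δ) (h1 : δ < 1) (hg : LipschitzWith L g) (hg0 : g 0 = 0)
    (b : ℝ) : ContractingWith (1 / 2) (volterra h0 h1 hg hg0 b) := by
  refine ⟨by rw [← NNReal.coe_lt_coe]; norm_num, LipschitzWith.of_dist_le_mul fun η ξ => ?_⟩
  rw [BoundedContinuousFunction.dist_le (by positivity)]
  intro s
  have hm : (0 : ℝ) ≤ max s 0 := le_max_right _ _
  have hc := rate_pos h1 L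
  have hη : Continuous fun τ => g (unweight (rate δ L) η τ) :=
    hg.continuous.comp (continuous_unweight η.continuous)
  have hξ : Continuous fun τ => g (unweight (rate δ L) ξ τ) :=
    hg.continuous.comp (continuous_unweight ξ.continuous)
  have h := abs_integral_avg_le h0 h1 hc (mul_nonneg L.coe_nonneg (norm_nonneg (η - ξ)))
    (abs_g_unweight_sub_le hg (c := rate δ L) η ξ) hm
  have e : ∀ σ, avg δ (fun τ => g (unweight (rate δ L) η τ) - g (unweight (rate δ L) ξ τ)) σ =
      avg δ (fun τ => g (unweight (rate δ L) η τ)) σ -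
      avg δ (fun τ => g (unweight (rate δ L) ξ τ)) σ := avg_sub h0 h1 hη hξ
  simp only [e] at h
  rw [intervalIntegral.integral_sub ((continuous_avg h0 h1 hη).intervalIntegrable _ _)
    ((continuous_avg h0 h1 hξ).intervalIntegrable _ _)] at h
  have hw := growth_pos (rate δ L) (max s 0)
  show dist (volterraFun δ g (rate δ L) b η s) (volterraFun δ g (rate δ L) b ξ s) ≤ _
  rw [Real.dist_eq, volterraFun, volterraFun, ← sub_div, abs_div, abs_of_pos hw, div_le_iff₀ hw,
    sub_sub_sub_cancel_left, abs_sub_comm]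
  refine h.trans ?_
  rw [dist_eq_norm]
  have := mul_le_mul_of_nonneg_right (div_rate_le h1 L (norm_nonneg (η - ξ))) hw.le
  refine this.trans_eq ?_
  push_cast
  ring

/-- The weighted regular solution. -/
noncomputable def fixedW (h0 : 0 < δ) (h1 : δ < 1) (hg : LipschitzWith L g) (hg0 : g 0 = 0)
    (b : ℝ) : BoundedContinuousFunction ℝ ℝ :=
  ContractingWith.fixedPoint _ (contracting_volterra h0 h1 hg hg0 b)

lemma dist_fixedW_le (h0 : 0 < δ) (h1 : δ < 1) (hg : LipschitzWith L g) (hg0 : g 0 = 0)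
    (b b' : ℝ) : ‖fixedW h0 h1 hg hg0 b - fixedW h0 h1 hg hg0 b'‖ ≤ 2 * |b - b'| := by
  rw [← dist_eq_norm]
  have h := (contracting_volterra h0 h1 hg hg0 b).dist_fixedPoint_fixedPoint_of_dist_le'
    (volterra h0 h1 hg hg0 b')
    (ContractingWith.fixedPoint_isFixedPt (contracting_volterra h0 h1 hg hg0 b))
    (ContractingWith.fixedPoint_isFixedPt (contracting_volterra h0 h1 hg hg0 b'))
    (C := |b - b'|) ?_
  · refine h.trans_eq ?_
    simp; ring
  · intro η
    rw [BoundedContinuousFunction.dist_le (abs_nonneg _)]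
    intro s
    have hm : (0 : ℝ) ≤ max s 0 := le_max_right _ _
    have hc := rate_pos h1 L
    have hw := growth_pos (rate δ L) (max s 0)
    have hw1 : 1 ≤ growth (rate δ L) (max s 0) := by
      rw [← growth_zero (rate δ L)]
      exact growth_mono hc.le (mem_Ici.2 le_rfl) (mem_Ici.2 hm) hm
    show dist (volterraFun δ g (rate δ L) b η s) (volterraFun δ g (rate δ L) b' η s) ≤ _
    rw [Real.dist_eq, volterraFun, volterraFun, ← sub_div, abs_div, abs_of_pos hw, div_le_iff₀ hw,
      sub_sub_sub_cancel_right]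
    exact le_mul_of_one_le_right (abs_nonneg _) hw1

/-- The regular solution with initial value `b`. -/
noncomputable def solY (h0 : 0 < δ) (h1 : δ < 1) (hg : LipschitzWith L g) (hg0 : g 0 = 0)
    (b : ℝ) : ℝ → ℝ := unweight (rate δ L) (fixedW h0 h1 hg hg0 b)

/-- The derivative of the regular solution. -/
noncomputable def solZ (h0 : 0 < δ) (h1 : δ < 1) (hg : LipschitzWith L g) (hg0 : g 0 = 0)
    (b s : ℝ) : ℝ := -avg δ (fun τ => g (solY h0 h1 hg hg0 b τ)) s

lemma continuous_solY (h0 : 0 < δ) (h1 : δ < 1) (hg : LipschitzWith L g) (hg0 : g 0 = 0)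
    (b : ℝ) : Continuous (solY h0 h1 hg hg0 b) :=
  continuous_unweight (fixedW h0 h1 hg hg0 b).continuous

lemma continuous_solZ (h0 : 0 < δ) (h1 : δ < 1) (hg : LipschitzWith L g) (hg0 : g 0 = 0)
    (b : ℝ) : Continuous (solZ h0 h1 hg hg0 b) :=
  (continuous_avg h0 h1 (hg.continuous.comp (continuous_solY h0 h1 hg hg0 b))).neg

lemma solY_eq (h0 : 0 < δ) (h1 : δ < 1) (hg : LipschitzWith L g) (hg0 : g 0 = 0)
    (b : ℝ) {s : ℝ} (hs : 0 ≤ s) :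
    solY h0 h1 hg hg0 b s =
      b - ∫ σ in (0 : ℝ)..s, avg δ (fun τ => g (solY h0 h1 hg hg0 b τ)) σ := by
  have h := ContractingWith.fixedPoint_isFixedPt (contracting_volterra h0 h1 hg hg0 b)
  have h2 : volterraFun δ g (rate δ L) b (fixedW h0 h1 hg hg0 b) s = fixedW h0 h1 hg hg0 b s :=
    DFunLike.congr_fun h s
  rw [volterraFun, max_eq_left hs, div_eq_iff (growth_pos _ _).ne'] at h2
  have h3 : solY h0 h1 hg hg0 b s = fixedW h0 h1 hg hg0 b s * growth (rate δ L) s := by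
    rw [solY, unweight, max_eq_left hs]
  rw [h3, ← h2]; rfl

lemma regSol_sol (h0 : 0 < δ) (h1 : δ < 1) (hg : LipschitzWith L g) (hg0 : g 0 = 0)
    (b : ℝ) : RegSol δ g b (solY h0 h1 hg hg0 b) (solZ h0 h1 hg hg0 b) where
  cont_y := (continuous_solY h0 h1 hg hg0 b).continuousOn
  cont_z := (continuous_solZ h0 h1 hg hg0 b).continuousOn
  y_zero := by rw [solY_eq _ _ _ _ _ le_rfl]; simp
  z_zero := by simp [solZ, avg]
  deriv_y s hs := by
    have hc := continuous_avg h0 h1 (hg.continuous.comp (continuous_solY h0 h1 hg hg0 b))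
    have h := (intervalIntegral.integral_hasDerivAt_right (hc.intervalIntegrable 0 s)
      (hc.stronglyMeasurableAtFilter _ _) hc.continuousAt).const_sub b
    refine h.congr_of_eventuallyEq ?_
    filter_upwards [lt_mem_nhds hs] with t ht
    exact solY_eq h0 h1 hg hg0 b (le_of_lt ht)
  deriv_z s hs := by
    have h := (hasDerivAt_avg h0 h1
      (hg.continuous.comp (continuous_solY h0 h1 hg hg0 b)) hs).neg
    refine h.congr_deriv ?_
    rw [solZ]; simp only [Function.comp_def]; ring
  bound_z S := by
    obtain ⟨C, hC⟩ := (isCompact_Icc (a := (0 : ℝ)) (b := S)).exists_bound_of_continuousOn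
      (hg.continuous.comp (continuous_solY h0 h1 hg hg0 b)).continuousOn
    refine ⟨C / (1 - δ) * cosh S, fun s hs hsS => ?_⟩
    have h := abs_avg_le h0 h1 (φ := fun τ => g (solY h0 h1 hg hg0 b τ)) (C := C) hs
      fun τ hτ hτs => hC τ ⟨hτ.le, hτs.trans hsS⟩
    have hC0 : 0 ≤ C := (norm_nonneg _).trans (hC 0 ⟨le_rfl, hs.trans hsS⟩)
    have h1' : 0 < 1 - δ := by linarith
    rw [solZ, abs_neg]
    refine h.trans ?_
    have : cosh s ≤ cosh S := by
      rw [cosh_le_cosh, abs_of_nonneg hs, abs_of_nonneg (hs.trans hsS)]; exact hsS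
    calc C / (1 - δ) * (s * cosh s) ≤ C / (1 - δ) * (s * cosh S) := by gcongr
      _ = _ := by ring

lemma sol_lipschitz (h0 : 0 < δ) (h1 : δ < 1) (hg : LipschitzWith L g) (hg0 : g 0 = 0) (S : ℝ) :
    ∃ C, 0 ≤ C ∧ ∀ b b' s, 0 ≤ s → s ≤ S →
      |solY h0 h1 hg hg0 b s - solY h0 h1 hg hg0 b' s| ≤ C * |b - b'| ∧
      |solZ h0 h1 hg hg0 b s - solZ h0 h1 hg hg0 b' s| ≤ C * |b - b'| * s := by
  have h1' : 0 < 1 - δ := by linarith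
  have hL : (0 : ℝ) ≤ L := L.coe_nonneg
  set c := rate δ L with hcdef
  have hc := rate_pos h1 L
  have hW := growth_pos c S
  have hcS := cosh_pos S
  refine ⟨2 * growth c S + 2 * L / (1 - δ) * (cosh S * growth c S), by positivity,
    fun b b' s hs hsS => ?_⟩
  have hd := dist_fixedW_le h0 h1 hg hg0 b b'
  have hmono : growth c s ≤ growth c S :=
    growth_mono hc.le (mem_Ici.2 hs) (mem_Ici.2 (hs.trans hsS)) hsS
  have hcosh : cosh s ≤ cosh S := by
    rw [cosh_le_cosh, abs_of_nonneg hs, abs_of_nonneg (hs.trans hsS)]; exact hsS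
  have hws := growth_pos c s
  have hcs := cosh_pos s
  constructor
  · have h := abs_unweight_le (c := c) (fixedW h0 h1 hg hg0 b - fixedW h0 h1 hg hg0 b') s hs
    have h' : |solY h0 h1 hg hg0 b s - solY h0 h1 hg hg0 b' s| ≤
        ‖fixedW h0 h1 hg hg0 b - fixedW h0 h1 hg hg0 b'‖ * growth c s := by
      simpa [solY, unweight, sub_mul] using h
    calc _ ≤ _ := h'
      _ ≤ (2 * |b - b'|) * growth c S := by gcongr
      _ = (2 * growth c S) * |b - b'| := by ring
      _ ≤ _ := by
        gcongr
        have : 0 ≤ 2 * (L : ℝ) / (1 - δ) * (cosh S * growth c S) := by positivity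
        linarith
  · have hη := hg.continuous.comp (continuous_solY h0 h1 hg hg0 b)
    have hξ := hg.continuous.comp (continuous_solY h0 h1 hg hg0 b')
    have h := abs_avg_le_growth h0 h1 hc.le (mul_nonneg hL (norm_nonneg
      (fixedW h0 h1 hg hg0 b - fixedW h0 h1 hg hg0 b')))
      (abs_g_unweight_sub_le hg (c := c) (fixedW h0 h1 hg hg0 b) (fixedW h0 h1 hg hg0 b')) hs
    have e := avg_sub h0 h1 hη hξ s
    simp only [Function.comp_def] at e
    change |avg δ (fun τ => g (solY h0 h1 hg hg0 b τ) - g (solY h0 h1 hg hg0 b' τ)) s| ≤ _ at h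
    rw [e, abs_sub_comm] at h
    rw [solZ, solZ, neg_sub_neg]
    calc _ ≤ _ := h
      _ ≤ L * (2 * |b - b'|) / (1 - δ) * (s * cosh S * growth c S) := by gcongr
      _ = (2 * L / (1 - δ) * (cosh S * growth c S)) * |b - b'| * s := by ring
      _ ≤ _ := by
        gcongr
        linarith

lemma RegSol.eq_sol (h0 : 0 < δ) (h1 : δ < 1) (hg : LipschitzWith L g) (hg0 : g 0 = 0)
    {b : ℝ} {y z : ℝ → ℝ} (hy : Continuous y) (hyW : ∃ C, ∀ s, |y s| ≤ C)
    (h : RegSol δ g b y z) {s : ℝ} (hs : 0 ≤ s) : y s = solY h0 h1 hg hg0 b s := by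
  set c := rate δ L with hcdef
  have hc := rate_pos h1 L
  have hgy : Continuous fun τ => g (y τ) := hg.continuous.comp hy
  have hz : ∀ t, 0 < t → z t = -avg δ (fun τ => g (y τ)) t := by
    intro t ht
    have hintg := intervalIntegrable_wt_mul h0 h1 hgy 0 t
    set q : ℝ → ℝ := fun τ => wt δ τ * z τ with hq
    have hqc : ContinuousOn q (Icc 0 t) := by
      intro τ hτ
      rcases hτ.1.eq_or_lt with rfl | hτ0
      · obtain ⟨C, hC⟩ := h.bound_z t
        have hq0 : q 0 = 0 := by simp [hq, h.z_zero]
        rw [ContinuousWithinAt, hq0]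
        have hlim : Tendsto (fun τ : ℝ => C * |τ| ^ (1 - δ)) (𝓝[Icc 0 t] 0) (𝓝 0) := by
          have : Continuous fun τ : ℝ => C * |τ| ^ (1 - δ) :=
            continuous_const.mul (continuous_abs.rpow_const fun _ => Or.inr (by linarith))
          have h2 := (this.tendsto 0).mono_left (nhdsWithin_le_nhds (s := Icc 0 t))
          simpa [zero_rpow (show 1 - δ ≠ 0 by linarith)] using h2
        refine squeeze_zero_norm' ?_ hlim
        filter_upwards [self_mem_nhdsWithin] with τ hτ
        rcases hτ.1.eq_or_lt with rfl | hτ0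
        · rw [hq0]; simp [zero_rpow (show 1 - δ ≠ 0 by linarith)]
        · rw [hq, norm_mul, norm_of_nonneg (wt_nonneg _ _), Real.norm_eq_abs, abs_of_pos hτ0]
          calc wt δ τ * |z τ| ≤ τ ^ (-δ) * (C * τ) :=
                mul_le_mul (wt_le_rpow h0.le hτ0) (hC τ hτ.1 hτ.2) (abs_nonneg _)
                  (rpow_nonneg hτ0.le _)
            _ = C * (τ ^ (-δ) * τ ^ (1 : ℝ)) := by rw [rpow_one]; ring
            _ = _ := by rw [← rpow_add hτ0]; congr 2; ring
      · refine ContinuousAt.continuousWithinAt ?_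
        refine ContinuousAt.mul ?_ (h.deriv_z τ hτ0).continuousAt
        refine ContinuousAt.rpow_const (by fun_prop) (Or.inl ?_)
        rw [max_eq_left (sinh_nonneg_iff.2 hτ0.le)]; exact (sinh_pos_iff.2 hτ0).ne'
    have hqd : ∀ τ ∈ Ioo 0 t, HasDerivAt q (-(wt δ τ * g (y τ))) τ := by
      intro τ hτ
      have hsinh : 0 < sinh τ := sinh_pos_iff.2 hτ.1
      have hp : HasDerivAt (wt δ) (cosh τ * (-δ) * sinh τ ^ (-δ - 1)) τ := by
        refine ((hasDerivAt_sinh τ).rpow_const (Or.inl hsinh.ne')).congr_of_eventuallyEq ?_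
        filter_upwards [lt_mem_nhds hτ.1] with t ht
        rw [wt_of_pos ht]
      refine (hp.mul (h.deriv_z τ hτ.1)).congr_deriv ?_
      rw [wt_of_pos hτ.1, rpow_sub_one hsinh.ne']
      field_simp
      ring
    have e := intervalIntegral.integral_eq_sub_of_hasDerivAt_of_le ht.le hqc hqd hintg.neg
    rw [intervalIntegral.integral_neg] at e
    have hq0 : q 0 = 0 := by simp [hq, h.z_zero]
    rw [hq0, sub_zero] at e
    have hsinh : 0 < sinh t := sinh_pos_iff.2 ht
    have e2 : (∫ τ in (0 : ℝ)..t, wt δ τ * g (y τ)) = - (wt δ t * z t) := by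
      linarith
    rw [avg, e2, max_eq_left hsinh.le, wt_of_pos ht, rpow_neg hsinh.le]
    have := (rpow_pos_of_pos hsinh δ).ne'
    field_simp
  have hyint : ∀ t, 0 ≤ t → y t = b - ∫ σ in (0 : ℝ)..t, avg δ (fun τ => g (y τ)) σ := by
    intro t ht
    have hc := continuous_avg h0 h1 hgy
    have e := intervalIntegral.integral_eq_sub_of_hasDerivAt_of_le ht
      (hy.continuousOn (s := Icc 0 t))
      (fun x hx => by
        have := h.deriv_y x hx.1
        rw [hz x hx.1] at this; exact this) (hc.neg.intervalIntegrable 0 t)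
    have e3 := intervalIntegral.integral_neg (μ := volume) (a := 0) (b := t)
      (f := avg δ fun τ => g (y τ))
    rw [h.y_zero] at e
    simp only [Pi.neg_apply] at e
    linarith
  obtain ⟨C, hC⟩ := hyW
  have hm : Continuous fun s : ℝ => max s 0 := by fun_prop
  let η : BoundedContinuousFunction ℝ ℝ := BoundedContinuousFunction.ofNormedAddCommGroup
    (fun s => y (max s 0) / growth c (max s 0))
    ((hy.comp hm).div ((continuous_growth c).comp hm) fun s => (growth_pos _ _).ne') C
    (fun s => by
      have hw := growth_pos c (max s 0)
      have hw1 : 1 ≤ growth c (max s 0) := by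
        rw [← growth_zero c]
        exact growth_mono hc.le (mem_Ici.2 le_rfl) (mem_Ici.2 (le_max_right _ _)) (le_max_right _ _)
      rw [norm_div, norm_of_nonneg hw.le, div_le_iff₀ hw, Real.norm_eq_abs]
      have := hC (max s 0)
      exact this.trans (le_mul_of_one_le_right ((abs_nonneg _).trans this) hw1))
  have hηy : ∀ τ, 0 ≤ τ → unweight c η τ = y τ := by
    intro τ hτ
    show y (max τ 0) / growth c (max τ 0) * growth c (max τ 0) = y τ
    rw [div_mul_cancel₀ _ (growth_pos _ _).ne', max_eq_left hτ]
  have havg : ∀ σ, 0 ≤ σ → avg δ (fun τ => g (unweight c η τ)) σ = avg δ (fun τ => g (y τ)) σ := by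
    intro σ hσ
    unfold avg
    congr 1
    refine intervalIntegral.integral_congr fun τ hτ => ?_
    rw [uIcc_of_le hσ] at hτ
    simp only [hηy τ hτ.1]
  have hfix : Function.IsFixedPt (volterra h0 h1 hg hg0 b) η := by
    refine BoundedContinuousFunction.ext fun t => ?_
    show volterraFun δ g c b η t = y (max t 0) / growth c (max t 0)
    have hm0 : 0 ≤ max t 0 := le_max_right _ _
    rw [volterraFun, hyint _ hm0]
    congr 2
    refine intervalIntegral.integral_congr fun σ hσ => ?_
    rw [uIcc_of_le hm0] at hσ
    exact havg σ hσ.1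
  have huniq : η = fixedW h0 h1 hg hg0 b :=
    ContractingWith.fixedPoint_unique (contracting_volterra h0 h1 hg hg0 b) hfix
  rw [solY, ← huniq]
  exact (hηy s hs).symm

end Contraction

lemma mul_cosh_div_sinh_le {s S : ℝ} (hs : 0 < s) (hsS : s ≤ S) :
    s * (cosh s / sinh s) ≤ cosh S := by
  have hsinh : 0 < sinh s := sinh_pos_iff.2 hs
  have h1 : s ≤ sinh s := self_le_sinh_iff.2 hs.le
  have hcosh : cosh s ≤ cosh S := by
    rw [cosh_le_cosh, abs_of_pos hs, abs_of_pos (hs.trans_le hsS)]; exact hsS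
  have h2 : s / sinh s ≤ 1 := by rw [div_le_one hsinh]; exact h1
  calc s * (cosh s / sinh s) = s / sinh s * cosh s := by ring
    _ ≤ 1 * cosh S := by gcongr
    _ = _ := one_mul _

lemma one_le_coth {s : ℝ} (hs : 0 < s) : 1 ≤ cosh s / sinh s := by
  rw [one_le_div (sinh_pos_iff.2 hs)]
  exact (sinh_lt_cosh s).le

lemma abs_second_le {δ C S s z G V : ℝ} (h0 : 0 < δ) (h1 : δ < 1) (hs : 0 < s) (hsS : s ≤ S)
    (hz : |z| ≤ C * s) (hG : |G| ≤ V) :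
    |δ * (cosh s / sinh s) * z - G| ≤ C * cosh S + V := by
  have hq : 0 < cosh s / sinh s := div_pos (cosh_pos s) (sinh_pos_iff.2 hs)
  have hC : 0 ≤ C := by
    have := (abs_nonneg z).trans hz
    exact nonneg_of_mul_nonneg_left this hs
  refine (abs_sub _ _).trans (add_le_add ?_ hG)
  rw [abs_mul, abs_mul, abs_of_pos h0, abs_of_pos hq]
  calc δ * (cosh s / sinh s) * |z| ≤ 1 * (cosh s / sinh s) * (C * s) := by gcongr
    _ = C * (s * (cosh s / sinh s)) := by ring
    _ ≤ C * cosh S := by gcongr; exact mul_cosh_div_sinh_le hs hsS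

namespace RegSol

variable {δ : ℝ} {g : ℝ → ℝ} {L : NNReal} {b : ℝ} {y z : ℝ → ℝ}

/-- A regular solution that meets an equilibrium in phase space starts there. -/
lemma eq_of_meets (h : RegSol δ g b y z) (h0 : 0 < δ) (hg : LipschitzWith L g) {c : ℝ}
    (hgc : g c = 0) {τ : ℝ} (hτ : 0 ≤ τ) (hy : y τ = c) (hz : z τ = 0) : b = c := by
  set e : ℝ → ℝ := fun s => ((y s - c) ^ 2 + z s ^ 2) * exp ((1 + L) * s) with he
  have hmono : MonotoneOn e (Icc 0 τ) := by
    have hyc : ContinuousOn y (Icc 0 τ) := h.cont_y.mono Icc_subset_Ici_self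
    have hzc : ContinuousOn z (Icc 0 τ) := h.cont_z.mono Icc_subset_Ici_self
    have hd : ∀ s ∈ Ioo 0 τ, HasDerivAt e
        ((2 * (y s - c) * z s + 2 * z s * (δ * (cosh s / sinh s) * z s - g (y s)))
          * exp ((1 + L) * s) + ((y s - c) ^ 2 + z s ^ 2) * (exp ((1 + L) * s) * (1 + L))) s := by
      intro s hs
      have h1 := ((h.deriv_y s hs.1).sub_const c).pow 2
      have h2 := (h.deriv_z s hs.1).pow 2
      have h3 : HasDerivAt (fun s : ℝ => exp ((1 + L) * s)) (exp ((1 + L) * s) * (1 + L)) s := by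
        simpa using ((hasDerivAt_id s).const_mul (1 + (L : ℝ))).exp
      refine ((h1.add h2).mul h3).congr_deriv ?_
      simp
    refine monotoneOn_of_deriv_nonneg (convex_Icc 0 τ) (by fun_prop) ?_ ?_
    · rw [interior_Icc]
      exact fun s hs => (hd s hs).differentiableAt.differentiableWithinAt
    · rw [interior_Icc]
      intro s hs
      rw [(hd s hs).deriv]
      have hq : 0 < cosh s / sinh s := div_pos (cosh_pos s) (sinh_pos_iff.2 hs.1)
      have hG : |g (y s)| ≤ L * |y s - c| := by
        have := hg.dist_le_mul (y s) c
        rwa [hgc, dist_zero_right, Real.norm_eq_abs, Real.dist_eq] at this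
      have h3 : z s * g (y s) ≤ L * (|z s| * |y s - c|) := by
        calc z s * g (y s) ≤ |z s * g (y s)| := le_abs_self _
          _ = |z s| * |g (y s)| := abs_mul _ _
          _ ≤ |z s| * (L * |y s - c|) := by gcongr
          _ = _ := by ring
      have h4 : 2 * (|z s| * |y s - c|) ≤ (y s - c) ^ 2 + z s ^ 2 := by
        nlinarith [sq_nonneg (|z s| - |y s - c|), sq_abs (z s), sq_abs (y s - c)]
      have h5 : 0 ≤ δ * (cosh s / sinh s) * z s ^ 2 := by positivity
      have h6 := mul_le_mul_of_nonneg_left h4 L.coe_nonneg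
      have h7 : 0 ≤ (2 * (y s - c) * z s + 2 * z s * (δ * (cosh s / sinh s) * z s - g (y s)))
          + ((y s - c) ^ 2 + z s ^ 2) * (1 + L) := by
        nlinarith [sq_nonneg (y s - c + z s)]
      have := mul_nonneg h7 (exp_pos ((1 + L) * s)).le
      linarith
  have h1 := hmono ⟨le_rfl, hτ⟩ ⟨hτ, le_rfl⟩ hτ
  simp only [he, hy, hz, h.y_zero, h.z_zero] at h1
  simp only [sub_self, mul_zero, exp_zero, mul_one] at h1
  have : (b - c) ^ 2 = 0 := le_antisymm (by nlinarith) (sq_nonneg _)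
  have := pow_eq_zero_iff (two_ne_zero) |>.1 this
  linarith

lemma radius_pos (h : RegSol δ g b y z) (h0 : 0 < δ) (hg : LipschitzWith L g)
    (hg1 : g 1 = 0) (hb : 1 < b) {s : ℝ} (hs : 0 ≤ s) : 0 < (y s - 1) ^ 2 + z s ^ 2 := by
  rcases eq_or_ne (y s - 1) 0 with h1 | h1
  · have hz : z s ≠ 0 := fun hz => by
      have := h.eq_of_meets h0 hg hg1 hs (by linarith) hz
      linarith
    positivity
  · positivity

lemma exists_abs_second_le (h : RegSol δ g b y z) (h0 : 0 < δ) (h1 : δ < 1)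
    (hg : Continuous g) (S : ℝ) :
    ∃ V, ∀ s, 0 < s → s ≤ S → |δ * (cosh s / sinh s) * z s - g (y s)| ≤ V := by
  obtain ⟨C, hC⟩ := h.bound_z S
  obtain ⟨V, hV⟩ := (isCompact_Icc (a := (0 : ℝ)) (b := S)).exists_bound_of_continuousOn
    (hg.comp_continuousOn (h.cont_y.mono Icc_subset_Ici_self))
  exact ⟨C * cosh S + V, fun s hs hsS => abs_second_le h0 h1 hs hsS (hC s hs.le hsS)
    (hV s ⟨hs.le, hsS⟩)⟩

end RegSol

/-- Angular speed, around `(1, 0)`, of the phase curve `(y, y')`. -/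
noncomputable def angRate (δ : ℝ) (g y z : ℝ → ℝ) (s : ℝ) : ℝ :=
  (z s ^ 2 - (y s - 1) * (δ * (cosh s / sinh s) * z s - g (y s))) / ((y s - 1) ^ 2 + z s ^ 2)

/-- Angle swept, around `(1, 0)`, by the phase curve `(y, y')`. -/
noncomputable def ang (δ : ℝ) (g y z : ℝ → ℝ) (s : ℝ) : ℝ := ∫ t in (0 : ℝ)..s, angRate δ g y z t

lemma ang_zero (δ : ℝ) (g y z : ℝ → ℝ) : ang δ g y z 0 = 0 := by simp [ang]

lemma abs_angRate_le {δ : ℝ} {g y z : ℝ → ℝ} {s Z R V c : ℝ} (hc : 0 < c)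
    (hr : c ≤ (y s - 1) ^ 2 + z s ^ 2) (hz : |z s| ≤ Z) (hy : |y s - 1| ≤ R)
    (hV : |δ * (cosh s / sinh s) * z s - g (y s)| ≤ V) :
    |angRate δ g y z s| ≤ (Z ^ 2 + R * V) / c := by
  have hZ := (abs_nonneg _).trans hz
  have hR := (abs_nonneg _).trans hy
  have hV' := (abs_nonneg _).trans hV
  rw [angRate, abs_div, abs_of_pos (hc.trans_le hr)]
  refine div_le_div₀ (by positivity) ?_ hc hr
  refine (abs_sub _ _).trans ?_
  rw [abs_pow, abs_mul]
  gcongr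

namespace RegSol

variable {δ : ℝ} {g : ℝ → ℝ} {L : NNReal} {b : ℝ} {y z : ℝ → ℝ}

lemma continuousOn_angRate (h : RegSol δ g b y z) (h0 : 0 < δ) (hg : LipschitzWith L g)
    (hg1 : g 1 = 0) (hb : 1 < b) : ContinuousOn (angRate δ g y z) (Ioi 0) := by
  have hy := h.cont_y.mono Ioi_subset_Ici_self
  have hz := h.cont_z.mono Ioi_subset_Ici_self
  have hgy := hg.continuous.comp_continuousOn hy
  simp only [Function.comp_def] at hgy
  have hq : ContinuousOn (fun s => cosh s / sinh s) (Ioi 0) :=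
    continuous_cosh.continuousOn.div continuous_sinh.continuousOn
      fun s hs => (sinh_pos_iff.2 hs).ne'
  unfold angRate
  refine ContinuousOn.div ((hz.pow 2).sub ((hy.sub continuousOn_const).mul
    (((continuousOn_const.mul hq).mul hz).sub hgy))) (by fun_prop) fun s hs => ?_
  exact (h.radius_pos h0 hg hg1 hb (le_of_lt hs)).ne'

lemma exists_radius_ge (h : RegSol δ g b y z) (h0 : 0 < δ) (hg : LipschitzWith L g)
    (hg1 : g 1 = 0) (hb : 1 < b) (S : ℝ) :
    ∃ c, 0 < c ∧ ∀ s, 0 ≤ s → s ≤ S → c ≤ (y s - 1) ^ 2 + z s ^ 2 := by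
  rcases le_or_gt 0 S with hS | hS
  · have hyc : ContinuousOn y (Icc 0 S) := h.cont_y.mono Icc_subset_Ici_self
    have hzc : ContinuousOn z (Icc 0 S) := h.cont_z.mono Icc_subset_Ici_self
    obtain ⟨s0, hs0, hmin⟩ := isCompact_Icc.exists_isMinOn (nonempty_Icc.2 hS)
      (show ContinuousOn (fun s => (y s - 1) ^ 2 + z s ^ 2) (Icc 0 S) by fun_prop)
    exact ⟨_, h.radius_pos h0 hg hg1 hb hs0.1, fun s hs hsS => hmin ⟨hs, hsS⟩⟩
  · exact ⟨1, one_pos, fun s hs hsS => by linarith⟩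

lemma exists_abs_angRate_le (h : RegSol δ g b y z) (h0 : 0 < δ) (h1 : δ < 1)
    (hg : LipschitzWith L g) (hg1 : g 1 = 0) (hb : 1 < b) (S : ℝ) :
    ∃ K, ∀ s, 0 < s → s ≤ S → |angRate δ g y z s| ≤ K := by
  obtain ⟨c, hc, hr⟩ := h.exists_radius_ge h0 hg hg1 hb S
  obtain ⟨V, hV⟩ := h.exists_abs_second_le h0 h1 hg.continuous S
  obtain ⟨Z, hZ⟩ := (isCompact_Icc (a := (0 : ℝ)) (b := S)).exists_bound_of_continuousOn
    (h.cont_z.mono Icc_subset_Ici_self)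
  obtain ⟨R, hR⟩ := (isCompact_Icc (a := (0 : ℝ)) (b := S)).exists_bound_of_continuousOn
    ((h.cont_y.mono Icc_subset_Ici_self).sub continuousOn_const (f := y) (g := fun _ => (1 : ℝ)))
  exact ⟨_, fun s hs hsS => abs_angRate_le hc (hr s hs.le hsS) (hZ s ⟨hs.le, hsS⟩)
    (hR s ⟨hs.le, hsS⟩) (hV s hs hsS)⟩

lemma aestronglyMeasurable_angRate (h : RegSol δ g b y z) (h0 : 0 < δ)
    (hg : LipschitzWith L g) (hg1 : g 1 = 0) (hb : 1 < b) {s : ℝ} (hs : 0 ≤ s) :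
    AEStronglyMeasurable (angRate δ g y z) (volume.restrict (uIoc 0 s)) := by
  rw [uIoc_of_le hs]
  exact ((h.continuousOn_angRate h0 hg hg1 hb).mono fun t ht => ht.1).aestronglyMeasurable
    measurableSet_Ioc

lemma intervalIntegrable_angRate (h : RegSol δ g b y z) (h0 : 0 < δ) (h1 : δ < 1)
    (hg : LipschitzWith L g) (hg1 : g 1 = 0) (hb : 1 < b) {s : ℝ} (hs : 0 ≤ s) :
    IntervalIntegrable (angRate δ g y z) volume 0 s := by
  obtain ⟨K, hK⟩ := h.exists_abs_angRate_le h0 h1 hg hg1 hb s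
  refine (intervalIntegrable_const (c := K)).mono_fun'
    (h.aestronglyMeasurable_angRate h0 hg hg1 hb hs) ?_
  refine (ae_restrict_iff' measurableSet_uIoc).2 (ae_of_all _ fun t ht => ?_)
  rw [uIoc_of_le hs] at ht
  exact hK t ht.1 ht.2

lemma continuousOn_ang (h : RegSol δ g b y z) (h0 : 0 < δ) (h1 : δ < 1)
    (hg : LipschitzWith L g) (hg1 : g 1 = 0) (hb : 1 < b) :
    ContinuousOn (ang δ g y z) (Ici 0) := by
  intro s hs
  have hs' : (0 : ℝ) ≤ s + 1 := by linarith [mem_Ici.1 hs]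
  have hi := (h.intervalIntegrable_angRate h0 h1 hg hg1 hb hs')
  have hc := intervalIntegral.continuousOn_primitive_interval (hi.def'.mono_set_ae ?_ : IntegrableOn (angRate δ g y z) (uIcc 0 (s+1)) volume)
  · rw [uIcc_of_le hs'] at hc
    refine (hc s ⟨hs, by linarith⟩).mono_of_mem_nhdsWithin ?_
    have : Iic (s + 1) ∈ 𝓝 s := Iic_mem_nhds (by linarith)
    filter_upwards [self_mem_nhdsWithin, mem_nhdsWithin_of_mem_nhds this] with t h1 h2
    exact ⟨h1, h2⟩
  · rw [uIcc_of_le hs', uIoc_of_le hs']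
    exact Ioc_ae_eq_Icc.symm.le

lemma hasDerivAt_ang (h : RegSol δ g b y z) (h0 : 0 < δ) (h1 : δ < 1)
    (hg : LipschitzWith L g) (hg1 : g 1 = 0) (hb : 1 < b) {s : ℝ} (hs : 0 < s) :
    HasDerivAt (ang δ g y z) (angRate δ g y z s) s := by
  have hc := h.continuousOn_angRate h0 hg hg1 hb
  exact intervalIntegral.integral_hasDerivAt_right
    (h.intervalIntegrable_angRate h0 h1 hg hg1 hb hs.le)
    (hc.stronglyMeasurableAtFilter isOpen_Ioi s hs) (hc.continuousAt (Ioi_mem_nhds hs))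

lemma polar (h : RegSol δ g b y z) (h0 : 0 < δ) (h1 : δ < 1)
    (hg : LipschitzWith L g) (hg1 : g 1 = 0) (hb : 1 < b) {s : ℝ} (hs : 0 ≤ s) :
    ∃ A, 0 < A ∧ y s - 1 = A * cos (ang δ g y z s) ∧ z s = -(A * sin (ang δ g y z s)) := by
  set θ := ang δ g y z with hθ
  have hθc := h.continuousOn_ang h0 h1 hg hg1 hb
  set P : ℝ → ℝ := fun s => (y s - 1) * cos (θ s) - z s * sin (θ s) with hP
  set Q : ℝ → ℝ := fun s => (y s - 1) * sin (θ s) + z s * cos (θ s) with hQ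
  have hQ0 : ∀ S, 0 ≤ S → Q S = 0 := by
    intro S hS
    obtain ⟨c, hc, hr⟩ := h.exists_radius_ge h0 hg hg1 hb S
    obtain ⟨V, hV⟩ := h.exists_abs_second_le h0 h1 hg.continuous S
    obtain ⟨Z, hZ⟩ := (isCompact_Icc (a := (0 : ℝ)) (b := S)).exists_bound_of_continuousOn
      (h.cont_z.mono Icc_subset_Ici_self)
    obtain ⟨R, hR⟩ := (isCompact_Icc (a := (0 : ℝ)) (b := S)).exists_bound_of_continuousOn
      ((h.cont_y.mono Icc_subset_Ici_self).sub continuousOn_const (f := y) (g := fun _ => (1 : ℝ)))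
    set K := Z * (R + V) / c with hK
    set w : ℝ → ℝ := fun s => δ * (cosh s / sinh s) * z s - g (y s) with hw
    set m : ℝ → ℝ := fun s => z s * ((y s - 1) + w s) / ((y s - 1) ^ 2 + z s ^ 2) with hm
    have hmK : ∀ t ∈ Ioo 0 S, m t ≤ K := by
      intro t ht
      have hz' := hZ t ⟨ht.1.le, ht.2.le⟩
      have hy' := hR t ⟨ht.1.le, ht.2.le⟩
      have hv' := hV t ht.1 ht.2.le
      have hr' := hr t ht.1.le ht.2.le
      have hZ0 := (norm_nonneg _).trans hz'
      have hR0 := (norm_nonneg _).trans hy'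
      have hV0 := (abs_nonneg _).trans hv'
      refine (le_abs_self _).trans ?_
      rw [hm, abs_div, abs_of_pos (hc.trans_le hr')]
      refine div_le_div₀ (by positivity) ?_ hc hr'
      rw [abs_mul]
      refine mul_le_mul hz' ((abs_add_le _ _).trans (add_le_add hy' hv')) (abs_nonneg _) hZ0
    have hd : ∀ t ∈ Ioo 0 S, HasDerivAt Q (m t * Q t) t := by
      intro t ht
      have hr' := (hc.trans_le (hr t ht.1.le ht.2.le)).ne'
      have e1 := (h.deriv_y t ht.1).sub_const 1
      have e2 := h.deriv_z t ht.1
      have e3 := h.hasDerivAt_ang h0 h1 hg hg1 hb ht.1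
      refine ((e1.mul e3.sin).add (e2.mul e3.cos)).congr_deriv ?_
      simp only [hm, hQ, hw, angRate]
      rw [← hθ]
      field_simp
      ring
    have hanti : AntitoneOn (fun t => Q t ^ 2 * exp (-(2 * K) * t)) (Icc 0 S) := by
      have hyc : ContinuousOn y (Icc 0 S) := h.cont_y.mono Icc_subset_Ici_self
      have hzc : ContinuousOn z (Icc 0 S) := h.cont_z.mono Icc_subset_Ici_self
      have hθc' : ContinuousOn θ (Icc 0 S) := hθc.mono Icc_subset_Ici_self
      have hdd : ∀ t ∈ Ioo 0 S, HasDerivAt (fun t => Q t ^ 2 * exp (-(2 * K) * t))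
          ((2 * Q t * (m t * Q t)) * exp (-(2 * K) * t)
            + Q t ^ 2 * (exp (-(2 * K) * t) * (-(2 * K)))) t := by
        intro t ht
        have h3 : HasDerivAt (fun s : ℝ => exp (-(2 * K) * s)) (exp (-(2 * K) * t) * (-(2 * K))) t := by
          simpa using ((hasDerivAt_id t).const_mul (-(2 * K))).exp
        refine (((hd t ht).pow 2).mul h3).congr_deriv ?_
        simp
      refine antitoneOn_of_deriv_nonpos (convex_Icc 0 S) (by fun_prop) ?_ ?_
      · rw [interior_Icc]
        exact fun s hs => (hdd s hs).differentiableAt.differentiableWithinAt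
      · rw [interior_Icc]
        intro t ht
        rw [(hdd t ht).deriv]
        have h2 : 0 ≤ Q t ^ 2 * exp (-(2 * K) * t) := by positivity
        nlinarith [hmK t ht]
    have := hanti ⟨le_rfl, hS⟩ ⟨hS, le_rfl⟩ hS
    have hQ00 : Q 0 = 0 := by simp [hQ, hθ, ang_zero, h.z_zero]
    simp only [hQ00] at this
    have he := exp_pos (-(2 * K) * S)
    have h4 : Q S ^ 2 ≤ 0 := by
      by_contra hcon
      have := mul_pos (not_le.1 hcon) he
      norm_num at *
      linarith
    exact pow_eq_zero_iff two_ne_zero |>.1 (le_antisymm h4 (sq_nonneg _))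
  have hPne : ∀ t, 0 ≤ t → P t ≠ 0 := by
    intro t ht hPt
    have hr := h.radius_pos h0 hg hg1 hb ht
    have : P t ^ 2 + Q t ^ 2 = (y t - 1) ^ 2 + z t ^ 2 := by
      simp only [hP, hQ]
      nlinarith [sin_sq_add_cos_sq (θ t)]
    rw [hPt, hQ0 t ht] at this
    simp only [ne_eq, OfNat.ofNat_ne_zero, not_false_eq_true, zero_pow, add_zero] at this
    linarith
  have hPpos : 0 < P s := by
    by_contra hcon
    have hyc : ContinuousOn y (Icc 0 s) := h.cont_y.mono Icc_subset_Ici_self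
    have hzc : ContinuousOn z (Icc 0 s) := h.cont_z.mono Icc_subset_Ici_self
    have hθc' : ContinuousOn θ (Icc 0 s) := hθc.mono Icc_subset_Ici_self
    have hPc : ContinuousOn P (Icc 0 s) := by fun_prop
    have hP0 : P 0 = b - 1 := by simp [hP, hθ, ang_zero, h.z_zero, h.y_zero]
    obtain ⟨t, ht, hPt⟩ := intermediate_value_Icc' hs hPc
      (show (0 : ℝ) ∈ Icc (P s) (P 0) from ⟨not_lt.1 hcon, by rw [hP0]; linarith⟩)
    exact hPne t ht.1 hPt
  have hQs := hQ0 s hs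
  simp only [hQ] at hQs
  refine ⟨P s, hPpos, ?_, ?_⟩
  · simp only [hP]
    linear_combination sin (θ s) * hQs - (y s - 1) * sin_sq_add_cos_sq (θ s)
  · simp only [hP]
    linear_combination cos (θ s) * hQs - z s * sin_sq_add_cos_sq (θ s)

end RegSol

section Family

variable {δ : ℝ} {g : ℝ → ℝ} {L : NNReal}

/-- The angle of the regular solution starting at `b`. -/
noncomputable def solAng (h0 : 0 < δ) (h1 : δ < 1) (hg : LipschitzWith L g) (hg0 : g 0 = 0)
    (b : ℝ) : ℝ → ℝ := ang δ g (solY h0 h1 hg hg0 b) (solZ h0 h1 hg hg0 b)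

lemma continuous_solY_param (h0 : 0 < δ) (h1 : δ < 1) (hg : LipschitzWith L g) (hg0 : g 0 = 0)
    {s : ℝ} (hs : 0 ≤ s) : Continuous fun b => solY h0 h1 hg hg0 b s := by
  obtain ⟨C, hC, hl⟩ := sol_lipschitz h0 h1 hg hg0 s
  refine (LipschitzWith.of_dist_le_mul (K := C.toNNReal) fun b b' => ?_).continuous
  rw [Real.coe_toNNReal _ hC]
  exact (hl b b' s hs le_rfl).1

lemma continuous_solZ_param (h0 : 0 < δ) (h1 : δ < 1) (hg : LipschitzWith L g) (hg0 : g 0 = 0)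
    {s : ℝ} (hs : 0 ≤ s) : Continuous fun b => solZ h0 h1 hg hg0 b s := by
  obtain ⟨C, hC, hl⟩ := sol_lipschitz h0 h1 hg hg0 s
  refine (LipschitzWith.of_dist_le_mul (K := (C * s).toNNReal) fun b b' => ?_).continuous
  have := (hl b b' s hs le_rfl).2
  rw [Real.dist_eq, Real.dist_eq, Real.coe_toNNReal _ (mul_nonneg hC hs)]
  linarith

lemma continuousAt_solAng (h0 : 0 < δ) (h1 : δ < 1) (hg : LipschitzWith L g) (hg0 : g 0 = 0)
    (hg1 : g 1 = 0) {b : ℝ} (hb : 1 < b) {s : ℝ} (hs : 0 ≤ s) :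
    ContinuousAt (fun b => solAng h0 h1 hg hg0 b s) b := by
  have hr := regSol_sol h0 h1 hg hg0
  obtain ⟨C, hC, hl⟩ := sol_lipschitz h0 h1 hg hg0 s
  obtain ⟨c, hc, hrad⟩ := (hr b).exists_radius_ge h0 hg hg1 hb s
  obtain ⟨D, hD⟩ := (hr b).bound_z s
  obtain ⟨R, hR⟩ := (isCompact_Icc (a := (0 : ℝ)) (b := s)).exists_bound_of_continuousOn
    (((hr b).cont_y.mono Icc_subset_Ici_self).sub continuousOn_const (f := solY h0 h1 hg hg0 b)
      (g := fun _ => (1 : ℝ)))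
  obtain ⟨V, hV⟩ : ∃ V, V = L * (R + C) := ⟨_, rfl⟩
  have hev : ∀ᶠ b' in 𝓝 b, 1 < b' ∧ |b' - b| < 1 ∧
      2 * (C * (1 + s) * |b' - b|) ^ 2 < c / 4 := by
    refine (lt_mem_nhds hb).and (Eventually.and ?_ ?_)
    · have : ContinuousAt (fun b' => |b' - b|) b := by fun_prop
      exact this.eventually_lt continuousAt_const (by simp)
    · have : ContinuousAt (fun b' => 2 * (C * (1 + s) * |b' - b|) ^ 2) b := by fun_prop
      exact this.eventually_lt continuousAt_const (by simp; positivity)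
  have hbound : ∀ b', 1 < b' → |b' - b| < 1 → 2 * (C * (1 + s) * |b' - b|) ^ 2 < c / 4 →
      ∀ t, 0 < t → t ≤ s → |angRate δ g (solY h0 h1 hg hg0 b') (solZ h0 h1 hg hg0 b') t| ≤
        (((D + C) * s) ^ 2 + (R + C) * ((D + C) * cosh s + V)) / (c / 4) := by
    intro b' hb' hd1 hd2 t ht hts
    obtain ⟨e1, e2⟩ := hl b' b t ht.le hts
    have hCb : C * |b' - b| ≤ C := by nlinarith
    have hR' := hR t ⟨ht.le, hts⟩
    rw [Real.norm_eq_abs, Pi.sub_apply] at hR'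
    have hD' := hD t ht.le hts
    have hy' : |solY h0 h1 hg hg0 b' t - 1| ≤ R + C := by
      have := abs_add_le (solY h0 h1 hg hg0 b t - 1) (solY h0 h1 hg hg0 b' t - solY h0 h1 hg hg0 b t)
      rw [show solY h0 h1 hg hg0 b t - 1 + (solY h0 h1 hg hg0 b' t - solY h0 h1 hg hg0 b t)
        = solY h0 h1 hg hg0 b' t - 1 by ring] at this
      linarith
    have hz' : |solZ h0 h1 hg hg0 b' t| ≤ (D + C) * t := by
      have := abs_add_le (solZ h0 h1 hg hg0 b t) (solZ h0 h1 hg hg0 b' t - solZ h0 h1 hg hg0 b t)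
      rw [show solZ h0 h1 hg hg0 b t + (solZ h0 h1 hg hg0 b' t - solZ h0 h1 hg hg0 b t)
        = solZ h0 h1 hg hg0 b' t by ring] at this
      nlinarith
    have hDC : 0 ≤ D + C := nonneg_of_mul_nonneg_left ((abs_nonneg _).trans hz') ht
    have hg' : |g (solY h0 h1 hg hg0 b' t)| ≤ V := by
      have := hg.dist_le_mul (solY h0 h1 hg hg0 b' t) 1
      rw [hg1, dist_zero_right, Real.norm_eq_abs, Real.dist_eq] at this
      rw [hV]
      exact this.trans (mul_le_mul_of_nonneg_left hy' L.coe_nonneg)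
    refine abs_angRate_le (by positivity) ?_ (hz'.trans (by gcongr)) hy'
      (abs_second_le h0 h1 ht hts hz' hg')
    have hr0 := hrad t ht.le hts
    have k1 : |solY h0 h1 hg hg0 b' t - solY h0 h1 hg hg0 b t| ≤ C * (1 + s) * |b' - b| := by
      have : 0 ≤ C * |b' - b| * s := by positivity
      linarith
    have k2 : |solZ h0 h1 hg hg0 b' t - solZ h0 h1 hg hg0 b t| ≤ C * (1 + s) * |b' - b| := by
      have : 0 ≤ C * |b' - b| := by positivity
      nlinarith
    have k3 := sq_le_sq' (neg_le_of_abs_le k1) (le_of_abs_le k1)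
    have k4 := sq_le_sq' (neg_le_of_abs_le k2) (le_of_abs_le k2)
    nlinarith [sq_nonneg ((solY h0 h1 hg hg0 b t - 1) + 2 * (solY h0 h1 hg hg0 b' t - solY h0 h1 hg hg0 b t)),
      sq_nonneg (solZ h0 h1 hg hg0 b t + 2 * (solZ h0 h1 hg hg0 b' t - solZ h0 h1 hg hg0 b t))]
  refine intervalIntegral.continuousAt_of_dominated_interval
    (bound := fun _ => (((D + C) * s) ^ 2 + (R + C) * ((D + C) * cosh s + V)) / (c / 4)) ?_ ?_
    intervalIntegrable_const ?_
  · filter_upwards [hev] with b' hb'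
    exact (hr b').aestronglyMeasurable_angRate h0 hg hg1 hb'.1 hs
  · filter_upwards [hev] with b' hb'
    refine ae_of_all _ fun t ht => ?_
    rw [uIoc_of_le hs] at ht
    exact hbound b' hb'.1 hb'.2.1 hb'.2.2 t ht.1 ht.2
  · refine ae_of_all _ fun t ht => ?_
    rw [uIoc_of_le hs] at ht
    have cy := (continuous_solY_param h0 h1 hg hg0 ht.1.le).continuousAt (x := b)
    have cz := (continuous_solZ_param h0 h1 hg hg0 ht.1.le).continuousAt (x := b)
    have cg := hg.continuous.continuousAt.comp cy
    simp only [Function.comp_def] at cg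
    unfold angRate
    refine ContinuousAt.div ((cz.pow 2).sub ((cy.sub continuousAt_const).mul
      ((continuousAt_const.mul cz).sub cg))) (by fun_prop) ?_
    exact ((hr b).radius_pos h0 hg hg1 hb ht.1.le).ne'

end Family

/-- A force whose potential has a well at `1` and vanishes at the equilibrium `0`. -/
structure Well (L : NNReal) (κ : ℝ) (g : ℝ → ℝ) : Prop where
  lip : LipschitzWith L g
  zero : g 0 = 0
  one : g 1 = 0
  neg : ∀ y, 0 < y → y < 1 → g y < 0
  sub_one_le : ∀ y, 1 ≤ y → y - 1 ≤ g y
  near_one : ∃ η, 0 < η ∧ ∀ y, |y - 1| ≤ η → (y - 1) ^ 2 ≤ (y - 1) * g y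
  lower : ∀ y, 0 ≤ y → -(κ * y) ≤ g y

/-- The levels of the angle at which the phase curve crosses `y = 1`. -/
noncomputable def level (k : ℕ) : ℝ := π / 2 + k * π

lemma cos_level (k : ℕ) : cos (level k) = 0 := by
  rw [level, cos_add_nat_mul_pi, cos_pi_div_two, mul_zero]

lemma level_succ (k : ℕ) : level (k + 1) = level k + π := by simp [level]; ring

lemma level_mono : Monotone level :=
  monotone_nat_of_le_succ fun k => by rw [level_succ]; linarith [pi_pos]

lemma cos_neg_of_level {i : ℕ} {θ : ℝ} (h1 : level (2 * i) < θ) (h2 : θ < level (2 * i + 1)) :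
    cos θ < 0 := by
  rw [← cos_sub_nat_mul_two_pi θ i]
  rw [level_succ] at h2
  simp only [level, Nat.cast_mul, Nat.cast_ofNat] at h1 h2
  exact cos_neg_of_pi_div_two_lt_of_lt (by linarith) (by linarith)

lemma cos_pos_of_level {i : ℕ} {θ : ℝ} (h1 : level (2 * i + 1) < θ)
    (h2 : θ < level (2 * i + 2)) : 0 < cos θ := by
  rw [← cos_sub_nat_mul_two_pi θ (i + 1)]
  rw [level_succ] at h2
  rw [level_succ] at h1 h2
  simp only [level, Nat.cast_mul, Nat.cast_ofNat, Nat.cast_add, Nat.cast_one] at h1 h2 ⊢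
  exact cos_pos_of_mem_Ioo ⟨by linarith, by linarith⟩

lemma coth_le {s : ℝ} (hs : 1 ≤ s) : cosh s / sinh s ≤ 7 / 5 := by
  have hsinh : 0 < sinh s := sinh_pos_iff.2 (by linarith)
  rw [div_le_iff₀ hsinh, cosh_eq, sinh_eq]
  have h1 : exp 1 ≤ exp s := exp_le_exp.2 hs
  have h2 := exp_one_gt_d9
  have h3 : exp s * exp (-s) = 1 := by rw [← exp_add]; simp
  have h4 : 0 < exp (-s) := exp_pos _
  nlinarith

namespace RegSol

variable {δ κ : ℝ} {g : ℝ → ℝ} {L : NNReal} {b : ℝ} {y z : ℝ → ℝ}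

lemma y_eq_one_iff (h : RegSol δ g b y z) (h0 : 0 < δ) (h1 : δ < 1) (hw : Well L κ g) (hb : 1 < b)
    {s : ℝ} (hs : 0 ≤ s) : y s = 1 ↔ cos (ang δ g y z s) = 0 := by
  obtain ⟨A, hA, e, -⟩ := h.polar h0 h1 hw.lip hw.one hb hs
  constructor
  · intro hy
    rw [hy, sub_self] at e
    simpa [hA.ne'] using e.symm
  · intro hc
    rw [hc, mul_zero] at e
    linarith

lemma angRate_eq_one (h : RegSol δ g b y z) (h0 : 0 < δ) (hw : Well L κ g) (hb : 1 < b)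
    {s : ℝ} (hs : 0 ≤ s) (hy : y s = 1) : angRate δ g y z s = 1 := by
  have := h.radius_pos h0 hw.lip hw.one hb hs
  rw [hy] at this
  rw [angRate, hy]
  simp only [sub_self, zero_mul, sub_zero]
  simp only [sub_self] at this
  refine div_eq_one_iff_eq this.ne' |>.2 (by ring)

lemma ang_ge_of_ge (h : RegSol δ g b y z) (h0 : 0 < δ) (h1 : δ < 1) (hw : Well L κ g) (hb : 1 < b)
    {l s t : ℝ} (hl : cos l = 0) (hs : 0 < s) (hst : s ≤ t) (hls : l ≤ ang δ g y z s) :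
    l ≤ ang δ g y z t := by
  have hc := h.continuousOn_ang h0 h1 hw.lip hw.one hb
  refine image_le_of_deriv_right_lt_deriv_boundary' (f := fun _ => l) (f' := fun _ => 0)
    (B := ang δ g y z) (B' := angRate δ g y z) (a := s) (b := t) continuousOn_const
    (fun x _ => hasDerivWithinAt_const _ _ _) hls
    (hc.mono fun x hx => hs.le.trans hx.1)
    (fun x hx => (h.hasDerivAt_ang h0 h1 hw.lip hw.one hb (hs.trans_le hx.1)).hasDerivWithinAt)
    ?_ (right_mem_Icc.2 hst)
  intro x hx hlx
  have hx0 : 0 < x := hs.trans_le hx.1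
  rw [h.angRate_eq_one h0 hw hb hx0.le ((h.y_eq_one_iff h0 h1 hw hb hx0.le).2 (hlx ▸ hl))]
  exact one_pos

lemma ang_gt_of_ge (h : RegSol δ g b y z) (h0 : 0 < δ) (h1 : δ < 1) (hw : Well L κ g) (hb : 1 < b)
    {l s t : ℝ} (hl : cos l = 0) (hs : 0 < s) (hst : s < t) (hls : l ≤ ang δ g y z s) :
    l < ang δ g y z t := by
  refine lt_of_le_of_ne (h.ang_ge_of_ge h0 h1 hw hb hl hs hst.le hls) fun heq => ?_
  have ht := hs.trans hst
  have hd := h.hasDerivAt_ang h0 h1 hw.lip hw.one hb ht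
  rw [h.angRate_eq_one h0 hw hb ht.le ((h.y_eq_one_iff h0 h1 hw hb ht.le).2 (heq ▸ hl))] at hd
  have h2 := (hasDerivAt_iff_tendsto_slope_left_right.1 hd).1
  have : (1 : ℝ) ≤ 0 := by
    refine le_of_tendsto h2 ?_
    filter_upwards [Ioo_mem_nhdsLT hst] with x hx
    rw [slope_def_field]
    have := h.ang_ge_of_ge h0 h1 hw hb hl hs hx.1.le hls
    refine div_nonpos_of_nonneg_of_nonpos ?_ ?_
    · linarith
    · linarith [hx.2]
  linarith

lemma neg_pi_div_two_lt_ang (h : RegSol δ g b y z) (h0 : 0 < δ) (h1 : δ < 1) (hw : Well L κ g)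
    (hb : 1 < b) {s : ℝ} (hs : 0 ≤ s) : -(π / 2) < ang δ g y z s := by
  have hc := h.continuousOn_ang h0 h1 hw.lip hw.one hb 0 (mem_Ici.2 le_rfl)
  have hl : cos (-(π / 2)) = 0 := by simp
  have hp : -(π / 2) < ang δ g y z 0 := by rw [ang_zero]; linarith [pi_pos]
  rcases hs.eq_or_lt with rfl | hs
  · exact hp
  have hev : ∀ᶠ t in 𝓝[>] (0 : ℝ), -(π / 2) < ang δ g y z t :=
    (hc.tendsto.mono_left (nhdsWithin_mono _ Ioi_subset_Ici_self)).eventually (lt_mem_nhds hp)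
  obtain ⟨t, ht, hts⟩ := (hev.and (Ioo_mem_nhdsGT hs)).exists
  exact h.ang_gt_of_ge h0 h1 hw hb hl hts.1 hts.2 ht.le

lemma ang_growth (h : RegSol δ g b y z) (h0 : 0 < δ) (h1 : δ < 1) (hw : Well L κ g) (hb : 1 < b)
    {s t : ℝ} (hs : 1 ≤ s) (hst : s ≤ t)
    (hrot : ∀ x ∈ Icc s t, (y x - 1) ^ 2 ≤ (y x - 1) * g (y x)) :
    3 / 10 * (t - s) ≤ ang δ g y z t - ang δ g y z s := by
  have hc := (h.continuousOn_ang h0 h1 hw.lip hw.one hb).mono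
    (fun x hx => (by linarith [hx.1] : (0 : ℝ) ≤ x) : Icc s t ⊆ Ici 0)
  have hd : ∀ x ∈ Icc s t, HasDerivAt (ang δ g y z) (angRate δ g y z x) x := fun x hx =>
    h.hasDerivAt_ang h0 h1 hw.lip hw.one hb (by linarith [hx.1])
  refine (convex_Icc s t).mul_sub_le_image_sub_of_le_deriv hc ?_ ?_ s (left_mem_Icc.2 hst) t
    (right_mem_Icc.2 hst) hst
  · exact fun x hx => (hd x (interior_subset hx)).differentiableAt.differentiableWithinAt
  · intro x hx
    have hx := interior_subset hx
    rw [(hd x hx).deriv, angRate, le_div_iff₀ (h.radius_pos h0 hw.lip hw.one hb (by linarith [hx.1]))]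
    have hq1 := one_le_coth (s := x) (by linarith [hx.1])
    have hq2 := coth_le (hs.trans hx.1)
    set q := cosh x / sinh x
    have hdq : δ * q ≤ 7 / 5 := by nlinarith
    have hdq0 : 0 ≤ δ * q := by positivity
    have h3 := hrot x hx
    have h4 : δ * q * ((y x - 1) * z x) ≤ 7 / 10 * ((y x - 1) ^ 2 + z x ^ 2) := by
      have : (y x - 1) * z x ≤ 1 / 2 * ((y x - 1) ^ 2 + z x ^ 2) := by
        nlinarith [sq_nonneg (y x - 1 - z x)]
      have h5 := mul_le_mul_of_nonneg_left this hdq0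
      have h6 : 0 ≤ (y x - 1) ^ 2 + z x ^ 2 := by positivity
      nlinarith
    nlinarith

end RegSol

section Shooting

variable {δ κ : ℝ} {g : ℝ → ℝ} {L : NNReal}

lemma solY_one (h0 : 0 < δ) (h1 : δ < 1) (hw : Well L κ g) {s : ℝ} (hs : 0 ≤ s) :
    solY h0 h1 hw.lip hw.zero 1 s = 1 := by
  have : RegSol δ g 1 (fun _ => 1) (fun _ => 0) :=
    { cont_y := continuousOn_const
      cont_z := continuousOn_const
      y_zero := rfl
      z_zero := rfl
      deriv_y := fun s _ => hasDerivAt_const _ _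
      deriv_z := fun s _ => by simpa [hw.one] using hasDerivAt_const s (0 : ℝ)
      bound_z := fun S => ⟨0, by simp⟩ }
  exact (this.eq_sol h0 h1 hw.lip hw.zero continuous_const ⟨1, by simp⟩ hs).symm

/-- The regular solution from `b` stays positive until its angle exceeds `l`. -/
def Winds (h0 : 0 < δ) (h1 : δ < 1) (hw : Well L κ g) (l b : ℝ) : Prop :=
  1 < b ∧ ∃ s, 0 < s ∧ (∀ t ∈ Icc 0 s, 0 < solY h0 h1 hw.lip hw.zero b t) ∧
    l < solAng h0 h1 hw.lip hw.zero b s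

lemma exists_winds (h0 : 0 < δ) (h1 : δ < 1) (hw : Well L κ g) {l : ℝ} (hl : 0 ≤ l) {c : ℝ}
    (hc : 1 < c) : ∃ b, b ≤ c ∧ Winds h0 h1 hw l b := by
  obtain ⟨η, hη, hnear⟩ := hw.near_one
  set S : ℝ := 1 + 10 / 3 * (l + 3) with hS
  obtain ⟨C, hC, hlip⟩ := sol_lipschitz h0 h1 hw.lip hw.zero S
  set e := min (c - 1) (min η (1 / 2) / (C + 1)) with he
  have hm : 0 < min η (1 / 2 : ℝ) := by positivity
  have he0 : 0 < e := by
    have : 0 < c - 1 := by linarith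
    positivity
  have hCe : C * e ≤ min η (1 / 2) := by
    have : e ≤ min η (1 / 2) / (C + 1) := min_le_right _ _
    rw [le_div_iff₀ (by positivity)] at this
    nlinarith
  have hb : 1 < 1 + e := by linarith
  have hclose : ∀ t ∈ Icc 0 S, |solY h0 h1 hw.lip hw.zero (1 + e) t - 1| ≤ min η (1 / 2) := by
    intro t ht
    have := (hlip (1 + e) 1 t ht.1 ht.2).1
    rw [solY_one h0 h1 hw ht.1, add_sub_cancel_left, abs_of_pos he0] at this
    exact this.trans hCe
  refine ⟨1 + e, by linarith [min_le_left (c - 1) (min η (1 / 2) / (C + 1))], hb, S, by positivity,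
    fun t ht => ?_, ?_⟩
  · have := neg_le_of_abs_le (hclose t ht)
    linarith [min_le_right η (1 / 2 : ℝ)]
  · have hr := regSol_sol h0 h1 hw.lip hw.zero (1 + e)
    have := hr.ang_growth h0 h1 hw hb le_rfl (show 1 ≤ S by linarith) fun x hx =>
      hnear _ ((hclose x ⟨by linarith [hx.1], hx.2⟩).trans (min_le_left _ _))
    have h2 := hr.neg_pi_div_two_lt_ang h0 h1 hw hb zero_le_one
    have h3 := pi_lt_four
    rw [solAng]
    linarith

lemma eventually_winds (h0 : 0 < δ) (h1 : δ < 1) (hw : Well L κ g) {l b : ℝ}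
    (hb : Winds h0 h1 hw l b) : ∀ᶠ b' in 𝓝 b, Winds h0 h1 hw l b' := by
  obtain ⟨hb1, s, hs, hpos, hang⟩ := hb
  obtain ⟨C, hC, hlip⟩ := sol_lipschitz h0 h1 hw.lip hw.zero s
  have hr := regSol_sol h0 h1 hw.lip hw.zero b
  obtain ⟨s0, hs0, hmin⟩ := isCompact_Icc.exists_isMinOn (nonempty_Icc.2 hs.le)
    (hr.cont_y.mono Icc_subset_Ici_self : ContinuousOn _ (Icc 0 s))
  have hclose : ∀ᶠ b' in 𝓝 b, C * |b - b'| < solY h0 h1 hw.lip hw.zero b s0 := by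
    have : ContinuousAt (fun b' => C * |b - b'|) b := by fun_prop
    exact this.eventually_lt continuousAt_const (by simpa using hpos s0 hs0)
  have hang' := (continuousAt_solAng h0 h1 hw.lip hw.zero hw.one hb1 hs.le).eventually
    (lt_mem_nhds hang)
  filter_upwards [lt_mem_nhds hb1, hclose, hang'] with b' hb' hc ha
  refine ⟨hb', s, hs, fun t ht => ?_, ha⟩
  have h2 := le_of_abs_le (hlip b b' t ht.1 ht.2).1
  have h3 := isMinOn_iff.1 hmin t ht
  linarith

/-- Shooting: the last starting point, below a non-winding one, that is a limit of winding ones. -/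
theorem exists_threshold (h0 : 0 < δ) (h1 : δ < 1) (hw : Well L κ g) (k : ℕ) {c : ℝ}
    (hc : 1 < c) (hcw : ¬ Winds h0 h1 hw (level k) c) :
    ∃ b, 1 < b ∧ b ≤ c ∧ (∀ s, 0 ≤ s → 0 < solY h0 h1 hw.lip hw.zero b s) ∧
      (∀ s, 0 ≤ s → solAng h0 h1 hw.lip hw.zero b s < level k) ∧
      ∃ᶠ b' in 𝓝 b, Winds h0 h1 hw (level k) b' := by
  set l := level k with hlk
  have hl : 0 ≤ l := by rw [hlk, level]; positivity
  have hcos : cos l = 0 := cos_level k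
  set A : Set ℝ := {b | b ≤ c ∧ Winds h0 h1 hw l b} with hA
  obtain ⟨b1, hb1⟩ : A.Nonempty := exists_winds h0 h1 hw hl hc
  have hbdd : BddAbove A := ⟨c, fun b hb => hb.1⟩
  set b := sSup A with hb
  have hb1b : 1 < b := hb1.2.1.trans_le (le_csSup hbdd hb1)
  have hbc : b ≤ c := csSup_le ⟨b1, hb1⟩ fun x hx => hx.1
  have hnot : ¬ Winds h0 h1 hw l b := by
    intro hwb
    have hlt : b < c := lt_of_le_of_ne hbc fun e => hcw (e ▸ hwb)
    have hev := (eventually_winds h0 h1 hw hwb).and (Iio_mem_nhds hlt)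
    obtain ⟨b', hb', hbb'⟩ := ((hev.filter_mono nhdsWithin_le_nhds).and
      (self_mem_nhdsWithin (s := Ioi b))).exists
    have : b' ≤ b := le_csSup hbdd ⟨le_of_lt hb'.2, hb'.1⟩
    exact absurd hbb' (not_lt.2 this)
  have hfreq : ∃ᶠ b' in 𝓝 b, Winds h0 h1 hw l b' :=
    (mem_closure_iff_frequently.1 (csSup_mem_closure ⟨b1, hb1⟩ hbdd)).mono fun x hx => hx.2
  have hr := regSol_sol h0 h1 hw.lip hw.zero
  have hle : ∀ s, 0 < s → (∀ t ∈ Icc 0 s, 0 < solY h0 h1 hw.lip hw.zero b t) →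
      solAng h0 h1 hw.lip hw.zero b s ≤ l := fun s hs hp => by
    by_contra hcon
    exact hnot ⟨hb1b, s, hs, hp, not_le.1 hcon⟩
  have hpos : ∀ s, 0 ≤ s → 0 < solY h0 h1 hw.lip hw.zero b s := by
    by_contra! hcon
    obtain ⟨s1, hs1, hs1y⟩ := hcon
    set Y := solY h0 h1 hw.lip hw.zero b with hY
    have hYc : Continuous Y := continuous_solY h0 h1 hw.lip hw.zero b
    set Z : Set ℝ := {s | 0 ≤ s ∧ Y s ≤ 0} with hZ
    have hZc : IsClosed Z := (isClosed_le continuous_const continuous_id).inter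
      (isClosed_le hYc continuous_const)
    have hZb : BddBelow Z := ⟨0, fun s hs => hs.1⟩
    set τ := sInf Z with hτ
    have hτZ : τ ∈ Z := hZc.csInf_mem ⟨s1, hs1, hs1y⟩ hZb
    have hbefore : ∀ t, 0 ≤ t → t < τ → 0 < Y t := fun t ht htτ => by
      by_contra hcon
      exact absurd (csInf_le hZb ⟨ht, not_lt.1 hcon⟩) (not_le.2 htτ)
    have hτ0 : 0 < τ := by
      refine lt_of_le_of_ne hτZ.1 fun e => ?_
      have := hτZ.2
      rw [← e, hY, (hr b).y_zero] at this
      linarith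
    have hev : ∀ᶠ t in 𝓝[<] τ, t ∈ Ioo 0 τ := Ioo_mem_nhdsLT hτ0
    have hYτ : Y τ = 0 := by
      refine le_antisymm hτZ.2 (ge_of_tendsto
        ((hYc.tendsto τ).mono_left (nhdsWithin_le_nhds (s := Iio τ))) ?_)
      filter_upwards [hev] with t ht using (hbefore t ht.1.le ht.2).le
    have hd := (hr b).deriv_y τ hτ0
    have hznp : solZ h0 h1 hw.lip hw.zero b τ ≤ 0 := by
      refine le_of_tendsto (hasDerivAt_iff_tendsto_slope_left_right.1 hd).1 ?_
      filter_upwards [hev] with t ht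
      rw [slope_def_field, ← hY, hYτ]
      refine div_nonpos_of_nonneg_of_nonpos ?_ ?_
      · linarith [hbefore t ht.1.le ht.2]
      · linarith [ht.2]
    have hzn : solZ h0 h1 hw.lip hw.zero b τ < 0 := by
      refine lt_of_le_of_ne hznp fun e => ?_
      have := (hr b).eq_of_meets h0 hw.lip hw.zero hτ0.le hYτ e
      linarith
    have hac : ContinuousAt (solAng h0 h1 hw.lip hw.zero b) τ :=
      ((hr b).hasDerivAt_ang h0 h1 hw.lip hw.one hb1b hτ0).continuousAt
    have haτ : solAng h0 h1 hw.lip hw.zero b τ < l := by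
      refine lt_of_le_of_ne ?_ fun e => ?_
      · refine le_of_tendsto (hac.tendsto.mono_left (nhdsWithin_le_nhds (s := Iio τ))) ?_
        filter_upwards [hev] with t ht
        exact hle t ht.1 fun x hx => hbefore x hx.1 (hx.2.trans_lt ht.2)
      · have := ((hr b).y_eq_one_iff h0 h1 hw hb1b hτ0.le).2 (by
          rw [← solAng, e, hcos])
        rw [← hY, hYτ] at this
        linarith
    have hsl := (hasDerivAt_iff_tendsto_slope_left_right.1 hd).2.eventually (gt_mem_nhds hzn)
    obtain ⟨t, ⟨ht1, ht2⟩, htτ⟩ := ((hsl.and ((hac.eventually (gt_mem_nhds haτ)).filter_mono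
      nhdsWithin_le_nhds)).and (self_mem_nhdsWithin (s := Ioi τ))).exists
    have htτ : τ < t := htτ
    have ht0 : 0 < t := hτ0.trans htτ
    have hYt : Y t < 0 := by
      rw [slope_def_field, ← hY, hYτ, sub_zero] at ht1
      have : 0 < t - τ := by linarith
      by_contra hcon
      exact absurd ht1 (not_lt.2 (div_nonneg (not_lt.1 hcon) this.le))
    have hev1 := (continuous_solY_param h0 h1 hw.lip hw.zero ht0.le).continuousAt.eventually
      (gt_mem_nhds hYt)
    have hev2 := (continuousAt_solAng h0 h1 hw.lip hw.zero hw.one hb1b ht0.le).eventually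
      (gt_mem_nhds ht2)
    obtain ⟨b', ⟨hb'1, s, hs, hsp, hsl⟩, hy', ha'⟩ := (hfreq.and_eventually (hev1.and hev2)).exists
    have hst : s < t := by
      by_contra hcon
      exact absurd (hsp t ⟨ht0.le, not_lt.1 hcon⟩) (not_lt.2 hy'.le)
    have := (hr b').ang_gt_of_ge h0 h1 hw hb'1 hcos hs hst hsl.le
    rw [solAng] at ha'
    linarith
  refine ⟨b, hb1b, hbc, hpos, fun s hs => ?_, hfreq⟩
  by_contra hcon
  have hs0 : 0 < s := by
    refine lt_of_le_of_ne hs fun e => hcon ?_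
    rw [← e, solAng, ang_zero, hlk, level]
    positivity
  have h2 := (hr b).ang_gt_of_ge h0 h1 hw hb1b hcos hs0 (lt_add_one s) (not_lt.1 hcon)
  exact absurd (hle (s + 1) (by linarith) fun t ht => hpos t ht.1) (not_le.2 h2)

end Shooting

lemma eventually_gt_of_hasDerivAt_pos {f : ℝ → ℝ} {f' x : ℝ} (hd : HasDerivAt f f' x)
    (hf : 0 < f') : ∀ᶠ t in 𝓝[>] x, f x < f t := by
  have hsl := (hasDerivAt_iff_tendsto_slope_left_right.1 hd).2.eventually (lt_mem_nhds hf)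
  filter_upwards [hsl, self_mem_nhdsWithin] with t h1 h2
  have h2 : x < t := h2
  rw [slope_def_field] at h1
  by_contra hcon
  exact absurd h1 (not_lt.2 (div_nonpos_of_nonpos_of_nonneg (by linarith) (by linarith)))

lemma mul_sub_le_of_le_hasDerivAt {f f' : ℝ → ℝ} {a b c : ℝ} (hab : a ≤ b)
    (hf : ContinuousOn f (Icc a b)) (hd : ∀ x ∈ Ioo a b, HasDerivAt f (f' x) x)
    (hc : ∀ x ∈ Ioo a b, c ≤ f' x) : c * (b - a) ≤ f b - f a := by
  refine (convex_Icc a b).mul_sub_le_image_sub_of_le_deriv hf ?_ ?_ a (left_mem_Icc.2 hab) b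
    (right_mem_Icc.2 hab) hab
  · rw [interior_Icc]
    exact fun x hx => (hd x hx).differentiableAt.differentiableWithinAt
  · rw [interior_Icc]
    exact fun x hx => by rw [(hd x hx).deriv]; exact hc x hx

/-- The potential of the force `g`. -/
noncomputable def pot (g : ℝ → ℝ) (y : ℝ) : ℝ := ∫ t in (0 : ℝ)..y, g t

lemma hasDerivAt_pot {g : ℝ → ℝ} (hg : Continuous g) (y : ℝ) : HasDerivAt (pot g) (g y) y :=
  hg.integral_hasStrictDerivAt 0 y |>.hasDerivAt

lemma pot_zero (g : ℝ → ℝ) : pot g 0 = 0 := by simp [pot]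

lemma continuous_pot {g : ℝ → ℝ} (hg : Continuous g) : Continuous (pot g) :=
  continuous_iff_continuousAt.2 fun y => (hasDerivAt_pot hg y).continuousAt

namespace Well

variable {κ : ℝ} {g : ℝ → ℝ} {L : NNReal}

lemma pot_strictAntiOn (hw : Well L κ g) : StrictAntiOn (pot g) (Icc 0 1) := by
  refine strictAntiOn_of_deriv_neg (convex_Icc 0 1) (continuous_pot hw.lip.continuous).continuousOn ?_
  rw [interior_Icc]
  intro y hy
  rw [(hasDerivAt_pot hw.lip.continuous y).deriv]
  exact hw.neg y hy.1 hy.2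

lemma pot_neg (hw : Well L κ g) {y : ℝ} (h0 : 0 < y) (h1 : y ≤ 1) : pot g y < 0 := by
  have := hw.pot_strictAntiOn (left_mem_Icc.2 zero_le_one) ⟨h0.le, h1⟩ h0
  rwa [pot_zero] at this

lemma neg_le_pot (hw : Well L κ g) {y : ℝ} (h0 : 0 ≤ y) : -(κ * y ^ 2 / 2) ≤ pot g y := by
  have hg := hw.lip.continuous
  have := mul_sub_le_of_le_hasDerivAt (f := fun t => pot g t + κ * t ^ 2 / 2)
    (f' := fun t => g t + κ * t) (c := 0) h0
    (((continuous_pot hg).add (by fun_prop)).continuousOn) (fun x _ => by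
      refine ((hasDerivAt_pot hg x).add
        ((((hasDerivAt_id x).pow 2).const_mul κ).div_const 2)).congr_deriv ?_
      simp
      ring) (fun x hx => by linarith [hw.lower x hx.1.le])
  simp only [pot_zero] at this
  linarith

end Well

/-- Energy of the phase point `(y, z)`. -/
noncomputable def energy (g y z : ℝ → ℝ) (s : ℝ) : ℝ := z s ^ 2 / 2 + pot g (y s)

namespace RegSol

variable {δ κ : ℝ} {g : ℝ → ℝ} {L : NNReal} {b : ℝ} {y z : ℝ → ℝ}

lemma hasDerivAt_energy (h : RegSol δ g b y z) (hg : Continuous g) {s : ℝ} (hs : 0 < s) :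
    HasDerivAt (energy g y z) (δ * (cosh s / sinh s) * z s ^ 2) s := by
  refine ((((h.deriv_z s hs).pow 2).div_const 2).add
    ((hasDerivAt_pot hg (y s)).comp s (h.deriv_y s hs))).congr_deriv ?_
  simp
  ring

lemma continuousOn_energy (h : RegSol δ g b y z) (hg : Continuous g) :
    ContinuousOn (energy g y z) (Ici 0) :=
  ((h.cont_z.pow 2).div_const 2).add ((continuous_pot hg).comp_continuousOn h.cont_y)

lemma energy_mono (h : RegSol δ g b y z) (h0 : 0 < δ) (hg : Continuous g) {s t : ℝ} (hs : 0 ≤ s)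
    (hst : s ≤ t) : energy g y z s ≤ energy g y z t := by
  have := mul_sub_le_of_le_hasDerivAt (c := 0) hst
    ((h.continuousOn_energy hg).mono fun x hx => hs.trans hx.1)
    (fun x hx => h.hasDerivAt_energy hg (hs.trans_lt hx.1)) (fun x hx => by
      have := one_le_coth (hs.trans_lt hx.1)
      positivity)
  linarith

lemma not_eventually_gt_one (h : RegSol δ g b y z) (h0 : 0 < δ) (h1 : δ < 1) (hw : Well L κ g)
    (hb : 1 < b) {l : ℝ} (hl : ∀ s, 0 ≤ s → ang δ g y z s < l) {S : ℝ} (hS : 1 ≤ S) :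
    ¬ ∀ s, S ≤ s → 1 < y s := by
  intro hgt
  set D := l + π / 2
  have hD : 0 ≤ D := by
    have := (h.neg_pi_div_two_lt_ang h0 h1 hw hb le_rfl).trans (hl 0 le_rfl)
    simp only [D]
    linarith
  have := h.ang_growth h0 h1 hw hb hS (show S ≤ S + 10 / 3 * D by linarith) fun x hx => by
    have h2 := hgt x hx.1
    have h3 := hw.sub_one_le (y x) h2.le
    nlinarith
  have h3 := h.neg_pi_div_two_lt_ang h0 h1 hw hb (show 0 ≤ S by linarith)
  have h4 := hl (S + 10 / 3 * D) (by linarith)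
  simp only [D] at this h4
  linarith

lemma exists_level_trap (h : RegSol δ g b y z) (h0 : 0 < δ) (h1 : δ < 1) (hw : Well L κ g)
    (hb : 1 < b) {k : ℕ} (hk : ∀ s, 0 ≤ s → ang δ g y z s < level k) :
    ∃ i, 2 * i + 1 ≤ k ∧ (∀ s, 0 ≤ s → ang δ g y z s < level (2 * i + 1)) ∧
      ∃ S, 1 ≤ S ∧ ∀ s, S ≤ s → level (2 * i) < ang δ g y z s := by
  classical
  have hex : ∃ k, ∀ s, 0 ≤ s → ang δ g y z s < level k := ⟨k, hk⟩
  set m := Nat.find hex with hm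
  have hmk : m ≤ k := Nat.find_min' hex hk
  have hms : ∀ s, 0 ≤ s → ang δ g y z s < level m := Nat.find_spec hex
  have key : ∀ S, 1 ≤ S → (∀ s, S ≤ s → 0 < cos (ang δ g y z s)) → False := fun S hS hcos => by
    refine h.not_eventually_gt_one h0 h1 hw hb hms hS fun s hs => ?_
    obtain ⟨A, hA, e, -⟩ := h.polar h0 h1 hw.lip hw.one hb (show 0 ≤ s by linarith)
    have := mul_pos hA (hcos s hs)
    linarith
  rcases hm' : m with _ | m'
  · exfalso
    refine key 1 le_rfl fun s hs => cos_pos_of_mem_Ioo ⟨?_, ?_⟩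
    · exact h.neg_pi_div_two_lt_ang h0 h1 hw hb (by linarith)
    · have := hms s (by linarith)
      rw [hm'] at this
      simpa [level] using this
  · have hlow : ∃ S, 1 ≤ S ∧ ∀ s, S ≤ s → level m' < ang δ g y z s := by
      have := Nat.find_min hex (show m' < m by omega)
      push Not at this
      obtain ⟨s0, hs0, hs0'⟩ := this
      have hs0p : 0 < s0 := by
        refine lt_of_le_of_ne hs0 fun e => ?_
        rw [← e, ang_zero, level] at hs0'
        have : 0 < π / 2 + m' * π := by positivity
        linarith
      exact ⟨s0 + 1, by linarith, fun s hs =>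
        h.ang_gt_of_ge h0 h1 hw hb (cos_level m') hs0p (by linarith) hs0'⟩
    rcases Nat.even_or_odd' m' with ⟨i, rfl | rfl⟩
    · exact ⟨i, by omega, fun s hs => by rw [← hm']; exact hms s hs, hlow⟩
    · exfalso
      obtain ⟨S, hS, hlow⟩ := hlow
      refine key S hS fun s hs => cos_pos_of_level (hlow s hs) ?_
      have := hms s (by linarith)
      rwa [hm'] at this

section Tail

variable {S : ℝ}

lemma tail_deriv_neg (h : RegSol δ g b y z) (h0 : 0 < δ) (hw : Well L κ g)
    (hpos : ∀ s, 0 ≤ s → 0 < y s) (hS : 1 ≤ S) (hlt : ∀ s, S ≤ s → y s < 1) :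
    ∀ s, S ≤ s → z s < 0 := by
  intro s0 hs0
  by_contra hcon
  have hz0 := not_lt.1 hcon
  have hdp : ∀ s, S ≤ s → 0 ≤ z s → 0 < δ * (cosh s / sinh s) * z s - g (y s) := fun s hs hz => by
    have h2 := hw.neg (y s) (hpos s (by linarith)) (hlt s hs)
    have h3 := one_le_coth (s := s) (by linarith)
    have : 0 ≤ δ * (cosh s / sinh s) * z s := by positivity
    linarith
  obtain ⟨s1, hz1, hs1⟩ := ((eventually_gt_of_hasDerivAt_pos (h.deriv_z s0 (by linarith))
    (hdp s0 hs0 hz0)).and self_mem_nhdsWithin).exists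
  have hs1 : s0 < s1 := hs1
  have hz1p : 0 < z s1 := hz0.trans_lt hz1
  have hge : ∀ t, s1 ≤ t → z s1 ≤ z t := fun t ht =>
    image_le_of_deriv_right_lt_deriv_boundary' (f := fun _ => z s1) (f' := fun _ => 0)
      (B := z) (B' := fun s => δ * (cosh s / sinh s) * z s - g (y s)) (a := s1) (b := t)
      continuousOn_const (fun x _ => hasDerivWithinAt_const _ _ _) le_rfl
      (h.cont_z.mono fun x hx => (by linarith [hx.1] : (0 : ℝ) ≤ x))
      (fun x hx => (h.deriv_z x (by linarith [hx.1])).hasDerivWithinAt)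
      (fun x hx hzx => hdp x (by linarith [hx.1]) (by linarith)) (right_mem_Icc.2 ht)
  have hT : s1 ≤ s1 + 1 / z s1 := by
    have : 0 < 1 / z s1 := by positivity
    linarith
  have := mul_sub_le_of_le_hasDerivAt (f := y) (f' := z) (c := z s1) hT
    (h.cont_y.mono fun x hx => (by linarith [hx.1] : (0 : ℝ) ≤ x))
    (fun x hx => h.deriv_y x (by linarith [hx.1])) (fun x hx => hge x hx.1.le)
  rw [add_sub_cancel_left, mul_one_div_cancel hz1p.ne'] at this
  linarith [hlt (s1 + 1 / z s1) (by linarith), hpos s1 (by linarith)]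

lemma tail_antitone (h : RegSol δ g b y z) (hS : 1 ≤ S) (hz : ∀ s, S ≤ s → z s < 0) {s t : ℝ}
    (hs : S ≤ s) (hst : s ≤ t) : y t ≤ y s := by
  have := mul_sub_le_of_le_hasDerivAt (f := fun s => -y s) (f' := fun s => -z s) (c := 0) hst
    ((h.cont_y.mono fun x hx => (by linarith [hx.1] : (0 : ℝ) ≤ x)).neg)
    (fun x hx => (h.deriv_y x (by linarith [hx.1])).neg)
    (fun x hx => by linarith [hz x (by linarith [hx.1])])
  linarith

lemma tendsto_zero (h : RegSol δ g b y z) (h0 : 0 < δ) (h1 : δ < 1) (hw : Well L κ g)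
    (hpos : ∀ s, 0 ≤ s → 0 < y s) (hS : 1 ≤ S) (hlt : ∀ s, S ≤ s → y s < 1) :
    Tendsto y atTop (𝓝 0) := by
  have hz := h.tail_deriv_neg h0 hw hpos hS hlt
  have hsmall : ∀ ε, 0 < ε → ∃ s, S ≤ s ∧ y s < ε := by
    by_contra! hcon
    obtain ⟨ε, hε, hge⟩ := hcon
    have hne : (Icc ε (y S)).Nonempty := nonempty_Icc.2 (hge S le_rfl)
    obtain ⟨x0, hx0, hmax⟩ := isCompact_Icc.exists_isMaxOn hne hw.lip.continuous.continuousOn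
    have hm : g x0 < 0 := hw.neg x0 (hε.trans_le hx0.1) (hx0.2.trans_lt (hlt S le_rfl))
    set W := z S - 7 / 5 * y S with hW
    have hWneg : W < 0 := by linarith [hz S le_rfl, hpos S (by linarith)]
    have hT : S ≤ S + W / g x0 := by
      have := div_pos_of_neg_of_neg hWneg hm
      linarith
    have := mul_sub_le_of_le_hasDerivAt (f := fun s => z s - 7 / 5 * y s)
      (f' := fun s => δ * (cosh s / sinh s) * z s - g (y s) - 7 / 5 * z s) (c := - g x0) hT
      ((h.cont_z.mono fun x hx => (by linarith [hx.1] : (0 : ℝ) ≤ x)).sub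
        (continuousOn_const.mul (h.cont_y.mono fun x hx => (by linarith [hx.1] : (0 : ℝ) ≤ x))))
      (fun x hx => (h.deriv_z x (by linarith [hx.1])).sub
        ((h.deriv_y x (by linarith [hx.1])).const_mul _))
      (fun x hx => by
        have hSx : S ≤ x := hx.1.le
        have hq := coth_le (hS.trans hSx)
        have hq1 := one_le_coth (s := x) (by linarith)
        have h4 := hz x hSx
        have h5 := isMaxOn_iff.1 hmax (y x) ⟨hge x hSx, h.tail_antitone hS hz le_rfl hSx⟩
        have h6 : δ * (cosh x / sinh x) ≤ 7 / 5 := by nlinarith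
        nlinarith)
    rw [add_sub_cancel_left, neg_mul, mul_div_cancel₀ _ hm.ne] at this
    linarith [hz (S + W / g x0) hT, hpos (S + W / g x0) (by linarith)]
  rw [Metric.tendsto_atTop]
  intro ε hε
  obtain ⟨s, hs, hys⟩ := hsmall ε hε
  refine ⟨s, fun t ht => ?_⟩
  have h3 := h.tail_antitone hS hz hs ht
  have h4 := hpos t (by linarith)
  rw [Real.dist_eq, sub_zero, abs_of_pos h4]
  linarith

lemma energy_nonpos (h : RegSol δ g b y z) (h0 : 0 < δ) (hw : Well L κ g)
    (hpos : ∀ s, 0 ≤ s → 0 < y s) (hS : 1 ≤ S) (hlt : ∀ s, S ≤ s → y s < 1) {s0 : ℝ}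
    (hs0 : 0 ≤ s0) : energy g y z s0 ≤ 0 := by
  by_contra hcon
  have he := not_le.1 hcon
  have hz := h.tail_deriv_neg h0 hw hpos hS hlt
  set r := √(2 * energy g y z s0) with hr
  have hrp : 0 < r := by positivity
  set T := max s0 S with hT
  have hTS : S ≤ T := le_max_right _ _
  have hzr : ∀ x, T ≤ x → z x ≤ -r := fun x hx => by
    have h2 := h.energy_mono h0 hw.lip.continuous hs0 ((le_max_left s0 S).trans hx)
    have hSx : S ≤ x := hTS.trans hx
    have h3 := hw.pot_neg (hpos x (by linarith)) (hlt x hSx).le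
    have h5 : 2 * energy g y z s0 ≤ z x ^ 2 := by
      have : energy g y z x = z x ^ 2 / 2 + pot g (y x) := rfl
      linarith
    have h6 := abs_le_abs_of_nonneg hrp.le (Real.sqrt_le_sqrt h5)
    rw [Real.sqrt_sq_eq_abs, abs_abs, abs_of_neg (hz x hSx), abs_of_pos hrp] at h6
    linarith
  have hyT := hpos T (by linarith)
  have hTT : T ≤ T + y T / r := by
    have : 0 < y T / r := by positivity
    linarith
  have := mul_sub_le_of_le_hasDerivAt (f := fun s => -y s) (f' := fun s => -z s) (c := r) hTT
    ((h.cont_y.mono fun x hx => (by linarith [hx.1] : (0 : ℝ) ≤ x)).neg)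
    (fun x hx => (h.deriv_y x (by linarith [hx.1])).neg)
    (fun x hx => by linarith [hzr x hx.1.le])
  rw [add_sub_cancel_left, mul_div_cancel₀ _ hrp.ne'] at this
  linarith [hpos (T + y T / r) (by linarith)]

end Tail

lemma encard_crossings (h : RegSol δ g b y z) (h0 : 0 < δ) (h1 : δ < 1) (hw : Well L κ g)
    (hb : 1 < b) {k : ℕ} (hk : ∀ s, 0 ≤ s → ang δ g y z s < level (k + 1)) {S : ℝ} (hS : 0 < S)
    (hSk : level k < ang δ g y z S) : {s | 0 < s ∧ y s = 1}.encard = ((k + 1 : ℕ) : ℕ∞) := by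
  have hinj : InjOn (ang δ g y z) {s | 0 < s ∧ y s = 1} := by
    intro s hs t ht hst
    have hcs := (h.y_eq_one_iff h0 h1 hw hb hs.1.le).1 hs.2
    have hct := (h.y_eq_one_iff h0 h1 hw hb ht.1.le).1 ht.2
    rcases lt_trichotomy s t with hlt | heq | hlt
    · have := h.ang_gt_of_ge h0 h1 hw hb hcs hs.1 hlt le_rfl
      linarith
    · exact heq
    · have := h.ang_gt_of_ge h0 h1 hw hb hct ht.1 hlt le_rfl
      linarith
  have hlinj : InjOn level (Finset.range (k + 1) : Set ℕ) := fun i _ j _ hij => by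
    simp only [level] at hij
    have : (i : ℝ) * π = j * π := by linarith
    exact_mod_cast mul_right_cancel₀ pi_ne_zero this
  have himg : ang δ g y z '' {s | 0 < s ∧ y s = 1} = level '' (Finset.range (k + 1) : Set ℕ) := by
    ext θ
    constructor
    · rintro ⟨s, ⟨hs, hys⟩, rfl⟩
      have hc := (h.y_eq_one_iff h0 h1 hw hb hs.le).1 hys
      obtain ⟨j, hj⟩ := cos_eq_zero_iff.1 hc
      have h2 := h.neg_pi_div_two_lt_ang h0 h1 hw hb hs.le
      have h3 := hk s hs.le
      simp only [level, Nat.cast_add, Nat.cast_one] at h3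
      have h4 : (-1 : ℝ) < j := by nlinarith [pi_pos]
      have h5 : (j : ℝ) < k + 1 := by nlinarith [pi_pos]
      have h4' : (-1 : ℤ) < j := by exact_mod_cast h4
      have h5' : j < (k : ℤ) + 1 := by exact_mod_cast h5
      lift j to ℕ using by omega
      refine ⟨j, ?_, ?_⟩
      · simp only [Finset.coe_range, mem_Iio]
        omega
      · rw [hj, level]
        push_cast
        ring
    · rintro ⟨j, hj, rfl⟩
      simp only [Finset.coe_range, mem_Iio] at hj
      have hj0 : 0 < level j := by rw [level]; positivity
      obtain ⟨s, hs, hsj⟩ := intermediate_value_Icc hS.le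
        ((h.continuousOn_ang h0 h1 hw.lip hw.one hb).mono Icc_subset_Ici_self)
        (show level j ∈ Icc (ang δ g y z 0) (ang δ g y z S) from
          ⟨by rw [ang_zero]; exact hj0.le,
            (level_mono (show j ≤ k by omega)).trans hSk.le⟩)
      have hs0 : 0 < s := by
        refine lt_of_le_of_ne hs.1 fun e => ?_
        rw [← e, ang_zero] at hsj
        linarith
      exact ⟨s, ⟨hs0, (h.y_eq_one_iff h0 h1 hw hb hs0.le).2 (hsj ▸ cos_level j)⟩, hsj⟩
  rw [← hinj.encard_image, himg, hlinj.encard_image, Set.encard_coe_eq_coe_finsetCard,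
    Finset.card_range]

/-- Climbing from a small value at small negative energy back to `1` makes the energy positive. -/
lemma energy_pos_of_climb (h : RegSol δ g b y z) (h0 : 0 < δ) (hw : Well L κ g) {s t η : ℝ}
    (hs : 0 < s) (hst : s ≤ t) (hys : y s ≤ 1 / 2) (hyt : y t = 1)
    (hle : ∀ x ∈ Ico s t, y x ≤ 1) (hE : -η ≤ energy g y z s)
    (hη1 : η ≤ -pot g (1 / 2) / 2) (hη2 : η < δ * √(-pot g (1 / 2)) / 2) :
    0 < energy g y z t := by
  have hyc : ContinuousOn y (Icc s t) := h.cont_y.mono fun x hx => hs.le.trans hx.1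
  have hK : IsCompact (Icc s t ∩ {x | y x ≤ 1 / 2}) :=
    isCompact_Icc.of_isClosed_subset (hyc.preimage_isClosed_of_isClosed isClosed_Icc isClosed_Iic)
      inter_subset_left
  obtain ⟨σ, ⟨hσ, hyσ⟩, hgr⟩ := hK.exists_isGreatest ⟨s, left_mem_Icc.2 hst, hys⟩
  have hyσ : y σ ≤ 1 / 2 := hyσ
  set c := -pot g (1 / 2) with hc
  have hc0 : 0 < c := by
    have := hw.pot_neg (y := 1 / 2) (by norm_num) (by norm_num)
    linarith
  have hgt : ∀ x ∈ Ioo σ t, 1 / 2 < y x := fun x hx => by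
    by_contra hcon
    have := hgr ⟨⟨hσ.1.trans hx.1.le, hx.2.le⟩, not_lt.1 hcon⟩
    linarith [hx.1]
  have hσ0 : 0 < σ := hs.trans_le hσ.1
  have hsub : Icc σ t ⊆ Ici 0 := fun x hx => hσ0.le.trans hx.1
  have key := mul_sub_le_of_le_hasDerivAt (f := fun x => energy g y z x - δ * √c * y x)
    (f' := fun x => δ * (cosh x / sinh x) * z x ^ 2 - δ * √c * z x) (c := 0) hσ.2
    (((h.continuousOn_energy hw.lip.continuous).mono hsub).sub
      (continuousOn_const.mul (h.cont_y.mono hsub)))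
    (fun x hx => (h.hasDerivAt_energy hw.lip.continuous (hσ0.trans hx.1)).sub
      ((h.deriv_y x (hσ0.trans hx.1)).const_mul _))
    (fun x hx => by
      have hx0 := hσ0.trans hx.1
      have h2 := h.energy_mono h0 hw.lip.continuous hs.le (hσ.1.trans hx.1.le)
      have h3 := hgt x hx
      have h4 := hle x ⟨hσ.1.trans hx.1.le, hx.2⟩
      have h5 := hw.pot_strictAntiOn.antitoneOn (⟨by norm_num, by norm_num⟩ : (1 / 2 : ℝ) ∈ Icc 0 1)
        ⟨by linarith, h4⟩ h3.le
      have h6 : c ≤ z x ^ 2 := by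
        have : energy g y z x = z x ^ 2 / 2 + pot g (y x) := rfl
        linarith
      have h7 : √c ≤ |z x| := by
        rw [← Real.sqrt_sq_eq_abs]
        exact Real.sqrt_le_sqrt h6
      have h8 := one_le_coth hx0
      have h9 : √c * z x ≤ z x ^ 2 := by
        rw [← sq_abs (z x)]
        calc √c * z x ≤ √c * |z x| := by gcongr; exact le_abs_self _
          _ ≤ |z x| * |z x| := by gcongr
          _ = _ := by ring
      have h10 : z x ^ 2 ≤ cosh x / sinh x * z x ^ 2 := by nlinarith [sq_nonneg (z x)]
      have := mul_le_mul_of_nonneg_left (h9.trans h10) h0.le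
      linarith)
  have h2 := h.energy_mono h0 hw.lip.continuous hs.le hσ.1
  have h3 : 0 ≤ δ * √c := by positivity
  have h4 : δ * √c * (1 / 2) ≤ δ * √c * (y t - y σ) := by
    apply mul_le_mul_of_nonneg_left _ h3
    linarith
  simp only [zero_mul] at key
  linarith

end RegSol

section Profile

variable {δ κ : ℝ} {g : ℝ → ℝ} {L : NNReal}

/-- A limit of winding solutions crosses `1` as many times as the winding level allows. -/
lemma le_of_frequently_winds (h0 : 0 < δ) (h1 : δ < 1) (hw : Well L κ g) {b : ℝ} (hb : 1 < b)
    {n i : ℕ} (hf : ∃ᶠ b' in 𝓝 b, Winds h0 h1 hw (level (2 * n + 1)) b')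
    (hang : ∀ s, 0 ≤ s → solAng h0 h1 hw.lip hw.zero b s < level (2 * i + 1)) {S : ℝ} (hS : 1 ≤ S)
    (hlow : ∀ s, S ≤ s → level (2 * i) < solAng h0 h1 hw.lip hw.zero b s)
    (hpos : ∀ s, 0 ≤ s → 0 < solY h0 h1 hw.lip hw.zero b s)
    (hlim : Tendsto (solY h0 h1 hw.lip hw.zero b) atTop (𝓝 0)) : n ≤ i := by
  by_contra! hin
  have hr := regSol_sol h0 h1 hw.lip hw.zero
  set c := -pot g (1 / 2) with hc
  have hc0 : 0 < c := by
    have := hw.pot_neg (y := 1 / 2) (by norm_num) (by norm_num)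
    linarith
  obtain ⟨η, hη, hη1, hη2⟩ : ∃ η, 0 < η ∧ η ≤ c / 2 ∧ η < δ * √c / 2 := by
    have : 0 < δ * √c := by positivity
    refine ⟨min (c / 2) (δ * √c / 4), by positivity, min_le_left _ _,
      (min_le_right _ _).trans_lt (by linarith)⟩
  have hlimκ : Tendsto (fun s => κ * solY h0 h1 hw.lip hw.zero b s ^ 2 / 2) atTop (𝓝 0) := by
    have := ((hlim.pow 2).const_mul κ).div_const 2
    simpa using this
  obtain ⟨s1, hs1S, hy1, hκ1⟩ := ((eventually_ge_atTop S).and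
    ((hlim.eventually (gt_mem_nhds (show (0 : ℝ) < 1 / 2 by norm_num))).and
      (hlimκ.eventually (gt_mem_nhds hη)))).exists
  have hs1 : 0 < s1 := by linarith
  have hE1 : -η < energy g (solY h0 h1 hw.lip hw.zero b) (solZ h0 h1 hw.lip hw.zero b) s1 := by
    have := hw.neg_le_pot (hpos s1 hs1.le).le
    rw [energy]
    nlinarith [sq_nonneg (solZ h0 h1 hw.lip hw.zero b s1)]
  have cy := (continuous_solY_param h0 h1 hw.lip hw.zero hs1.le).continuousAt (x := b)
  have cz := (continuous_solZ_param h0 h1 hw.lip hw.zero hs1.le).continuousAt (x := b)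
  have ca := continuousAt_solAng h0 h1 hw.lip hw.zero hw.one hb hs1.le
  have cE : ContinuousAt (fun b => energy g (solY h0 h1 hw.lip hw.zero b)
      (solZ h0 h1 hw.lip hw.zero b) s1) b :=
    ((cz.pow 2).div_const 2).add ((continuous_pot hw.lip.continuous).continuousAt.comp cy)
  obtain ⟨b', ⟨hb', t, ht, htp, hta⟩, hE, hy, ha1, ha2⟩ := (hf.and_eventually
    ((cE.eventually (lt_mem_nhds hE1)).and ((cy.eventually (gt_mem_nhds hy1)).and
      ((ca.eventually (gt_mem_nhds (hang s1 hs1.le))).and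
        (ca.eventually (lt_mem_nhds (hlow s1 hs1S))))))).exists
  replace hr := hr b'
  set Y := solY h0 h1 hw.lip hw.zero b'
  set Z := solZ h0 h1 hw.lip hw.zero b'
  set θ := solAng h0 h1 hw.lip hw.zero b' with hθ
  have hθc : ContinuousOn θ (Ici 0) := hr.continuousOn_ang h0 h1 hw.lip hw.one hb'
  have hup : ∀ {l s t : ℝ}, cos l = 0 → 0 < s → s < t → l ≤ θ s → l < θ t :=
    fun hl hs hst hls => hr.ang_gt_of_ge h0 h1 hw hb' hl hs hst hls
  have hlev : level (2 * i + 1) + 2 * π ≤ level (2 * n + 1) := by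
    have := level_mono (show 2 * i + 1 + 1 + 1 ≤ 2 * n + 1 by omega)
    rw [level_succ, level_succ] at this
    linarith
  have hpi := pi_pos
  have hs1t : s1 < t := by
    by_contra hcon
    have := hr.ang_ge_of_ge h0 h1 hw hb' (cos_level (2 * n + 1)) ht (not_lt.1 hcon) hta.le
    have : level (2 * n + 1) ≤ θ s1 := this
    linarith
  obtain ⟨s2, hs2, hθ2⟩ := intermediate_value_Icc hs1t.le
    (hθc.mono fun x hx => hs1.le.trans hx.1)
    (show level (2 * i + 1) ∈ Icc (θ s1) (θ t) from ⟨ha1.le, by linarith⟩)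
  have hs20 : 0 < s2 := hs1.trans_le hs2.1
  obtain ⟨s3, hs3, hθ3⟩ := intermediate_value_Icc hs2.2
    (hθc.mono fun x hx => hs20.le.trans hx.1)
    (show level (2 * i + 1) + 3 * π / 2 ∈ Icc (θ s2) (θ t) from ⟨by linarith, by linarith⟩)
  have hs30 : 0 < s3 := hs20.trans_le hs3.1
  have hE3 : energy g Y Z s3 < 0 := by
    obtain ⟨A, hA, e1, e2⟩ := hr.polar h0 h1 hw.lip hw.one hb' hs30.le
    have hθ3' : ang δ g Y Z s3 = π + (i + 1 : ℕ) * (2 * π) := by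
      rw [show ang δ g Y Z s3 = θ s3 from rfl, hθ3, level]
      push_cast
      ring
    rw [hθ3'] at e1 e2
    rw [cos_add_nat_mul_two_pi, cos_pi] at e1
    rw [sin_add_nat_mul_two_pi, sin_pi, mul_zero, neg_zero] at e2
    have := hw.pot_neg (htp s3 ⟨hs30.le, hs3.2⟩) (by linarith)
    rw [energy, e2]
    simpa using this
  have hE2 : 0 < energy g Y Z s2 := by
    refine hr.energy_pos_of_climb h0 hw hs1 hs2.1 hy.le
      ((hr.y_eq_one_iff h0 h1 hw hb' hs20.le).2 ?_) ?_ hE.le hη1 hη2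
    · rw [show ang δ g Y Z s2 = θ s2 from rfl, hθ2, cos_level]
    · intro x hx
      have hx0 : 0 < x := hs1.trans_le hx.1
      obtain ⟨A, hA, e, -⟩ := hr.polar h0 h1 hw.lip hw.one hb' hx0.le
      have hc1 : level (2 * i) < θ x := by
        rcases hx.1.eq_or_lt with rfl | hlt
        · exact ha2
        · exact hup (cos_level _) hs1 hlt ha2.le
      have hc2 : θ x < level (2 * i + 1) := by
        by_contra hcon
        have := hup (cos_level _) hx0 hx.2 (not_lt.1 hcon)
        linarith
      have := mul_neg_of_pos_of_neg hA (cos_neg_of_level hc1 hc2)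
      have h5 : Y x - 1 = A * cos (θ x) := e
      linarith
  linarith [hr.energy_mono h0 hw.lip.continuous hs20.le hs3.1]

/-- Positive solutions tending to `0` with a prescribed odd number of crossings of `1`. -/
theorem exists_profile (h0 : 0 < δ) (h1 : δ < 1) (hw : Well L κ g) (n : ℕ) {c : ℝ}
    (hc : 1 < c) (hcw : ¬ Winds h0 h1 hw (level (2 * n + 1)) c) :
    ∃ b y z, 1 < b ∧ Continuous y ∧ RegSol δ g b y z ∧ (∀ s, 0 ≤ s → 0 < y s) ∧
      {s | 0 < s ∧ y s = 1}.encard = ((2 * n + 1 : ℕ) : ℕ∞) ∧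
      (∀ s, 0 ≤ s → energy g y z s ≤ 0) ∧
      (∃ S, 1 ≤ S ∧ ∀ s, S ≤ s → y s < 1 ∧ z s < 0) ∧ Tendsto y atTop (𝓝 0) := by
  obtain ⟨b, hb, -, hpos, hang, hf⟩ := exists_threshold h0 h1 hw (2 * n + 1) hc hcw
  have hr := regSol_sol h0 h1 hw.lip hw.zero b
  obtain ⟨i, hik, hangi, S, hS, hlow⟩ := hr.exists_level_trap h0 h1 hw hb hang
  have hlt : ∀ s, S ≤ s → solY h0 h1 hw.lip hw.zero b s < 1 := fun s hs => by
    have hs0 : 0 ≤ s := by linarith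
    obtain ⟨A, hA, e, -⟩ := hr.polar h0 h1 hw.lip hw.one hb hs0
    have := mul_neg_of_pos_of_neg hA (cos_neg_of_level (hlow s hs) (hangi s hs0))
    linarith
  have hlim := hr.tendsto_zero h0 h1 hw hpos hS hlt
  have hni := le_of_frequently_winds h0 h1 hw hb hf hangi hS hlow hpos hlim
  obtain rfl : n = i := by omega
  exact ⟨b, _, _, hb, continuous_solY h0 h1 hw.lip hw.zero b, hr, hpos,
    hr.encard_crossings h0 h1 hw hb hangi (by linarith) (hlow S le_rfl),
    fun s hs => hr.energy_nonpos h0 hw hpos hS hlt hs,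
    ⟨S, hS, fun s hs => ⟨hlt s hs, hr.tail_deriv_neg h0 hw hpos hS hlt s hs⟩⟩, hlim⟩

end Profile

/-- Slope of the power `y ^ p`, frozen outside `[0, M]`. -/
noncomputable def truncSlope (p M y : ℝ) : ℝ := p * (max 0 (min y M)) ^ (p - 1)

/-- The power `y ^ p` on `[0, M]`, extended as a `C¹` convex function of linear growth. -/
noncomputable def truncPow (p M y : ℝ) : ℝ := ∫ t in (0 : ℝ)..y, truncSlope p M t

/-- The force of the profile equation in logarithmic variables. -/
noncomputable def force (κ p M y : ℝ) : ℝ := κ * (truncPow p M y - y)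

section Force

variable {κ p M : ℝ}

lemma continuous_truncSlope (hp : 1 < p) : Continuous (truncSlope p M) := by
  unfold truncSlope
  exact continuous_const.mul ((by fun_prop : Continuous fun y : ℝ => max 0 (min y M)).rpow_const
    fun _ => Or.inr (by linarith))

lemma hasDerivAt_truncPow (hp : 1 < p) (y : ℝ) :
    HasDerivAt (truncPow p M) (truncSlope p M y) y :=
  ((continuous_truncSlope hp).integral_hasStrictDerivAt 0 y).hasDerivAt

lemma hasDerivAt_force (hp : 1 < p) (y : ℝ) :
    HasDerivAt (force κ p M) (κ * (truncSlope p M y - 1)) y :=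
  ((hasDerivAt_truncPow hp y).sub (hasDerivAt_id y)).const_mul κ

lemma truncSlope_nonneg (hp : 1 < p) (y : ℝ) : 0 ≤ truncSlope p M y :=
  mul_nonneg (by linarith) (rpow_nonneg (le_max_left _ _) _)

lemma truncSlope_le (hp : 1 < p) (hM : 0 ≤ M) (y : ℝ) : truncSlope p M y ≤ p * M ^ (p - 1) := by
  refine mul_le_mul_of_nonneg_left ?_ (by linarith)
  exact rpow_le_rpow (le_max_left _ _) (max_le hM (min_le_right _ _)) (by linarith)

lemma le_truncSlope (hp : 1 < p) (hM : 1 ≤ M) {y : ℝ} (hy : 1 ≤ y) : p ≤ truncSlope p M y := by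
  have : 1 ≤ (max 0 (min y M)) ^ (p - 1) :=
    one_le_rpow ((le_min hy hM).trans (le_max_right _ _)) (by linarith)
  rw [truncSlope]
  nlinarith

lemma truncPow_eq (hp : 1 < p) {y : ℝ} (h0 : 0 ≤ y) (hM : y ≤ M) : truncPow p M y = y ^ p := by
  rw [truncPow, intervalIntegral.integral_congr (g := fun t => p * t ^ (p - 1)),
    intervalIntegral.integral_const_mul, integral_rpow (Or.inl (by linarith)), sub_add_cancel,
    zero_rpow (by linarith), sub_zero, mul_div_cancel₀ _ (by linarith)]
  intro t ht
  rw [uIcc_of_le h0] at ht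
  simp only [truncSlope]
  rw [min_eq_left (ht.2.trans hM), max_eq_right ht.1]

lemma force_eq (hp : 1 < p) {y : ℝ} (h0 : 0 ≤ y) (hM : y ≤ M) :
    force κ p M y = κ * (y ^ p - y) := by rw [force, truncPow_eq hp h0 hM]

lemma lipschitzWith_force (hp : 1 < p) (hM : 0 ≤ M) (hκ : 0 ≤ κ) :
    LipschitzWith (κ * (p * M ^ (p - 1) + 1)).toNNReal (force κ p M) := by
  refine lipschitzWith_of_nnnorm_deriv_le (fun y => (hasDerivAt_force hp y).differentiableAt)
    fun y => ?_
  have hnn : 0 ≤ p * M ^ (p - 1) := (truncSlope_nonneg hp 0).trans (truncSlope_le hp hM 0)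
  rw [← NNReal.coe_le_coe, coe_nnnorm, (hasDerivAt_force hp y).deriv,
    Real.coe_toNNReal _ (by positivity), Real.norm_eq_abs, abs_mul, abs_of_nonneg hκ]
  refine mul_le_mul_of_nonneg_left ?_ hκ
  rw [abs_le]
  constructor
  · linarith [truncSlope_nonneg (M := M) hp y]
  · linarith [truncSlope_le hp hM y]

lemma well_force (hp : 1 < p) (hM : 1 ≤ M) (hκ : 0 < κ) (hκp : 1 < κ * (p - 1)) :
    Well (κ * (p * M ^ (p - 1) + 1)).toNNReal κ (force κ p M) where
  lip := lipschitzWith_force hp (by linarith) hκ.le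
  zero := by rw [force_eq hp le_rfl (by linarith), zero_rpow (by linarith)]; simp
  one := by rw [force_eq hp zero_le_one hM, one_rpow]; simp
  neg := fun y h0 h1 => by
    rw [force_eq hp h0.le (by linarith)]
    have := rpow_lt_self_of_lt_one h0 h1 hp
    exact mul_neg_of_pos_of_neg hκ (by linarith)
  sub_one_le := fun y hy => by
    have := mul_sub_le_of_le_hasDerivAt (c := 1) hy
      (fun x _ => (hasDerivAt_force (κ := κ) (M := M) hp x).continuousAt.continuousWithinAt)
      (fun x _ => hasDerivAt_force hp x) (fun x hx => by
        have := le_truncSlope hp hM hx.1.le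
        nlinarith)
    rw [force_eq hp zero_le_one hM, one_rpow] at this
    simpa using this
  near_one := by
    have hd := hasDerivAt_iff_tendsto_slope.1 (hasDerivAt_force (κ := κ) (M := M) hp 1)
    have h1 : 1 < κ * (truncSlope p M 1 - 1) :=
      hκp.trans_le (mul_le_mul_of_nonneg_left (by linarith [le_truncSlope hp hM le_rfl]) hκ.le)
    have hev := eventually_nhdsWithin_iff.1 (hd.eventually (lt_mem_nhds h1))
    obtain ⟨ε, hε, hball⟩ := Metric.eventually_nhds_iff.1 hev
    refine ⟨ε / 2, by positivity, fun y hy => ?_⟩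
    rcases eq_or_ne y 1 with rfl | hne
    · simp
    · have := hball (y := y) (by rw [Real.dist_eq]; linarith) hne
      rw [slope_def_field, force_eq (y := 1) hp zero_le_one hM, one_rpow, sub_self, mul_zero,
        sub_zero] at this
      have h2 : 0 < (y - 1) ^ 2 := by
        have := sub_ne_zero.2 hne
        positivity
      have h3 := mul_lt_mul_of_pos_left this h2
      rw [mul_one] at h3
      refine h3.le.trans_eq ?_
      have := sub_ne_zero.2 hne
      field_simp
  lower := fun y hy => by
    have : 0 ≤ truncPow p M y :=
      intervalIntegral.integral_nonneg hy fun t _ => truncSlope_nonneg hp t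
    rw [force]
    nlinarith

lemma pot_force_eq (hp : 1 < p) {y : ℝ} (h0 : 0 ≤ y) (hM : y ≤ M) :
    pot (force κ p M) y = κ * (y ^ (p + 1) / (p + 1) - y ^ 2 / 2) := by
  have hi : IntervalIntegrable (fun t : ℝ => t ^ p) volume 0 y :=
    intervalIntegral.intervalIntegrable_rpow' (by linarith)
  have hi' : IntervalIntegrable (fun t : ℝ => t) volume 0 y :=
    continuous_id.intervalIntegrable 0 y
  rw [pot, intervalIntegral.integral_congr (g := fun t => κ * (t ^ p - t)),
    intervalIntegral.integral_const_mul, intervalIntegral.integral_sub hi hi', integral_rpow (Or.inl (by linarith)),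
    integral_id, zero_rpow (by linarith)]
  · ring
  · intro t ht
    rw [uIcc_of_le h0] at ht
    exact force_eq hp ht.1 (ht.2.trans hM)

lemma le_of_pot_force_nonpos (hp : 1 < p) (hM : 1 ≤ M) (hMp : (p + 1) / 2 ≤ M ^ (p - 1))
    (hκ : 0 < κ) (hκp : 1 < κ * (p - 1)) {y : ℝ} (hy : pot (force κ p M) y ≤ 0) :
    y ≤ M := by
  by_contra! hcon
  have hw := well_force hp hM hκ hκp
  have h1 : 0 ≤ pot (force κ p M) M := by
    rw [pot_force_eq hp (by linarith) le_rfl]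
    refine mul_nonneg hκ.le ?_
    have e : M ^ (p + 1) = M ^ (p - 1) * M ^ 2 := by
      rw [← rpow_natCast M 2, ← rpow_add (by linarith)]
      congr 1
      push_cast
      ring
    rw [e, sub_nonneg, le_div_iff₀ (by linarith)]
    have := mul_le_mul_of_nonneg_right hMp (sq_nonneg M)
    linarith
  have hmono : StrictMonoOn (pot (force κ p M)) (Ici 1) := by
    refine strictMonoOn_of_deriv_pos (convex_Ici 1) (continuous_pot hw.lip.continuous).continuousOn
      fun x hx => ?_
    rw [interior_Ici] at hx
    have hx : 1 < x := hx
    rw [(hasDerivAt_pot hw.lip.continuous x).deriv]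
    linarith [hw.sub_one_le x hx.le]
  have := hmono (mem_Ici.2 hM) (mem_Ici.2 (hM.trans hcon.le)) hcon
  linarith

end Force

lemma sinh_le_mul_cosh {s : ℝ} (hs : 0 ≤ s) : sinh s ≤ s * cosh s := by
  have := mul_sub_le_of_le_hasDerivAt (f := fun s => s * cosh s - sinh s)
    (f' := fun s => s * sinh s) (c := 0) hs (by fun_prop)
    (fun x _ => (((hasDerivAt_id x).mul (hasDerivAt_cosh x)).sub (hasDerivAt_sinh x)).congr_deriv
      (by simp)) (fun x hx => mul_nonneg hx.1.le (sinh_nonneg_iff.2 hx.1.le))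
  simpa using this

lemma hasDerivAt_cosh_rpow (r s : ℝ) :
    HasDerivAt (fun s => cosh s ^ r) (r * (sinh s / cosh s) * cosh s ^ r) s := by
  refine ((hasDerivAt_cosh s).rpow_const (Or.inl (cosh_pos s).ne')).congr_deriv ?_
  rw [rpow_sub_one (cosh_pos s).ne']
  ring

section Constant

variable {α δ M : ℝ}

/-- The profile corresponding to the constant solution. -/
lemma regSol_const (hα : 0 < α) {c : ℝ} (hc : 0 ≤ c) (hcM : c ≤ M)
    (hcp : α * (α + δ) * c ^ (2 / α) = α * (α + 1)) :
    RegSol δ (force (α * (α + δ)) (1 + 2 / α) M) c (fun s => c * cosh s ^ (-α))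
      (fun s => -α * (sinh s / cosh s) * (c * cosh s ^ (-α))) := by
  have hp : 1 < 1 + 2 / α := by
    have : 0 < 2 / α := by positivity
    linarith
  have hcs : Continuous fun s : ℝ => cosh s ^ (-α) :=
    continuous_cosh.rpow_const fun s => Or.inl (cosh_pos s).ne'
  have hle : ∀ s, cosh s ^ (-α) ≤ 1 := fun s =>
    rpow_le_one_of_one_le_of_nonpos (one_le_cosh s) (by linarith)
  have hth : Continuous fun s : ℝ => sinh s / cosh s :=
    continuous_sinh.div continuous_cosh fun s => (cosh_pos s).ne'
  refine ⟨(continuous_const.mul hcs).continuousOn,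
    ((continuous_const.mul hth).mul (continuous_const.mul hcs)).continuousOn, by simp, by simp,
    fun s hs => ?_, fun s hs => ?_, fun S => ⟨α * c, fun s hs _ => ?_⟩⟩
  · refine ((hasDerivAt_cosh_rpow (-α) s).const_mul c).congr_deriv ?_
    ring
  · have hC := cosh_pos s
    have hS := sinh_pos_iff.2 hs
    have hy0 : 0 ≤ c * cosh s ^ (-α) := mul_nonneg hc (rpow_nonneg hC.le _)
    have hyM : c * cosh s ^ (-α) ≤ M :=
      (mul_le_of_le_one_right hc (hle s)).trans hcM
    rw [force_eq hp hy0 hyM]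
    have e : cosh s ^ (-α * (2 / α)) = (cosh s ^ 2)⁻¹ := by
      rw [show -α * (2 / α) = -(2 : ℝ) by field_simp, rpow_neg hC.le, rpow_ofNat]
    have hpow : α * (α + δ) * (c * cosh s ^ (-α)) ^ (1 + 2 / α)
        = α * (α + 1) * (c * cosh s ^ (-α)) / cosh s ^ 2 := by
      rw [rpow_add' hy0 (by linarith), rpow_one, mul_rpow hc (rpow_nonneg hC.le _),
        ← rpow_mul hC.le, e, ← hcp]
      ring
    rw [mul_sub, hpow]
    have hd := ((hasDerivAt_sinh s).div (hasDerivAt_cosh s) hC.ne').const_mul (-α) |>.mul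
      ((hasDerivAt_cosh_rpow (-α) s).const_mul c)
    refine hd.congr_deriv ?_
    generalize cosh s ^ (-α) = w
    simp only [Pi.div_apply]
    have := cosh_sq s
    field_simp
    rw [this]
    ring
  · have hC := cosh_pos s
    have h2 : 0 ≤ sinh s := sinh_nonneg_iff.2 hs
    have h3 : sinh s / cosh s ≤ s := by
      rw [div_le_iff₀ hC]
      exact sinh_le_mul_cosh hs
    have h4 : 0 ≤ cosh s ^ (-α) := rpow_nonneg hC.le _
    rw [abs_mul, abs_mul, abs_neg, abs_of_pos hα, abs_of_nonneg (a := sinh s / cosh s) (by positivity),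
      abs_of_nonneg (a := c * _) (by positivity)]
    calc α * (sinh s / cosh s) * (c * cosh s ^ (-α)) ≤ α * s * (c * 1) := by
          gcongr
          exact hle s
      _ = _ := by ring

lemma not_winds_const (hα : 0 < α) (h0 : 0 < δ) (h1 : δ < 1) {L : NNReal} {c : ℝ} (hc : 1 < c)
    (hcM : c ≤ M) (hcp : α * (α + δ) * c ^ (2 / α) = α * (α + 1))
    (hw : Well L (α * (α + δ)) (force (α * (α + δ)) (1 + 2 / α) M)) {k : ℕ} (hk : 1 ≤ k) :
    ¬ Winds h0 h1 hw (level k) c := by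
  rintro ⟨-, s, hs, -, hang⟩
  have hreg := regSol_const hα (by linarith) hcM hcp
  have hcs : Continuous fun s : ℝ => cosh s ^ (-α) :=
    continuous_cosh.rpow_const fun s => Or.inl (cosh_pos s).ne'
  have hY : ∀ t, 0 ≤ t → c * cosh t ^ (-α) = solY h0 h1 hw.lip hw.zero c t := fun t ht =>
    hreg.eq_sol h0 h1 hw.lip hw.zero (continuous_const.mul hcs) ⟨c, fun t => by
      change |c * cosh t ^ (-α)| ≤ c
      rw [abs_of_nonneg (mul_nonneg (by linarith) (rpow_nonneg (cosh_pos t).le _))]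
      exact mul_le_of_le_one_right (by linarith)
        (rpow_le_one_of_one_le_of_nonpos (one_le_cosh t) (by linarith))⟩ ht
  have hr := regSol_sol h0 h1 hw.lip hw.zero c
  have hZ : ∀ t, 0 < t → solZ h0 h1 hw.lip hw.zero c t < 0 := fun t ht => by
    have e : (fun t => c * cosh t ^ (-α)) =ᶠ[𝓝 t] solY h0 h1 hw.lip hw.zero c := by
      filter_upwards [lt_mem_nhds ht] with x hx using hY x hx.le
    rw [((hr.deriv_y t ht).congr_of_eventuallyEq e).unique (hreg.deriv_y t ht)]
    have h2 := cosh_pos t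
    have h3 := sinh_pos_iff.2 ht
    have h4 : 0 < cosh t ^ (-α) := rpow_pos_of_pos h2 _
    have : 0 < α * (sinh t / cosh t) * (c * cosh t ^ (-α)) := by positivity
    linarith
  have hpi := pi_pos
  have hlk : π ≤ level k := by
    have := level_mono hk
    rw [level] at this
    norm_num at this
    linarith
  obtain ⟨t, ht, htπ⟩ := intermediate_value_Icc hs.le
    ((hr.continuousOn_ang h0 h1 hw.lip hw.one hc).mono Icc_subset_Ici_self)
    (show π ∈ Icc _ _ from ⟨by rw [ang_zero]; exact hpi.le, hlk.trans hang.le⟩)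
  have ht0 : 0 < t := by
    refine lt_of_le_of_ne ht.1 fun e => ?_
    rw [← e, ang_zero] at htπ
    linarith
  obtain ⟨A, hA, -, e⟩ := hr.polar h0 h1 hw.lip hw.one hc ht0.le
  rw [htπ, sin_pi, mul_zero, neg_zero] at e
  linarith [hZ t ht0]

/-- Positive profiles of the power nonlinearity with an odd number of crossings of `1`. -/
theorem exists_power_profile (hα : 0 < α) (h0 : 0 < δ) (h1 : δ < 1) (hαδ : 1 < 2 * (α + δ))
    (n : ℕ) :
    ∃ b M y z, 1 < b ∧ Continuous y ∧ RegSol δ (fun y => α * (α + δ) * (|y| ^ (1 + 2 / α) - y)) b y z ∧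
      (∀ s, 0 ≤ s → 0 < y s ∧ y s ≤ M) ∧
      {s | 0 < s ∧ y s = 1}.encard = ((2 * n + 1 : ℕ) : ℕ∞) ∧
      (∃ S, 1 ≤ S ∧ ∀ s, S ≤ s → y s < 1 ∧ z s < 0) ∧ Tendsto y atTop (𝓝 0) ∧
      ∀ s, 0 ≤ s → z s ^ 2 ≤ α * (α + δ) * y s ^ 2 := by
  set κ := α * (α + δ) with hκ
  set p := 1 + 2 / α with hp
  have h2α : 0 < 2 / α := by positivity
  have hp1 : 1 < p := by linarith
  have hκ0 : 0 < κ := by positivity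
  have hκp : 1 < κ * (p - 1) := by
    have : κ * (p - 1) = 2 * (α + δ) := by
      rw [hκ, hp]
      field_simp
      ring
    linarith
  set c := ((α + 1) / (α + δ)) ^ (α / 2) with hc
  have hc1 : 1 < c := one_lt_rpow (by rw [one_lt_div (by linarith)]; linarith) (by positivity)
  have hcp : κ * c ^ (2 / α) = α * (α + 1) := by
    rw [hc, ← rpow_mul (by positivity), show α / 2 * (2 / α) = 1 by field_simp, rpow_one, hκ]
    field_simp
  set M := max c (((p + 1) / 2) ^ (1 / (p - 1))) with hM
  have hM1 : 1 ≤ M := hc1.le.trans (le_max_left _ _)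
  have hMp : (p + 1) / 2 ≤ M ^ (p - 1) := by
    calc (p + 1) / 2 = (((p + 1) / 2) ^ (1 / (p - 1))) ^ (p - 1) := by
          rw [← rpow_mul (by linarith), one_div_mul_cancel (by linarith), rpow_one]
      _ ≤ M ^ (p - 1) := rpow_le_rpow (rpow_nonneg (by linarith) _) (le_max_right _ _) (by linarith)
  have hw := well_force hp1 hM1 hκ0 hκp
  obtain ⟨b, y, z, hb, hyc, hr, hpos, hcard, hE, hS, hlim⟩ := exists_profile h0 h1 hw n hc1
    (not_winds_const hα h0 h1 hc1 (le_max_left _ _) hcp hw (by omega))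
  have hyM : ∀ s, 0 ≤ s → y s ≤ M := fun s hs => by
    refine le_of_pot_force_nonpos hp1 hM1 hMp hκ0 hκp ?_
    have := hE s hs
    rw [energy] at this
    nlinarith [sq_nonneg (z s)]
  refine ⟨b, M, y, z, hb, hyc, ⟨hr.cont_y, hr.cont_z, hr.y_zero, hr.z_zero, hr.deriv_y,
    fun s hs => ?_, hr.bound_z⟩, fun s hs => ⟨hpos s hs, hyM s hs⟩, hcard, hS, hlim,
    fun s hs => ?_⟩
  rotate_left
  · have := hE s hs
    rw [energy, pot_force_eq hp1 (hpos s hs).le (hyM s hs), mul_sub] at this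
    have h3 : 0 ≤ κ * (y s ^ (p + 1) / (p + 1)) :=
      mul_nonneg hκ0.le (div_nonneg (rpow_nonneg (hpos s hs).le _) (by linarith))
    linarith
  have := hr.deriv_z s hs
  rw [force_eq hp1 (hpos s hs.le).le (hyM s hs.le)] at this
  simpa only [abs_of_pos (hpos s hs.le)] using this

end Constant

section Flux

variable {A B : ℝ} {v v' h : ℝ → ℝ}

lemma hasDerivAt_flux {ρ : ℝ} (h0 : 0 < ρ) (h1 : ρ < 1) (hv : HasDerivAt v (v' ρ) ρ)
    (ode : (1 - ρ ^ 2) * v' ρ + (A / ρ - B * ρ) * v ρ = h ρ) :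
    HasDerivAt (fun r => r ^ A * (1 - r ^ 2) ^ ((B - A) / 2) * v r)
      (ρ ^ A * (1 - ρ ^ 2) ^ ((B - A) / 2 - 1) * h ρ) ρ := by
  have hq : 0 < 1 - ρ ^ 2 := by nlinarith
  have d1 : HasDerivAt (fun r : ℝ => r ^ A) (A * ρ ^ (A - 1)) ρ :=
    hasDerivAt_rpow_const (Or.inl h0.ne')
  have d2 := (((hasDerivAt_id ρ).pow 2).const_sub 1).rpow_const (p := (B - A) / 2)
    (Or.inl hq.ne')
  refine ((d1.mul d2).mul hv).congr_deriv ?_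
  have e : (1 - ρ ^ 2) ^ ((B - A) / 2) = (1 - ρ ^ 2) ^ ((B - A) / 2 - 1) * (1 - ρ ^ 2) := by
    rw [← rpow_add_one hq.ne', sub_add_cancel]
  simp only [Pi.mul_apply, Pi.pow_apply, id]
  rw [← ode, e, rpow_sub_one h0.ne']
  field_simp
  push_cast
  ring

/-- Control of a solution near the singular point `0` by its right-hand side. -/
lemma abs_le_of_flux (he0 : A < B) (he1 : B < A + 2) {K m ρ : ℝ} (hm : 0 < m + A + 1)
    (h0 : 0 < ρ) (h1 : ρ ≤ 1 / 2) (hv : ∀ r ∈ Ioc 0 ρ, HasDerivAt v (v' r) r)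
    (ode : ∀ r ∈ Ioc 0 ρ, (1 - r ^ 2) * v' r + (A / r - B * r) * v r = h r)
    (hh : ∀ r ∈ Ioc 0 ρ, |h r| ≤ K * r ^ m)
    (hlim : Tendsto (fun r => r ^ A * v r) (𝓝[>] 0) (𝓝 0)) :
    |v ρ| ≤ 4 * K / (m + A + 1) * ρ ^ (m + 1) := by
  set e := (B - A) / 2 with he
  set F := fun r => r ^ A * (1 - r ^ 2) ^ e * v r with hF
  have hFd : ∀ r ∈ Ioc 0 ρ, HasDerivAt F (r ^ A * (1 - r ^ 2) ^ (e - 1) * h r) r := fun r hr =>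
    hasDerivAt_flux hr.1 (by linarith [hr.2]) (hv r hr) (ode r hr)
  have hF0 : Tendsto F (𝓝[>] 0) (𝓝 0) := by
    have : Tendsto (fun r : ℝ => (1 - r ^ 2) ^ e) (𝓝[>] 0) (𝓝 1) := by
      have hc : ContinuousAt (fun r : ℝ => (1 - r ^ 2) ^ e) 0 :=
        (by fun_prop : Continuous fun r : ℝ => 1 - r ^ 2).continuousAt.rpow_const
          (Or.inl (by norm_num))
      have := hc.tendsto
      simp only [ne_eq, OfNat.ofNat_ne_zero, not_false_eq_true, zero_pow, sub_zero, one_rpow] at this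
      exact this.mono_left nhdsWithin_le_nhds
    have := hlim.mul this
    rw [zero_mul] at this
    exact this.congr fun r => by simp only [hF]; ring
  have hP0 : Tendsto (fun r : ℝ => 2 * K / (m + A + 1) * r ^ (m + A + 1)) (𝓝[>] 0) (𝓝 0) := by
    have := ((continuousAt_rpow_const 0 (m + A + 1) (Or.inr hm.le)).tendsto.const_mul
      (2 * K / (m + A + 1)))
    rw [zero_rpow hm.ne', mul_zero] at this
    exact this.mono_left nhdsWithin_le_nhds
  have key : ∀ σ : ℝ, |σ| = 1 → σ * F ρ ≤ 2 * K / (m + A + 1) * ρ ^ (m + A + 1) := by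
    intro σ hσ
    set G := fun r => 2 * K / (m + A + 1) * r ^ (m + A + 1) - σ * F r with hG
    have hGd : ∀ r ∈ Ioc 0 ρ, HasDerivAt G (2 * K * r ^ (m + A)
        - σ * (r ^ A * (1 - r ^ 2) ^ (e - 1) * h r)) r := fun r hr => by
      refine (((hasDerivAt_rpow_const (Or.inl hr.1.ne')).const_mul _).sub
        ((hFd r hr).const_mul σ)).congr_deriv ?_
      rw [add_sub_cancel_right]
      field_simp
    have hG0 : Tendsto G (𝓝[>] 0) (𝓝 0) := by
      have := hP0.sub (hF0.const_mul σ)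
      simpa using this
    have hmono : ∀ᶠ r in 𝓝[>] 0, G r ≤ G ρ := by
      filter_upwards [Ioo_mem_nhdsGT h0] with r hr
      have := mul_sub_le_of_le_hasDerivAt (f := G) (c := 0) hr.2.le
        (fun x hx => (hGd x ⟨hr.1.trans_le hx.1, hx.2⟩).continuousAt.continuousWithinAt)
        (fun x hx => hGd x ⟨hr.1.trans hx.1, hx.2.le⟩) (fun x hx => ?_)
      · linarith
      · have hx0 : 0 < x := hr.1.trans hx.1
        have hx1 : x ≤ 1 / 2 := hx.2.le.trans h1
        have hq : 3 / 4 ≤ 1 - x ^ 2 := by nlinarith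
        have h2 : (1 - x ^ 2) ^ (e - 1) ≤ 2 := by
          calc (1 - x ^ 2) ^ (e - 1) ≤ (1 - x ^ 2) ^ (-1 : ℝ) :=
                rpow_le_rpow_of_exponent_ge (by linarith) (by nlinarith) (by rw [he]; linarith)
            _ = (1 - x ^ 2)⁻¹ := rpow_neg_one _
            _ ≤ 2 := by
                rw [inv_le_comm₀ (by linarith) two_pos]
                linarith
        have h3 : 0 ≤ (1 - x ^ 2) ^ (e - 1) := rpow_nonneg (by linarith) _
        have h4 : 0 < x ^ A := rpow_pos_of_pos hx0 _
        have h5 := hh x ⟨hx0, hx.2.le⟩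
        have h6 : σ * (x ^ A * (1 - x ^ 2) ^ (e - 1) * h x) ≤ x ^ A * 2 * (K * x ^ m) := by
          refine (le_abs_self _).trans ?_
          rw [abs_mul, hσ, one_mul, abs_mul, abs_of_nonneg (mul_nonneg h4.le h3)]
          gcongr
        have h7 : x ^ (m + A) = x ^ A * x ^ m := by rw [add_comm, rpow_add hx0]
        rw [h7]
        linarith
    have := le_of_tendsto hG0 hmono
    simp only [hG] at this
    linarith
  have k1 := key 1 (by simp)
  have k2 := key (-1) (by simp)
  have hA : 0 < ρ ^ A := rpow_pos_of_pos h0 _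
  have hq : 1 / 2 ≤ (1 - ρ ^ 2) ^ e := by
    calc (1 : ℝ) / 2 ≤ (1 - ρ ^ 2) ^ (1 : ℝ) := by rw [rpow_one]; nlinarith
      _ ≤ _ := rpow_le_rpow_of_exponent_ge (by nlinarith) (by nlinarith) (by rw [he]; linarith)
  have h8 : |F ρ| ≤ 2 * K / (m + A + 1) * ρ ^ (m + A + 1) := abs_le.2 ⟨by linarith, by linarith⟩
  have h9 : ρ ^ (m + A + 1) = ρ ^ A * ρ ^ (m + 1) := by rw [← rpow_add h0]; congr 1; ring
  simp only [hF] at h8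
  rw [abs_mul, abs_of_nonneg (by positivity), h9] at h8
  have h10 : ρ ^ A * (1 / 2) * |v ρ| ≤ ρ ^ A * (1 - ρ ^ 2) ^ e * |v ρ| := by gcongr
  have h11 : ρ ^ A * |v ρ| ≤ ρ ^ A * (4 * K / (m + A + 1) * ρ ^ (m + 1)) := by
    calc ρ ^ A * |v ρ| = 2 * (ρ ^ A * (1 / 2) * |v ρ|) := by ring
      _ ≤ 2 * (2 * K / (m + A + 1) * (ρ ^ A * ρ ^ (m + 1))) := by linarith
      _ = _ := by ring
  exact le_of_mul_le_mul_left h11 hA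

/-- Behaviour of a solution at the singular point `0`. -/
lemma tendsto_div_of_flux (hA : 0 < A) (hv : ∀ r ∈ Ioo (0 : ℝ) 1, HasDerivAt v (v' r) r)
    (ode : ∀ r ∈ Ioo (0 : ℝ) 1, (1 - r ^ 2) * v' r + (A / r - B * r) * v r = h r)
    (hlim : Tendsto (fun r => r ^ A * v r) (𝓝[>] 0) (𝓝 0)) {l : ℝ}
    (hh : Tendsto h (𝓝[>] 0) (𝓝 l)) :
    Tendsto (fun r => v r / r) (𝓝[>] 0) (𝓝 (l / (A + 1))) := by
  set e := (B - A) / 2 with he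
  have hq : ∀ c : ℝ, Tendsto (fun r : ℝ => (1 - r ^ 2) ^ c) (𝓝[>] 0) (𝓝 1) := fun c => by
    have hc : ContinuousAt (fun r : ℝ => (1 - r ^ 2) ^ c) 0 :=
      (by fun_prop : Continuous fun r : ℝ => 1 - r ^ 2).continuousAt.rpow_const
        (Or.inl (by norm_num))
    have := hc.tendsto
    simp only [ne_eq, OfNat.ofNat_ne_zero, not_false_eq_true, zero_pow, sub_zero, one_rpow] at this
    exact this.mono_left nhdsWithin_le_nhds
  have hnear : ∀ᶠ r : ℝ in 𝓝[>] 0, r ∈ Ioo (0 : ℝ) 1 := Ioo_mem_nhdsGT one_pos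
  have hF0 : Tendsto (fun r => r ^ A * (1 - r ^ 2) ^ e * v r) (𝓝[>] 0) (𝓝 0) := by
    have := hlim.mul (hq e)
    rw [zero_mul] at this
    exact this.congr fun r => by ring
  have hG0 : Tendsto (fun r : ℝ => r ^ (A + 1)) (𝓝[>] 0) (𝓝 0) := by
    have := (continuousAt_rpow_const 0 (A + 1) (Or.inr (by linarith))).tendsto
    rw [zero_rpow (by linarith)] at this
    exact this.mono_left nhdsWithin_le_nhds
  have hFd : ∀ r ∈ Ioo (0 : ℝ) 1, HasDerivAt (fun r => r ^ A * (1 - r ^ 2) ^ e * v r)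
      (r ^ A * (1 - r ^ 2) ^ (e - 1) * h r) r := fun r hr =>
    hasDerivAt_flux hr.1 hr.2 (hv r hr) (ode r hr)
  have hl := HasDerivAt.lhopital_zero_nhdsGT (hnear.mono hFd)
    (hnear.mono fun r hr => hasDerivAt_rpow_const (p := A + 1) (Or.inl hr.1.ne'))
    (hnear.mono fun r hr => ?_) hF0 hG0 (l := 𝓝 (l / (A + 1))) ?_
  · have := (hl.div (hq e) one_ne_zero)
    rw [div_one] at this
    refine this.congr' ?_
    filter_upwards [hnear] with r hr
    have h1 : 0 < r ^ A := rpow_pos_of_pos hr.1 _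
    have h2 : 0 < (1 - r ^ 2) ^ e := rpow_pos_of_pos (by nlinarith [hr.1, hr.2]) _
    have h3 := hr.1
    simp only [Pi.div_apply]
    rw [rpow_add_one hr.1.ne']
    field_simp
  · have := rpow_pos_of_pos hr.1 (A + 1 - 1)
    positivity
  · have := ((hq (e - 1)).mul hh).div_const (A + 1)
    rw [one_mul] at this
    refine this.congr' ?_
    filter_upwards [hnear] with r hr
    have h1 : 0 < r ^ A := rpow_pos_of_pos hr.1 _
    rw [add_sub_cancel_right]
    field_simp

/-- Behaviour of a solution at the singular point `1`. -/
lemma tendsto_of_flux (he0 : A < B) (hv : ∀ r ∈ Ioo (0 : ℝ) 1, HasDerivAt v (v' r) r)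
    (ode : ∀ r ∈ Ioo (0 : ℝ) 1, (1 - r ^ 2) * v' r + (A / r - B * r) * v r = h r)
    (hlim : Tendsto (fun r => (1 - r ^ 2) ^ ((B - A) / 2) * v r) (𝓝[<] 1) (𝓝 0)) {l : ℝ}
    (hh : Tendsto h (𝓝[<] 1) (𝓝 l)) :
    Tendsto v (𝓝[<] 1) (𝓝 (-l / (B - A))) := by
  set e := (B - A) / 2 with he
  have he' : 0 < e := by rw [he]; linarith
  have hr : ∀ c : ℝ, Tendsto (fun r : ℝ => r ^ c) (𝓝[<] 1) (𝓝 1) := fun c => by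
    have := (continuousAt_rpow_const 1 c (Or.inl one_ne_zero)).tendsto
    rw [one_rpow] at this
    exact this.mono_left nhdsWithin_le_nhds
  have hnear : ∀ᶠ r : ℝ in 𝓝[<] 1, r ∈ Ioo (0 : ℝ) 1 := Ioo_mem_nhdsLT one_pos
  have hF0 : Tendsto (fun r => r ^ A * (1 - r ^ 2) ^ e * v r) (𝓝[<] 1) (𝓝 0) := by
    have := (hr A).mul hlim
    rw [mul_zero] at this
    exact this.congr fun r => by ring
  have hG0 : Tendsto (fun r : ℝ => (1 - r ^ 2) ^ e) (𝓝[<] 1) (𝓝 0) := by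
    have hc : ContinuousAt (fun r : ℝ => (1 - r ^ 2) ^ e) 1 :=
      (by fun_prop : Continuous fun r : ℝ => 1 - r ^ 2).continuousAt.rpow_const (Or.inr he'.le)
    have := hc.tendsto
    simp only [one_pow, sub_self, zero_rpow he'.ne'] at this
    exact this.mono_left nhdsWithin_le_nhds
  have hFd : ∀ r ∈ Ioo (0 : ℝ) 1, HasDerivAt (fun r => r ^ A * (1 - r ^ 2) ^ e * v r)
      (r ^ A * (1 - r ^ 2) ^ (e - 1) * h r) r := fun r hr =>
    hasDerivAt_flux hr.1 hr.2 (hv r hr) (ode r hr)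
  have hl := HasDerivAt.lhopital_zero_nhdsLT (hnear.mono hFd)
    (hnear.mono fun r hr => (((hasDerivAt_id r).pow 2).const_sub 1).rpow_const (p := e)
      (Or.inl (show (1 : ℝ) - r ^ 2 ≠ 0 by nlinarith [hr.1, hr.2])))
    (hnear.mono fun r hr => ?_) hF0 hG0 (l := 𝓝 (-l / (B - A))) ?_
  · have := hl.div (hr A) one_ne_zero
    rw [div_one] at this
    refine this.congr' ?_
    filter_upwards [hnear] with r hr
    have h1 : 0 < r ^ A := rpow_pos_of_pos hr.1 _
    have h2 : 0 < (1 - r ^ 2) ^ e := rpow_pos_of_pos (by nlinarith [hr.1, hr.2]) _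
    simp only [Pi.div_apply, Pi.pow_apply, id]
    field_simp
  · have hq : 0 < 1 - r ^ 2 := by nlinarith [hr.1, hr.2]
    have := rpow_pos_of_pos hq (e - 1)
    have h3 := hr.1
    simp only [Pi.pow_apply, id]
    have : 0 < 2 * r * e * (1 - r ^ 2) ^ (e - 1) := by positivity
    norm_num
    exact ⟨⟨h3.ne', he'.ne'⟩, by positivity⟩
  · have := ((hr (A - 1)).mul hh.neg).div_const (B - A)
    rw [one_mul] at this
    refine this.congr' ?_
    filter_upwards [hnear] with r hr
    have hq : 0 < 1 - r ^ 2 := by nlinarith [hr.1, hr.2]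
    have h2 := rpow_pos_of_pos hq (e - 1)
    have h3 := hr.1
    have h4 : B - A = 2 * e := by rw [he]; ring
    simp only [Pi.pow_apply, id]
    rw [h4, rpow_sub_one hr.1.ne']
    norm_num
    field_simp

end Flux

/-- The zeroth-order part of the normalized profile equation. -/
noncomputable def reaction (α δ x : ℝ) : ℝ :=
  α * (α + 1) * x - α * (α + δ) * x ^ (1 + 2 / α)

/-- The second derivative prescribed by the normalized profile equation. -/
noncomputable def accel (α δ : ℝ) (u v : ℝ → ℝ) (ρ : ℝ) : ℝ :=
  (reaction α δ (u ρ) - ((2 * α + 1 + δ) / ρ - 2 * (α + 1) * ρ) * v ρ) / (1 - ρ ^ 2)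

/-- Positive solutions `u`, with derivative `v`, of the normalized profile equation. -/
structure RadSol (α δ : ℝ) (u v : ℝ → ℝ) : Prop where
  pos : ∀ ρ ∈ Ioo (0 : ℝ) 1, 0 < u ρ
  deriv_u : ∀ ρ ∈ Ioo (0 : ℝ) 1, HasDerivAt u (v ρ) ρ
  deriv_v : ∀ ρ ∈ Ioo (0 : ℝ) 1, HasDerivAt v (accel α δ u v ρ) ρ

lemma hasDerivAt_reaction {α : ℝ} (hα : 0 < α) (δ x : ℝ) :
    HasDerivAt (reaction α δ)
      (α * (α + 1) - α * (α + δ) * ((1 + 2 / α) * x ^ (2 / α))) x := by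
  have h2α : 0 < 2 / α := by positivity
  have := ((hasDerivAt_id x).const_mul (α * (α + 1))).sub
    ((hasDerivAt_rpow_const (x := x) (p := 1 + 2 / α) (Or.inr (by linarith))).const_mul
      (α * (α + δ)))
  refine this.congr_deriv ?_
  rw [add_sub_cancel_left, mul_one]

lemma continuous_reaction {α : ℝ} (hα : 0 < α) (δ : ℝ) : Continuous (reaction α δ) :=
  continuous_iff_continuousAt.2 fun x => (hasDerivAt_reaction hα δ x).continuousAt

lemma accel_ode {α δ : ℝ} (u v : ℝ → ℝ) {r : ℝ} (hr : r ∈ Ioo (0 : ℝ) 1) :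
    (1 - r ^ 2) * accel α δ u v r + ((2 * α + 1 + δ) / r - 2 * (α + 1) * r) * v r
      = reaction α δ (u r) := by
  have hq : 1 - r ^ 2 ≠ 0 := by nlinarith [hr.1, hr.2]
  rw [accel, mul_div_cancel₀ _ hq]
  ring

namespace RadSol

variable {α δ : ℝ} {u v : ℝ → ℝ}

lemma abs_reaction_le (hα : 0 < α) (h0 : 0 < δ) {w r ρ : ℝ} (hr : 0 < r) (hrρ : r ≤ ρ)
    {x : ℝ} (hx : 0 ≤ x) (hxw : r ^ α * x ≤ w) :
    |reaction α δ x| ≤ w * (α * (α + 1) * ρ ^ 2 + α * (α + δ) * w ^ (2 / α)) * r ^ (-α - 2) := by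
  have hrα : 0 < r ^ α := rpow_pos_of_pos hr _
  set m := r ^ α * x with hm
  have hm0 : 0 ≤ m := by positivity
  have hxm : x = r ^ (-α) * m := by
    rw [hm, rpow_neg hr.le, inv_mul_cancel_left₀ hrα.ne']
  have h2α : 0 < 2 / α := by positivity
  have e1 : r ^ (-α) = r ^ (-α - 2) * r ^ 2 := by
    rw [← rpow_natCast r 2, ← rpow_add hr]
    congr 1
    push_cast
    ring
  have e2 : x ^ (1 + 2 / α) = r ^ (-α - 2) * (m * m ^ (2 / α)) := by
    rw [hxm, mul_rpow (rpow_nonneg hr.le _) hm0, ← rpow_mul hr.le, rpow_add' hm0 (by linarith),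
      rpow_one]
    congr 2
    field_simp
    ring
  have hR : 0 < r ^ (-α - 2) := rpow_pos_of_pos hr _
  have e3 : reaction α δ x = m * (α * (α + 1) * r ^ 2 - α * (α + δ) * m ^ (2 / α))
      * r ^ (-α - 2) := by
    rw [reaction, e2, hxm, e1]
    ring
  rw [e3, abs_mul, abs_of_pos hR, abs_mul, abs_of_nonneg hm0]
  have hp : 0 ≤ m ^ (2 / α) := rpow_nonneg hm0 _
  have h1 : |α * (α + 1) * r ^ 2 - α * (α + δ) * m ^ (2 / α)|
      ≤ α * (α + 1) * r ^ 2 + α * (α + δ) * m ^ (2 / α) := by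
    rw [abs_le]
    have h3 : 0 ≤ α * (α + 1) * r ^ 2 := by positivity
    have h4 : 0 ≤ α * (α + δ) * m ^ (2 / α) := by positivity
    constructor <;> linarith
  have hw : 0 ≤ w := hm0.trans hxw
  gcongr
  refine h1.trans ?_
  gcongr

/-- A solution which is `o(ρ ^ (-α))` in a regular fashion extends continuously to `0`. -/
lemma exists_tendsto_zero (h : RadSol α δ u v) (hα : 0 < α) (h0 : 0 < δ) (h1 : δ < 1) {R C : ℝ}
    (hR : 0 < R) (hmono : MonotoneOn (fun r => r ^ α * u r) (Ioo 0 R))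
    (hlim : Tendsto (fun r => r ^ α * u r) (𝓝[>] 0) (𝓝 0))
    (hC : ∀ r ∈ Ioo 0 R, |r * v r| ≤ C * u r) :
    ∃ l, 0 < l ∧ Tendsto u (𝓝[>] 0) (𝓝 l) ∧
      Tendsto (fun r => r ^ (2 * α + 1 + δ) * v r) (𝓝[>] 0) (𝓝 0) := by
  set w := fun r => r ^ α * u r with hw
  set R' := min R (1 / 2) with hR'
  have hR'0 : 0 < R' := lt_min hR (by norm_num)
  have hmem : ∀ {r}, r ∈ Ioo 0 R' → r ∈ Ioo (0 : ℝ) 1 := fun hr =>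
    ⟨hr.1, hr.2.trans ((min_le_right _ _).trans_lt (by norm_num))⟩
  have hmem' : ∀ {r}, r ∈ Ioo 0 R' → r ∈ Ioo 0 R := fun hr =>
    ⟨hr.1, hr.2.trans_le (min_le_left _ _)⟩
  have hnear : ∀ᶠ r : ℝ in 𝓝[>] 0, r ∈ Ioo 0 R' := Ioo_mem_nhdsGT hR'0
  have hpow : ∀ {c : ℝ}, 0 < c → Tendsto (fun r : ℝ => r ^ c) (𝓝[>] 0) (𝓝 0) := fun {c} hc => by
    have := (continuousAt_rpow_const 0 c (Or.inr hc.le)).tendsto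
    rw [zero_rpow hc.ne'] at this
    exact this.mono_left nhdsWithin_le_nhds
  have hflux : Tendsto (fun r => r ^ (2 * α + 1 + δ) * v r) (𝓝[>] 0) (𝓝 0) := by
    have := ((hpow (c := α + δ) (by linarith)).mul hlim).const_mul C
    rw [mul_zero, mul_zero] at this
    refine squeeze_zero_norm' ?_ this
    filter_upwards [hnear] with r hr
    have hr0 : 0 < r := hr.1
    have h3 := hC r (hmem' hr)
    rw [abs_mul, abs_of_pos hr0] at h3
    have e : r ^ (2 * α + 1 + δ) = r ^ (α + δ) * r ^ α * r := by
      rw [← rpow_add hr0, ← rpow_add_one hr0.ne']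
      congr 1
      ring
    have h4 : 0 < r ^ (α + δ) * r ^ α := mul_pos (rpow_pos_of_pos hr0 _) (rpow_pos_of_pos hr0 _)
    rw [Real.norm_eq_abs, abs_mul, abs_of_pos (rpow_pos_of_pos hr0 _), e]
    have := mul_le_mul_of_nonneg_left h3 h4.le
    linarith
  refine (fun hmain => ?_ : (∃ K R₁, 0 < K ∧ R₁ ∈ Ioc 0 R' ∧ ∀ r ∈ Ioo 0 R₁, |v r| ≤ K * u r) → _) ?_
  · obtain ⟨K, R₁, hK, hR₁, hv⟩ := hmain
    have hm1 : ∀ {r}, r ∈ Ioo 0 R₁ → r ∈ Ioo (0 : ℝ) 1 := fun hr => hmem ⟨hr.1, hr.2.trans_le hR₁.2⟩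
    have hlip : LipschitzOnWith K.toNNReal (fun r => log (u r)) (Ioo 0 R₁) := by
      refine (convex_Ioo 0 R₁).lipschitzOnWith_of_nnnorm_hasDerivWithin_le
        (f' := fun r => v r / u r) (fun r hr =>
          ((h.deriv_u r (hm1 hr)).log (h.pos r (hm1 hr)).ne').hasDerivWithinAt) fun r hr => ?_
      have hu := h.pos r (hm1 hr)
      rw [← NNReal.coe_le_coe, coe_nnnorm, Real.coe_toNNReal _ hK.le, Real.norm_eq_abs, abs_div,
        abs_of_pos hu, div_le_iff₀ hu]
      exact hv r hr
    obtain ⟨g, hg, hfg⟩ := hlip.extend_real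
    refine ⟨exp (g 0), exp_pos _, ?_, hflux⟩
    have : Tendsto (fun r => exp (g r)) (𝓝[>] 0) (𝓝 (exp (g 0))) :=
      ((continuous_exp.comp hg.continuous).tendsto 0).mono_left nhdsWithin_le_nhds
    refine this.congr' ?_
    filter_upwards [Ioo_mem_nhdsGT hR₁.1] with r hr
    rw [← hfg hr, exp_log (h.pos r (hm1 hr))]
  have key : ∀ r ∈ Ioo 0 R', |v r| ≤ 4 * (w r * (α * (α + 1) * r ^ 2
      + α * (α + δ) * w r ^ (2 / α))) / (α + δ) * r ^ (-α - 1) := by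
    intro ρ hρ
    have hsub : ∀ {r}, r ∈ Ioc 0 ρ → r ∈ Ioo 0 R' := fun hr => ⟨hr.1, hr.2.trans_lt hρ.2⟩
    have := abs_le_of_flux (A := 2 * α + 1 + δ) (B := 2 * (α + 1)) (v := v)
      (v' := accel α δ u v) (h := fun r => reaction α δ (u r)) (m := -α - 2) (ρ := ρ)
      (K := w ρ * (α * (α + 1) * ρ ^ 2 + α * (α + δ) * w ρ ^ (2 / α)))
      (by linarith) (by linarith) (by linarith) hρ.1 (hρ.2.le.trans (min_le_right _ _))
      (fun r hr => h.deriv_v r (hmem (hsub hr))) (fun r hr => accel_ode u v (hmem (hsub hr)))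
      (fun r hr => abs_reaction_le hα h0 hr.1 hr.2 (h.pos r (hmem (hsub hr))).le
        (hmono (hmem' (hsub hr)) (hmem' hρ) hr.2)) hflux
    convert this using 3 <;> ring
  have hrv : ∀ r ∈ Ioo 0 R', |r * v r| ≤ 4 * (α * (α + 1) * r ^ 2
      + α * (α + δ) * w r ^ (2 / α)) / (α + δ) * u r := by
    intro r hr
    have hr0 : 0 < r := hr.1
    have e : r * r ^ (-α - 1) * r ^ α = 1 := by
      rw [mul_comm r, ← rpow_add_one hr0.ne', ← rpow_add hr0]
      simp
    rw [abs_mul, abs_of_pos hr0]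
    refine (mul_le_mul_of_nonneg_left (key r hr) hr0.le).trans_eq ?_
    calc _ = 4 * (α * (α + 1) * r ^ 2 + α * (α + δ) * w r ^ (2 / α)) / (α + δ) * u r
          * (r * r ^ (-α - 1) * r ^ α) := by
            simp only [hw]
            ring
      _ = _ := by rw [e, mul_one]
  have hsmall : Tendsto (fun r => 4 * (α * (α + 1) * r ^ 2
      + α * (α + δ) * w r ^ (2 / α)) / (α + δ)) (𝓝[>] 0) (𝓝 0) := by
    have e1 : Tendsto (fun r => w r ^ (2 / α)) (𝓝[>] 0) (𝓝 0) := by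
      have := hlim.rpow_const (p := 2 / α) (Or.inr (by positivity))
      rwa [zero_rpow (by positivity)] at this
    have e2 : Tendsto (fun r : ℝ => r ^ 2) (𝓝[>] 0) (𝓝 0) := by
      have := (continuous_pow 2 (M := ℝ)).tendsto 0
      rw [zero_pow two_ne_zero] at this
      exact this.mono_left nhdsWithin_le_nhds
    have := ((((e2.const_mul (α * (α + 1))).add (e1.const_mul (α * (α + δ)))).const_mul 4).div_const
      (α + δ))
    simpa using this
  obtain ⟨R₁, hR₁, hsub⟩ := mem_nhdsGT_iff_exists_Ioo_subset.1
    (inter_mem hnear (hsmall.eventually (gt_mem_nhds (show 0 < α / 2 by positivity))))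
  have hR₁0 : 0 < R₁ := hR₁
  have hR₁' : ∀ {r}, r ∈ Ioo 0 R₁ → r ∈ Ioo 0 R' := fun hr => (hsub hr).1
  have hmid : R₁ / 2 ∈ Ioo 0 R₁ := ⟨by positivity, by linarith⟩
  set D := (R₁ / 2) ^ (α / 2) * u (R₁ / 2) with hD
  have hD0 : 0 < D := mul_pos (rpow_pos_of_pos hmid.1 _) (h.pos _ (hmem (hR₁' hmid)))
  have hwD : ∀ r ∈ Ioo 0 (R₁ / 2), w r ≤ D * r ^ (α / 2) := by
    intro r hr
    have hr0 : 0 < r := hr.1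
    have hin : ∀ {x}, r ≤ x → x ≤ R₁ / 2 → x ∈ Ioo 0 R₁ := fun h3 h4 =>
      ⟨hr0.trans_le h3, h4.trans_lt hmid.2⟩
    have hd : ∀ x ∈ Icc r (R₁ / 2), HasDerivAt (fun x => x ^ (α / 2) * u x)
        (x ^ (α / 2 - 1) * (α / 2 * u x + x * v x)) x := fun x hx => by
      have hx0 : 0 < x := hr0.trans_le hx.1
      refine ((hasDerivAt_rpow_const (p := α / 2) (Or.inl hx0.ne')).mul
        (h.deriv_u x (hmem (hR₁' (hin hx.1 hx.2))))).congr_deriv ?_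
      rw [rpow_sub_one hx0.ne']
      field_simp
    have := mul_sub_le_of_le_hasDerivAt (c := 0) hr.2.le
      (fun x hx => (hd x hx).continuousAt.continuousWithinAt)
      (fun x hx => hd x ⟨hx.1.le, hx.2.le⟩) (fun x hx => by
        have hx1 := hin hx.1.le hx.2.le
        have hu := h.pos x (hmem (hR₁' hx1))
        have h3 := (abs_le.1 (hrv x (hR₁' hx1))).1
        have h4 := mul_le_mul_of_nonneg_right (hsub hx1).2.le hu.le
        exact mul_nonneg (rpow_nonneg hx1.1.le _) (by linarith))
    have h5 : r ^ (α / 2) * u r ≤ D := by linarith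
    calc w r = r ^ (α / 2) * (r ^ (α / 2) * u r) := by
          rw [← mul_assoc, ← rpow_add hr0, add_halves]
      _ ≤ r ^ (α / 2) * D := mul_le_mul_of_nonneg_left h5 (rpow_nonneg hr0.le _)
      _ = _ := mul_comm _ _
  refine ⟨4 * (α * (α + 1) + α * (α + δ) * D ^ (2 / α)) / (α + δ), R₁ / 2, by positivity,
    ⟨hmid.1, (hR₁' hmid).2.le⟩, fun r hr => ?_⟩
  have hr0 : 0 < r := hr.1
  have hr1 : r ∈ Ioo 0 R' := hR₁' ⟨hr.1, hr.2.trans hmid.2⟩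
  have hu := h.pos r (hmem hr1)
  have h3 : w r ^ (2 / α) ≤ D ^ (2 / α) * r := by
    calc w r ^ (2 / α) ≤ (D * r ^ (α / 2)) ^ (2 / α) :=
          rpow_le_rpow (mul_nonneg (rpow_nonneg hr0.le _) hu.le) (hwD r hr) (by positivity)
      _ = D ^ (2 / α) * r := by
          rw [mul_rpow hD0.le (rpow_nonneg hr0.le _), ← rpow_mul hr0.le,
            show α / 2 * (2 / α) = 1 by field_simp, rpow_one]
  have h4 : r ^ 2 ≤ r := by nlinarith [(hmem hr1).2]
  have h5 := hrv r hr1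
  rw [abs_mul, abs_of_pos hr0] at h5
  refine le_of_mul_le_mul_left (h5.trans ?_) hr0
  calc _ ≤ 4 * (α * (α + 1) * r + α * (α + δ) * (D ^ (2 / α) * r)) / (α + δ) * u r := by gcongr
    _ = _ := by ring

end RadSol

section Extend

variable {f f' f'' : ℝ → ℝ} {a b fa fb ga gb ka kb : ℝ}

lemma hasDerivWithinAt_extendFrom (hab : a < b) (hd : ∀ x ∈ Ioo a b, HasDerivAt f (f' x) x)
    (hc' : ContinuousOn f' (Ioo a b))
    (hfa : Tendsto f (𝓝[>] a) (𝓝 fa)) (hfb : Tendsto f (𝓝[<] b) (𝓝 fb))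
    (hga : Tendsto f' (𝓝[>] a) (𝓝 ga)) (hgb : Tendsto f' (𝓝[<] b) (𝓝 gb)) :
    ∀ x ∈ Icc a b, HasDerivWithinAt (extendFrom (Ioo a b) f) (extendFrom (Ioo a b) f' x)
      (Icc a b) x := by
  have hc : ContinuousOn f (Ioo a b) := fun x hx => (hd x hx).continuousAt.continuousWithinAt
  have hF : ContinuousOn (extendFrom (Ioo a b) f) (Icc a b) :=
    continuousOn_Icc_extendFrom_Ioo hc hfa hfb
  have hD : ∀ x ∈ Ioo a b, HasDerivAt (extendFrom (Ioo a b) f) (f' x) x := fun x hx =>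
    (hd x hx).congr_of_eventuallyEq (by
      filter_upwards [Ioo_mem_nhds hx.1 hx.2] with t ht using extendFrom_extends hc t ht)
  have hdiff : DifferentiableOn ℝ (extendFrom (Ioo a b) f) (Ioo a b) := fun x hx =>
    (hD x hx).differentiableAt.differentiableWithinAt
  intro x hx
  rcases eq_or_lt_of_le hx.1 with rfl | hax
  · rw [eq_lim_at_left_extendFrom_Ioo hab hga]
    refine (hasDerivWithinAt_Ici_of_tendsto_deriv hdiff
      ((hF a hx).mono Ioo_subset_Icc_self) (Ioo_mem_nhdsGT hab) ?_).mono Icc_subset_Ici_self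
    refine hga.congr' ?_
    filter_upwards [Ioo_mem_nhdsGT hab] with t ht using (hD t ht).deriv.symm
  rcases eq_or_lt_of_le hx.2 with rfl | hxb
  · rw [eq_lim_at_right_extendFrom_Ioo hab hgb]
    refine (hasDerivWithinAt_Iic_of_tendsto_deriv hdiff
      ((hF x hx).mono Ioo_subset_Icc_self) (Ioo_mem_nhdsLT hab) ?_).mono Icc_subset_Iic_self
    refine hgb.congr' ?_
    filter_upwards [Ioo_mem_nhdsLT hab] with t ht using (hD t ht).deriv.symm
  · rw [extendFrom_extends hc' x ⟨hax, hxb⟩]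
    exact (hD x ⟨hax, hxb⟩).hasDerivWithinAt

lemma contDiffOn_extendFrom (hab : a < b) (hd : ∀ x ∈ Ioo a b, HasDerivAt f (f' x) x)
    (hd' : ∀ x ∈ Ioo a b, HasDerivAt f' (f'' x) x) (hc'' : ContinuousOn f'' (Ioo a b))
    (hfa : Tendsto f (𝓝[>] a) (𝓝 fa)) (hfb : Tendsto f (𝓝[<] b) (𝓝 fb))
    (hga : Tendsto f' (𝓝[>] a) (𝓝 ga)) (hgb : Tendsto f' (𝓝[<] b) (𝓝 gb))
    (hka : Tendsto f'' (𝓝[>] a) (𝓝 ka)) (hkb : Tendsto f'' (𝓝[<] b) (𝓝 kb)) :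
    ContDiffOn ℝ 2 (extendFrom (Ioo a b) f) (Icc a b) := by
  have hU := uniqueDiffOn_Icc hab
  have hc' : ContinuousOn f' (Ioo a b) := fun x hx => (hd' x hx).continuousAt.continuousWithinAt
  have h1 := hasDerivWithinAt_extendFrom hab hd hc' hfa hfb hga hgb
  have h2 := hasDerivWithinAt_extendFrom hab hd' hc'' hga hgb hka hkb
  rw [show (2 : WithTop ℕ∞) = 1 + 1 by norm_num, contDiffOn_succ_iff_derivWithin hU]
  refine ⟨fun x hx => (h1 x hx).differentiableWithinAt, by simp, ?_⟩
  refine ContDiffOn.congr (f := extendFrom (Ioo a b) f') ?_ fun x hx =>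
    (h1 x hx).derivWithin (hU x hx)
  rw [show (1 : WithTop ℕ∞) = 0 + 1 by norm_num, contDiffOn_succ_iff_derivWithin hU]
  refine ⟨fun x hx => (h2 x hx).differentiableWithinAt, by simp, ?_⟩
  rw [contDiffOn_zero]
  exact (continuousOn_Icc_extendFrom_Ioo hc'' hka hkb).congr fun x hx =>
    (h2 x hx).derivWithin (hU x hx)

end Extend

namespace RadSol

variable {α δ : ℝ} {u v : ℝ → ℝ}

lemma tendsto_deriv_zero (h : RadSol α δ u v) (hα : 0 < α) (h0 : 0 < δ) {l : ℝ}
    (hu : Tendsto u (𝓝[>] 0) (𝓝 l))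
    (hflux : Tendsto (fun r => r ^ (2 * α + 1 + δ) * v r) (𝓝[>] 0) (𝓝 0)) :
    Tendsto v (𝓝[>] 0) (𝓝 0) ∧ ∃ m, Tendsto (accel α δ u v) (𝓝[>] 0) (𝓝 m) := by
  have hh : Tendsto (fun r => reaction α δ (u r)) (𝓝[>] 0) (𝓝 (reaction α δ l)) :=
    ((continuous_reaction hα δ).tendsto l).comp hu
  have hd := tendsto_div_of_flux (A := 2 * α + 1 + δ) (B := 2 * (α + 1)) (by linarith)
    h.deriv_v (fun r hr => accel_ode u v hr) hflux hh
  have hr : Tendsto (fun r : ℝ => r) (𝓝[>] 0) (𝓝 0) := tendsto_id.mono_left nhdsWithin_le_nhds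
  have hne : ∀ᶠ r : ℝ in 𝓝[>] 0, 0 < r := self_mem_nhdsWithin
  have hv : Tendsto v (𝓝[>] 0) (𝓝 0) := by
    have := hd.mul hr
    rw [mul_zero] at this
    refine this.congr' ?_
    filter_upwards [hne] with r hr using div_mul_cancel₀ _ hr.ne'
  refine ⟨hv, _, (((hh.sub (hd.const_mul (2 * α + 1 + δ))).add
    ((hr.mul hv).const_mul (2 * (α + 1)))).div (tendsto_const_nhds.sub (hr.pow 2))
    (by norm_num : (1 : ℝ) - 0 ^ 2 ≠ 0)).congr fun r => ?_⟩
  simp only [accel, Pi.div_apply]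
  congr 1
  ring

lemma tendsto_deriv_one (h : RadSol α δ u v) (hα : 0 < α) (h1 : δ < 1) {l C : ℝ}
    (hl : 0 < l) (hu : Tendsto u (𝓝[<] 1) (𝓝 l)) (hv : ∀ᶠ r in 𝓝[<] 1, |v r| ≤ C) :
    (∃ m, Tendsto v (𝓝[<] 1) (𝓝 m)) ∧ ∃ m, Tendsto (accel α δ u v) (𝓝[<] 1) (𝓝 m) := by
  set A := 2 * α + 1 + δ with hA
  set B := 2 * (α + 1) with hB
  have hnear : ∀ᶠ r : ℝ in 𝓝[<] 1, r ∈ Ioo (0 : ℝ) 1 := Ioo_mem_nhdsLT one_pos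
  have hr : Tendsto (fun r : ℝ => r) (𝓝[<] 1) (𝓝 1) := tendsto_id.mono_left nhdsWithin_le_nhds
  have hq : ∀ {e : ℝ}, 0 < e → Tendsto (fun r : ℝ => (1 - r ^ 2) ^ e) (𝓝[<] 1) (𝓝 0) := by
    intro e he
    have := (tendsto_const_nhds (x := (1 : ℝ))).sub (hr.pow 2) |>.rpow_const (p := e) (Or.inr he.le)
    rwa [one_pow, sub_self, zero_rpow he.ne'] at this
  have hh : Tendsto (fun r => reaction α δ (u r)) (𝓝[<] 1) (𝓝 (reaction α δ l)) :=
    ((continuous_reaction hα δ).tendsto l).comp hu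
  have hv1 : Tendsto v (𝓝[<] 1) (𝓝 (-reaction α δ l / (B - A))) := by
    refine tendsto_of_flux (by linarith) h.deriv_v (fun r hr => accel_ode u v hr) ?_ hh
    have := (hq (e := (B - A) / 2) (by linarith)).mul_const C
    rw [zero_mul] at this
    refine squeeze_zero_norm' ?_ this
    filter_upwards [hnear, hv] with r hr hvr
    have h3 : 0 ≤ (1 - r ^ 2) ^ ((B - A) / 2) := rpow_nonneg (by nlinarith [hr.1, hr.2]) _
    rw [Real.norm_eq_abs, abs_mul, abs_of_nonneg h3]
    exact mul_le_mul_of_nonneg_left hvr h3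
  refine ⟨⟨_, hv1⟩, ?_⟩
  set m := -reaction α δ l / (B - A) with hm
  set R' := fun x : ℝ => α * (α + 1) - α * (α + δ) * ((1 + 2 / α) * x ^ (2 / α)) with hR'
  set k := fun r => R' (u r) * v r + (A / r ^ 2 + B) * v r with hk
  set w := accel α δ u v with hw
  set w' := fun r => (k r - (A / r - (B + 2) * r) * w r) / (1 - r ^ 2) with hw'
  have hkl : ∃ kl, Tendsto k (𝓝[<] 1) (𝓝 kl) := by
    have h3 : Tendsto (fun r => R' (u r)) (𝓝[<] 1) (𝓝 (R' l)) :=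
      tendsto_const_nhds.sub (((hu.rpow_const (Or.inl hl.ne')).const_mul _).const_mul _)
    exact ⟨_, (h3.mul hv1).add (((tendsto_const_nhds.div (hr.pow 2) (by norm_num)).add
      tendsto_const_nhds).mul hv1)⟩
  obtain ⟨kl, hkl⟩ := hkl
  have hwd : ∀ r ∈ Ioo (0 : ℝ) 1, HasDerivAt w (w' r) r := by
    intro r hr
    have hr0 := hr.1.ne'
    have hq0 : 1 - r ^ 2 ≠ 0 := by nlinarith [hr.1, hr.2]
    have d1 := (hasDerivAt_reaction hα δ (u r)).comp r (h.deriv_u r hr)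
    have d2 := ((hasDerivAt_const r A).div (hasDerivAt_id r) hr0).sub
      ((hasDerivAt_id r).const_mul B)
    have d3 := ((hasDerivAt_id r).pow 2).const_sub 1
    refine ((d1.sub (d2.mul (h.deriv_v r hr))).div d3 hq0).congr_deriv ?_
    have hode : reaction α δ (u r) = (1 - r ^ 2) * w r + (A / r - B * r) * v r :=
      (accel_ode u v hr).symm
    simp only [hw', hk, Pi.mul_apply, Pi.sub_apply, Pi.pow_apply, Pi.div_apply, id,
      Function.comp_apply]
    rw [hode]
    change _ = ((R' (u r) * v r + (A / r ^ 2 + B) * v r) - _) / _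
    change ((R' (u r) * v r - (_ + _ * w r)) * _ - _) / _ = _
    generalize R' (u r) = x
    field_simp
    push_cast
    ring
  refine ⟨_, tendsto_of_flux (A := A) (B := B + 2) (by linarith) hwd (fun r hr => ?_) ?_ hkl⟩
  · have hq0 : 1 - r ^ 2 ≠ 0 := by nlinarith [hr.1, hr.2]
    simp only [hw']
    rw [mul_div_cancel₀ _ hq0]
    ring
  · have h3 : Tendsto (fun r => reaction α δ (u r) - (A / r - B * r) * v r) (𝓝[<] 1)
        (𝓝 (reaction α δ l - (A / 1 - B * 1) * m)) :=
      hh.sub (((tendsto_const_nhds.div hr one_ne_zero).sub (hr.const_mul B)).mul hv1)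
    have h4 := (hq (e := (B - A) / 2) (by linarith)).mul h3
    rw [zero_mul] at h4
    refine h4.congr' ?_
    filter_upwards [hnear] with r hr
    have hq0 : 0 < 1 - r ^ 2 := by nlinarith [hr.1, hr.2]
    rw [show (B + 2 - A) / 2 = (B - A) / 2 + 1 by ring, rpow_add_one hq0.ne', ← accel_ode u v hr]
    ring

/-- A solution with a limit at `0` and `1` and mild control of its derivative is `C²` up to the
boundary. -/
theorem exists_contDiffOn (h : RadSol α δ u v) (hα : 0 < α) (h0 : 0 < δ) (h1 : δ < 1)
    {l b C : ℝ} (hu0 : Tendsto u (𝓝[>] 0) (𝓝 l))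
    (hflux : Tendsto (fun r => r ^ (2 * α + 1 + δ) * v r) (𝓝[>] 0) (𝓝 0))
    (hb : 0 < b) (hu1 : Tendsto u (𝓝[<] 1) (𝓝 b)) (hv1 : ∀ᶠ r in 𝓝[<] 1, |v r| ≤ C) :
    ∃ U : ℝ → ℝ, ContDiffOn ℝ 2 U (Icc 0 1) ∧ U 0 = l ∧ U 1 = b ∧
      derivWithin U (Ici 0) 0 = 0 ∧
      ∀ r ∈ Ioo (0 : ℝ) 1, U r = u r ∧ deriv U r = v r ∧ deriv (deriv U) r = accel α δ u v r := by
  obtain ⟨hv0, m0, hm0⟩ := h.tendsto_deriv_zero hα h0 hu0 hflux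
  obtain ⟨⟨n1, hn1⟩, m1, hm1⟩ := h.tendsto_deriv_one hα h1 hb hu1 hv1
  have hcu : ContinuousOn u (Ioo 0 1) := fun x hx =>
    (h.deriv_u x hx).continuousAt.continuousWithinAt
  have hcv : ContinuousOn v (Ioo 0 1) := fun x hx =>
    (h.deriv_v x hx).continuousAt.continuousWithinAt
  have hca : ContinuousOn (accel α δ u v) (Ioo 0 1) := by
    refine ContinuousOn.div (((continuous_reaction hα δ).comp_continuousOn hcu).sub
      (((continuousOn_const.div continuousOn_id fun x hx => hx.1.ne').sub
        (by fun_prop)).mul hcv)) (by fun_prop) fun x hx => ?_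
    nlinarith [hx.1, hx.2]
  have hU : ∀ x ∈ Ioo (0 : ℝ) 1, extendFrom (Ioo 0 1) u x = u x := extendFrom_extends hcu
  have hev : ∀ x ∈ Ioo (0 : ℝ) 1, ∀ᶠ t in 𝓝 x, t ∈ Ioo (0 : ℝ) 1 := fun x hx =>
    Ioo_mem_nhds hx.1 hx.2
  have hU' : ∀ x ∈ Ioo (0 : ℝ) 1, HasDerivAt (extendFrom (Ioo 0 1) u) (v x) x := fun x hx =>
    (h.deriv_u x hx).congr_of_eventuallyEq ((hev x hx).mono hU)
  refine ⟨extendFrom (Ioo 0 1) u,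
    contDiffOn_extendFrom one_pos h.deriv_u h.deriv_v hca hu0 hu1 hv0 hn1 hm0 hm1,
    eq_lim_at_left_extendFrom_Ioo one_pos hu0, eq_lim_at_right_extendFrom_Ioo one_pos hu1, ?_,
    fun r hr => ⟨hU r hr, (hU' r hr).deriv, ?_⟩⟩
  · have := hasDerivWithinAt_extendFrom one_pos h.deriv_u hcv hu0 hu1 hv0 hn1 0 ⟨le_rfl, one_pos.le⟩
    rw [eq_lim_at_left_extendFrom_Ioo one_pos hv0] at this
    exact (this.mono_of_mem_nhdsWithin (Icc_mem_nhdsGE one_pos)).derivWithin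
      (uniqueDiffOn_Ici 0 0 self_mem_Ici)
  · exact ((h.deriv_v r hr).congr_of_eventuallyEq
      ((hev r hr).mono fun x hx => (hU' x hx).deriv)).deriv

end RadSol

/-- The radial profile `ρ ^ (-α) y(s)` with `cosh s = 1 / ρ`. -/
noncomputable def radU (α : ℝ) (y : ℝ → ℝ) (ρ : ℝ) : ℝ := ρ ^ (-α) * y (arcosh ρ⁻¹)

/-- The derivative of `radU`, where `z = y'`. -/
noncomputable def radV (α : ℝ) (y z : ℝ → ℝ) (ρ : ℝ) : ℝ :=
  -ρ ^ (-α - 1) * (α * y (arcosh ρ⁻¹)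
    + cosh (arcosh ρ⁻¹) / sinh (arcosh ρ⁻¹) * z (arcosh ρ⁻¹))

section Arcosh

lemma arcosh_inv_pos {ρ : ℝ} (hρ : ρ ∈ Ioo (0 : ℝ) 1) : 0 < arcosh ρ⁻¹ :=
  arcosh_pos (one_lt_inv_iff₀.2 hρ)

lemma cosh_arcosh_inv {ρ : ℝ} (hρ : ρ ∈ Ioc (0 : ℝ) 1) : cosh (arcosh ρ⁻¹) = ρ⁻¹ :=
  cosh_arcosh (one_le_inv_iff₀.2 hρ)

lemma hasDerivAt_arcosh_inv {ρ : ℝ} (hρ : ρ ∈ Ioo (0 : ℝ) 1) :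
    HasDerivAt (fun r => arcosh r⁻¹) (-(cosh (arcosh ρ⁻¹) ^ 2) / sinh (arcosh ρ⁻¹)) ρ := by
  have h1 : 1 < ρ⁻¹ := one_lt_inv_iff₀.2 hρ
  refine ((hasDerivAt_arcosh h1).comp ρ (hasDerivAt_inv hρ.1.ne')).congr_deriv ?_
  rw [cosh_arcosh_inv ⟨hρ.1, hρ.2.le⟩, sinh_arcosh h1.le]
  field_simp

lemma tendsto_arcosh_inv_zero : Tendsto (fun r => arcosh r⁻¹) (𝓝[>] 0) atTop := by
  refine tendsto_atTop_mono' _ ?_ (tendsto_log_atTop.comp tendsto_inv_nhdsGT_zero)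
  filter_upwards [Ioo_mem_nhdsGT one_pos] with r hr
  have h1 : 1 ≤ r⁻¹ := (one_lt_inv_iff₀.2 hr).le
  rw [Function.comp_apply, log_le_iff_le_exp (by linarith), exp_arcosh h1]
  linarith [sqrt_nonneg (r⁻¹ ^ 2 - 1)]

lemma tendsto_arcosh_inv_one : Tendsto (fun r => arcosh r⁻¹) (𝓝[<] 1) (𝓝[>] 0) := by
  have hnear : ∀ᶠ r : ℝ in 𝓝[<] 1, r ∈ Ioo (0 : ℝ) 1 := Ioo_mem_nhdsLT one_pos
  refine tendsto_nhdsWithin_iff.2 ⟨?_, hnear.mono fun r hr => arcosh_inv_pos hr⟩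
  have h1 : Tendsto (fun r : ℝ => r⁻¹) (𝓝[<] 1) (𝓝[≥] 1) := by
    refine tendsto_nhdsWithin_iff.2 ⟨?_, hnear.mono fun r hr => (one_lt_inv_iff₀.2 hr).le⟩
    have := (continuousAt_inv₀ (one_ne_zero (α := ℝ))).tendsto
    rw [inv_one] at this
    exact this.mono_left nhdsWithin_le_nhds
  have h2 := (continuousOn_arcosh 1 self_mem_Ici).tendsto.comp h1
  rwa [arcosh_zero] at h2

end Arcosh

namespace RegSol

variable {α δ b : ℝ} {y z : ℝ → ℝ}

lemma radSol (h : RegSol δ (fun y => α * (α + δ) * (|y| ^ (1 + 2 / α) - y)) b y z) (hα : 0 < α)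
    (hpos : ∀ s, 0 ≤ s → 0 < y s) : RadSol α δ (radU α y) (radV α y z) where
  pos := fun ρ hρ => mul_pos (rpow_pos_of_pos hρ.1 _) (hpos _ (arcosh_inv_pos hρ).le)
  deriv_u := fun ρ hρ => by
    have hs := arcosh_inv_pos hρ
    have hS := sinh_pos_iff.2 hs
    have hC := cosh_arcosh_inv ⟨hρ.1, hρ.2.le⟩
    refine ((hasDerivAt_rpow_const (p := -α) (Or.inl hρ.1.ne')).mul
      ((h.deriv_y _ hs).comp ρ (hasDerivAt_arcosh_inv hρ))).congr_deriv ?_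
    rw [radV, rpow_sub_one hρ.1.ne', hC, Function.comp_apply]
    have := hρ.1
    field_simp
    ring
  deriv_v := fun ρ hρ => by
    have hs := arcosh_inv_pos hρ
    have hS := sinh_pos_iff.2 hs
    have hC := cosh_arcosh_inv ⟨hρ.1, hρ.2.le⟩
    have hy := hpos _ hs.le
    have hρ0 := hρ.1
    have hds := hasDerivAt_arcosh_inv hρ
    have hdz := h.deriv_z _ hs
    have hdq := (hasDerivAt_cosh (arcosh ρ⁻¹)).div (hasDerivAt_sinh (arcosh ρ⁻¹)) hS.ne'
    have hW := (((h.deriv_y _ hs).const_mul α).add (hdq.mul hdz)).comp ρ hds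
    have hd := ((hasDerivAt_rpow_const (p := -α - 1) (Or.inl hρ0.ne')).neg).mul hW
    refine hd.congr_deriv ?_
    have h2α : 0 < 2 / α := by positivity
    have e : radU α y ρ ^ (1 + 2 / α) = ρ ^ (-α) / ρ ^ 2 * y (arcosh ρ⁻¹) ^ (1 + 2 / α) := by
      rw [radU, mul_rpow (rpow_nonneg hρ0.le _) hy.le, ← rpow_mul hρ0.le, ← rpow_natCast ρ 2,
        ← rpow_sub hρ0]
      congr 2
      push_cast
      field_simp
      ring
    have hsq := sinh_sq (arcosh ρ⁻¹)
    rw [accel, reaction, e, radV, radU, rpow_sub_one hρ0.ne', rpow_sub_one hρ0.ne']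
    simp only [Function.comp_apply, Pi.div_apply, Pi.mul_apply, Pi.add_apply, Pi.neg_apply]
    rw [abs_of_pos hy, rpow_sub_one hρ0.ne']
    rw [hC] at hsq ⊢
    generalize arcosh ρ⁻¹ = s at *
    have hq : 1 - ρ ^ 2 = ρ ^ 2 * sinh s ^ 2 := by
      rw [hsq]
      field_simp
    rw [hq]
    generalize sinh s = S at *
    generalize y s ^ (1 + 2 / α) = P at *
    generalize z s = Z at *
    generalize y s = Y at *
    generalize ρ ^ (-α) = D at *
    have hS2 : S ^ 2 * ρ ^ 2 = 1 - ρ ^ 2 := by linarith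
    field_simp
    linear_combination D * ((α + 1) * (α * ρ * Y * S + Z) + α * Z + Z) * hS2

/-- The regular radial solution carried by a positive decaying profile. -/
theorem exists_radial (h : RegSol δ (fun y => α * (α + δ) * (|y| ^ (1 + 2 / α) - y)) b y z)
    (hα : 0 < α) (h0 : 0 < δ) (h1 : δ < 1) (hb : 0 < b) {M S : ℝ}
    (hy : ∀ s, 0 ≤ s → 0 < y s ∧ y s ≤ M) (hS : 1 ≤ S) (hz : ∀ s, S ≤ s → z s < 0)
    (hlim : Tendsto y atTop (𝓝 0))
    (hzy : ∀ s, 0 ≤ s → z s ^ 2 ≤ α * (α + δ) * y s ^ 2) :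
    ∃ (l : ℝ) (U : ℝ → ℝ), 0 < l ∧ ContDiffOn ℝ 2 U (Icc 0 1) ∧ U 0 = l ∧ U 1 = b ∧
      derivWithin U (Ici 0) 0 = 0 ∧
      ∀ r ∈ Ioo (0 : ℝ) 1, U r = radU α y r ∧ deriv U r = radV α y z r ∧
        deriv (deriv U) r = accel α δ (radU α y) (radV α y z) r := by
  have hr := h.radSol hα fun s hs => (hy s hs).1
  have hw : ∀ r : ℝ, 0 < r → r ^ α * radU α y r = y (arcosh r⁻¹) := fun r hr => by
    rw [radU, ← mul_assoc, ← rpow_add hr, add_neg_cancel, rpow_zero, one_mul]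
  have hCS : 1 ≤ cosh S := one_le_cosh S
  have hR0 : 0 < (cosh S)⁻¹ := by positivity
  have hR : ∀ r ∈ Ioo 0 (cosh S)⁻¹, r ∈ Ioo (0 : ℝ) 1 ∧ S ≤ arcosh r⁻¹ := fun r hr => by
    have h3 : cosh S < r⁻¹ := (lt_inv_comm₀ (by linarith) hr.1).2 hr.2
    refine ⟨⟨hr.1, hr.2.trans_le (inv_le_one_of_one_le₀ hCS)⟩, ?_⟩
    rw [← arcosh_cosh (x := S) (by linarith)]
    exact (arcosh_le_arcosh (by linarith) (by linarith)).2 h3.le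
  obtain ⟨l, hl, hu0, hflux⟩ := hr.exists_tendsto_zero (R := (cosh S)⁻¹)
    (C := α + 7 / 5 * √(α * (α + δ))) hα h0 h1 hR0 (fun r hr' t ht hrt => by
      simp only [hw r hr'.1, hw t ht.1]
      refine h.tail_antitone hS hz (hR t ht).2 ?_
      have := ht.1
      have := hr'.1
      exact (arcosh_le_arcosh (by positivity) (by positivity)).2 (inv_anti₀ this hrt))
    ((hlim.comp tendsto_arcosh_inv_zero).congr' (by
      filter_upwards [self_mem_nhdsWithin] with r hr using (hw r hr).symm))
    (fun r hr' => by
      have hr0 := hr'.1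
      have hs1 := hS.trans (hR r hr').2
      rw [radV, radU, rpow_sub_one hr0.ne']
      generalize arcosh r⁻¹ = s at *
      have hs0 : 0 < s := by linarith
      have hY := (hy s hs0.le).1
      have hD : 0 < r ^ (-α) := rpow_pos_of_pos hr0 _
      have h3 : |z s| ≤ √(α * (α + δ)) * y s := by
        have hk : 0 ≤ α * (α + δ) := by positivity
        refine abs_le_of_sq_le_sq ?_ (by positivity)
        rw [mul_pow, sq_sqrt hk]
        exact hzy s hs0.le
      have h4 : 0 ≤ cosh s / sinh s := by linarith [one_le_coth hs0]
      have h5 : |α * y s + cosh s / sinh s * z s| ≤ (α + 7 / 5 * √(α * (α + δ))) * y s := by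
        refine (abs_add_le _ _).trans ?_
        rw [abs_of_pos (mul_pos hα hY), abs_mul, abs_of_nonneg h4]
        have := mul_le_mul (coth_le hs1) h3 (abs_nonneg _) (by norm_num)
        linarith
      calc |r * (-(r ^ (-α) / r) * (α * y s + cosh s / sinh s * z s))|
          = r ^ (-α) * |α * y s + cosh s / sinh s * z s| := by
            rw [← mul_assoc, mul_neg, mul_div_cancel₀ _ hr0.ne', abs_mul, abs_neg,
              abs_of_pos hD]
        _ ≤ r ^ (-α) * ((α + 7 / 5 * √(α * (α + δ))) * y s) :=
            mul_le_mul_of_nonneg_left h5 hD.le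
        _ = _ := by ring)
  have hpow : ∀ c : ℝ, Tendsto (fun r : ℝ => r ^ c) (𝓝[<] 1) (𝓝 1) := fun c => by
    have := (continuousAt_rpow_const 1 c (Or.inl one_ne_zero)).tendsto
    rw [one_rpow] at this
    exact this.mono_left nhdsWithin_le_nhds
  have hu1 : Tendsto (radU α y) (𝓝[<] 1) (𝓝 b) := by
    have h3 : Tendsto y (𝓝[>] 0) (𝓝 b) := by
      have := (h.cont_y 0 self_mem_Ici).tendsto
      rw [h.y_zero] at this
      exact this.mono_left (nhdsWithin_mono _ Ioi_subset_Ici_self)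
    have := (hpow (-α)).mul (h3.comp tendsto_arcosh_inv_one)
    rwa [one_mul] at this
  obtain ⟨C, hC⟩ := h.bound_z 1
  have hC0 : 0 ≤ C := by simpa using (abs_nonneg _).trans (hC 1 zero_le_one le_rfl)
  have hv1 : ∀ᶠ r in 𝓝[<] 1, |radV α y z r| ≤ 2 * (α * M + cosh 1 * C) := by
    filter_upwards [tendsto_arcosh_inv_one.eventually (Ioo_mem_nhdsGT one_pos),
      (hpow (-α - 1)).eventually (gt_mem_nhds (show (1 : ℝ) < 2 by norm_num)),
      Ioo_mem_nhdsLT (zero_lt_one (α := ℝ))] with r hs h2 hr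
    rw [radV]
    generalize arcosh r⁻¹ = s at *
    have hs0 : 0 < s := hs.1
    have hY := hy s hs0.le
    have hsh : 0 < sinh s := sinh_pos_iff.2 hs0
    have hch : cosh s ≤ cosh 1 := cosh_le_cosh.2 (by
      rw [abs_of_pos hs0, abs_one]
      exact hs.2.le)
    have h4 : cosh s / sinh s * |z s| ≤ cosh 1 * C := by
      rw [div_mul_eq_mul_div, div_le_iff₀ hsh]
      have h5 : s ≤ sinh s := self_le_sinh_iff.2 hs0.le
      calc cosh s * |z s| ≤ cosh 1 * (C * s) :=
            mul_le_mul hch (hC s hs0.le hs.2.le) (abs_nonneg _) (cosh_pos 1).le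
        _ ≤ cosh 1 * (C * sinh s) := by
            have := cosh_pos 1
            gcongr
        _ = _ := by ring
    have h6 : |α * y s + cosh s / sinh s * z s| ≤ α * M + cosh 1 * C := by
      refine (abs_add_le _ _).trans ?_
      rw [abs_of_pos (mul_pos hα hY.1), abs_mul, abs_of_pos (div_pos (cosh_pos s) hsh)]
      have := mul_le_mul_of_nonneg_left hY.2 hα.le
      linarith
    rw [abs_mul, abs_neg, abs_of_pos (rpow_pos_of_pos hr.1 _)]
    exact mul_le_mul h2.le h6 (abs_nonneg _) (by norm_num)
  obtain ⟨U, hU⟩ := hr.exists_contDiffOn hα h0 h1 hu0 hflux hb hu1 hv1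
  exact ⟨l, U, hl, hU⟩

end RegSol

/-- The radial variable turns crossings of the profile into zeros of `u / u_∞ - 1`. -/
lemma encard_crossings {α c : ℝ} (hc : 0 < c) {y U : ℝ → ℝ}
    (hU : ∀ r ∈ Ioo (0 : ℝ) 1, U r = radU α y r) :
    {ρ ∈ Ioo (0 : ℝ) 1 | c * U ρ / (c * ρ ^ (-α)) - 1 = 0}.encard
      = {s | 0 < s ∧ y s = 1}.encard := by
  have hq : ∀ ρ ∈ Ioo (0 : ℝ) 1, c * U ρ / (c * ρ ^ (-α)) - 1 = 0 ↔ y (arcosh ρ⁻¹) = 1 :=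
    fun ρ hρ => by
      have h1 : ρ ^ (-α) ≠ 0 := (rpow_pos_of_pos hρ.1 _).ne'
      rw [hU ρ hρ, radU, ← mul_assoc, mul_div_cancel_left₀ _ (mul_ne_zero hc.ne' h1), sub_eq_zero]
  have hinj : InjOn (fun s => (cosh s)⁻¹) {s | 0 < s ∧ y s = 1} := fun s hs t ht hst =>
    cosh_injOn hs.1.le ht.1.le (inv_injective hst)
  rw [← hinj.encard_image]
  congr 1
  ext ρ
  constructor
  · rintro ⟨hρ, h0⟩
    exact ⟨arcosh ρ⁻¹, ⟨arcosh_inv_pos hρ, (hq ρ hρ).1 h0⟩, by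
      simp only [cosh_arcosh_inv ⟨hρ.1, hρ.2.le⟩, inv_inv]⟩
  · rintro ⟨s, hs, rfl⟩
    have hs0 : 0 < s := hs.1
    have hρ : (cosh s)⁻¹ ∈ Ioo (0 : ℝ) 1 :=
      ⟨inv_pos.2 (cosh_pos s), inv_lt_one_of_one_lt₀ (one_lt_cosh.2 hs0.ne')⟩
    refine ⟨hρ, (hq _ hρ).2 ?_⟩
    rw [inv_inv, arcosh_cosh hs0.le]
    exact hs.2

end SelfSimilar

theorem stmt11 (N : ℕ) (p : ℝ)
    (hNp : (N = 3 ∧ 5 < p) ∨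
      (4 ≤ N ∧ 1 + 4 / ((N : ℝ) - 2) < p ∧ p < 1 + 4 / ((N : ℝ) - 3))) :
    ∀ n : ℕ,
      ∃ (B C : ℝ) (u : ℝ → ℝ),
        bInf N p < B ∧ 0 < C ∧
        ContDiffOn ℝ 2 u (Icc 0 1) ∧
        IsSolOn N p u (Ioo 0 1) ∧
        u 0 = C ∧ derivWithin u (Ici 0) 0 = 0 ∧ u 1 = B ∧
        (∀ x ∈ Icc (0 : ℝ) 1, 0 < u x) ∧
        {ρ ∈ Ioo (0 : ℝ) 1 | u ρ / uInf N p ρ - 1 = 0}.encard =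
          ((2 * n + 1 : ℕ) : ℕ∞) := by
  intro n
  have hN : 3 ≤ N := by rcases hNp with h | h <;> omega
  have hN' : (3 : ℝ) ≤ N := by exact_mod_cast hN
  have hp1 : 1 < p := by
    rcases hNp with ⟨-, h⟩ | ⟨-, h, -⟩
    · linarith
    · have : 0 < 4 / ((N : ℝ) - 2) := div_pos (by norm_num) (by linarith)
      linarith
  set α := alphaP p with hα
  have hα' : α = 2 / (p - 1) := rfl
  have hα0 : 0 < α := by rw [hα']; exact div_pos two_pos (by linarith)
  have hpα : p - 1 = 2 / α := by rw [hα']; field_simp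
  set δ := (N : ℝ) - 2 - 2 * α with hδ
  have hδ0 : 0 < δ := by
    have : α < ((N : ℝ) - 2) / 2 := by
      rw [hα', div_lt_iff₀ (by linarith)]
      rcases hNp with ⟨rfl, h⟩ | ⟨-, h, -⟩
      · push_cast
        linarith
      · have h3 : 4 / ((N : ℝ) - 2) < p - 1 := by linarith
        rw [div_lt_iff₀ (by linarith)] at h3
        linarith
    linarith
  have hδ1 : δ < 1 := by
    rcases hNp with ⟨rfl, h⟩ | ⟨h4, -, h⟩
    · rw [hδ]
      push_cast
      linarith
    · have h4' : (4 : ℝ) ≤ N := by exact_mod_cast h4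
      have : ((N : ℝ) - 3) / 2 < α := by
        rw [hα', lt_div_iff₀ (by linarith)]
        have h3 : p - 1 < 4 / ((N : ℝ) - 3) := by linarith
        rw [lt_div_iff₀ (by linarith)] at h3
        linarith
      linarith
  obtain ⟨b, M, y, z, hb, -, hreg, hy, hcard, ⟨S, hS, hyz⟩, hlim, hzy⟩ :=
    SelfSimilar.exists_power_profile hα0 hδ0 hδ1 (by linarith) n
  obtain ⟨l, U, hl, hU2, hU0, hU1, hUd, hU⟩ := hreg.exists_radial hα0 hδ0 hδ1
    (by linarith) hy hS (fun s hs => (hyz s hs).2) hlim hzy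
  have hκ : α * ((N : ℝ) - 2 - α) = α * (α + δ) := by rw [hδ]; ring
  have hκ0 : 0 < α * (α + δ) := by positivity
  set c := bInf N p with hc
  have hc' : c = (α * (α + δ)) ^ (α / 2) := by rw [← hκ]; rfl
  have hc0 : 0 < c := by rw [hc']; exact Real.rpow_pos_of_pos hκ0 _
  have hcp : c ^ (2 / α) = α * (α + δ) := by
    rw [hc', ← Real.rpow_mul hκ0.le, show α / 2 * (2 / α) = 1 by field_simp, Real.rpow_one]
  have hpos : ∀ r ∈ Ioo (0 : ℝ) 1, 0 < U r := fun r hr => by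
    rw [(hU r hr).1]
    exact (hreg.radSol hα0 fun s hs => (hy s hs).1).pos r hr
  refine ⟨c * b, c * l, fun r => c * U r, lt_mul_of_one_lt_right hc0 hb, mul_pos hc0 hl,
    contDiffOn_const.mul hU2, fun r hr => ?_, by simp only [hU0], ?_, by simp only [hU1],
    fun r hr => mul_pos hc0 ?_, ?_⟩
  · obtain ⟨e0, e1, e2⟩ := hU r hr
    have hode := SelfSimilar.accel_ode (α := α) (δ := δ) (SelfSimilar.radU α y)
      (SelfSimilar.radV α y z) hr
    have h2α : 0 < 2 / α := by positivity
    rw [← e0, ← e1, ← e2, SelfSimilar.reaction, Real.rpow_add (hpos r hr), Real.rpow_one] at hode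
    have hd : deriv (fun r => c * U r) = fun r => c * deriv U r :=
      funext fun r => deriv_const_mul_field c
    simp only [hd]
    rw [deriv_const_mul_field, abs_of_pos (mul_pos hc0 (hpos r hr)), hpα,
      Real.mul_rpow hc0.le (hpos r hr).le, hcp,
      show (N : ℝ) - 1 = 2 * α + 1 + δ by rw [hδ]; ring]
    linear_combination c * hode
  · have hd : DifferentiableWithinAt ℝ U (Ici 0) 0 :=
      ((hU2.differentiableOn (by norm_num)) 0 ⟨le_rfl, zero_le_one⟩).mono_of_mem_nhdsWithin
        (Icc_mem_nhdsGE one_pos)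
    rw [derivWithin_const_mul c hd, hUd, mul_zero]
  · rcases eq_or_lt_of_le hr.1 with rfl | h0
    · rwa [hU0]
    rcases eq_or_lt_of_le hr.2 with rfl | h1
    · rw [hU1]
      linarith
    · exact hpos r ⟨h0, h1⟩
  · rw [← hcard]
    exact SelfSimilar.encard_crossings hc0 fun r hr => (hU r hr).1
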